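/- Let v ∈ W^{1,2}_loc(B) be a weak solution of div(A∇v) = 0 in B = B(0,1) ⊆ ℝ^k, with v not identically zero. Then there exist constants ρ₀ > 0, C₁ > 0 and C₂ > 0, depending only on k, the Lipschitz constant of the entries of A and the ellipticity constant of A, such that for every x ∈ B(0, 1/2) and all radii with 0 < 2r₁ < r₂ < ρ₀, the frequency function satisfies N_v(x, r₁) ≤ C₁ + C₂·N_v(x, r₂). -/

import Mathlib

open MeasureTheory Metric Set
open scoped ENNReal NNReal Topology ContDiff

noncomputable section
attribute [local instance] Classical.propDecidable

abbrev Euc (n : ℕ) := EuclideanSpace ℝ (Fin n)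

/-- The gradient vector of `v` at `x`, as a tuple of partial derivatives. -/
def gradVec {k : ℕ} (v : Euc k → ℝ) (x : Euc k) : Fin k → ℝ :=
  fun i => fderiv ℝ v x (EuclideanSpace.single i 1)

/-- The bilinear form `⟨A ξ, ζ⟩ = ∑ i j, A i j * ξ j * ζ i` associated with a matrix. -/
def aForm {k : ℕ} (A : Matrix (Fin k) (Fin k) ℝ) (ξ ζ : Fin k → ℝ) : ℝ :=
  ∑ i, ∑ j, A i j * ξ j * ζ i

/-- `A` is uniformly elliptic with constant `Λ` on `U`:
`Λ⁻¹|ξ|² ≤ ⟨A(x)ξ, ξ⟩ ≤ Λ|ξ|²` for all `x ∈ U`, `ξ ∈ ℝᵏ`. -/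
def UnifElliptic {k : ℕ} (A : Euc k → Matrix (Fin k) (Fin k) ℝ) (Λ : ℝ) (U : Set (Euc k)) :
    Prop :=
  ∀ x ∈ U, ∀ ξ : Fin k → ℝ,
    Λ⁻¹ * (∑ i, ξ i ^ 2) ≤ aForm (A x) ξ ξ ∧ aForm (A x) ξ ξ ≤ Λ * (∑ i, ξ i ^ 2)

/-- The entries of `A` are Lipschitz with constant `L` on `U`. -/
def LipEntries {k : ℕ} (A : Euc k → Matrix (Fin k) (Fin k) ℝ) (L : ℝ≥0) (U : Set (Euc k)) :
    Prop :=
  ∀ i j, LipschitzOnWith L (fun x => A x i j) U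

/-- `v` is a weak solution of `div(A ∇v) = 0` in `U`:
`∫_U ⟨A(x)∇v(x), ∇ψ(x)⟩ dx = 0` for every test function `ψ ∈ C_c^∞(U)`. -/
def IsWeakSol {k : ℕ} (A : Euc k → Matrix (Fin k) (Fin k) ℝ) (v : Euc k → ℝ)
    (U : Set (Euc k)) : Prop :=
  ∀ ψ : Euc k → ℝ, ContDiff ℝ ∞ ψ → HasCompactSupport ψ → tsupport ψ ⊆ U →
    ∫ x in U, aForm (A x) (gradVec v x) (gradVec ψ x) = 0

/-- `α(x) = ⟨A(x)x, x⟩/|x|²`, with `α(0) = 1`. -/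
def alphaFn {k : ℕ} (A : Euc k → Matrix (Fin k) (Fin k) ℝ) (x : Euc k) : ℝ :=
  if x = 0 then 1 else aForm (A x) (fun i => x i) (fun i => x i) / ‖x‖ ^ 2

/-- `H_v(x,r) = ∫_{B(x,r)} α v²`. -/
def Hfun {k : ℕ} (A : Euc k → Matrix (Fin k) (Fin k) ℝ) (v : Euc k → ℝ) (x : Euc k)
    (r : ℝ) : ℝ :=
  ∫ z in ball x r, alphaFn A z * v z ^ 2

/-- The frequency function `N_v(x,r) = r ∂_r H_v(x,r) / H_v(x,r)`. -/
def freqN {k : ℕ} (A : Euc k → Matrix (Fin k) (Fin k) ℝ) (v : Euc k → ℝ) (x : Euc k)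
    (r : ℝ) : ℝ :=
  r * deriv (Hfun A v x) r / Hfun A v x r

/-- The doubling index `𝒩_v(x,r) = log (H_v(x,2r) / H_v(x,r))`. -/
def doubN {k : ℕ} (A : Euc k → Matrix (Fin k) (Fin k) ℝ) (v : Euc k → ℝ) (x : Euc k)
    (r : ℝ) : ℝ :=
  Real.log (Hfun A v x (2 * r) / Hfun A v x r)

set_option linter.all false

section part1
open scoped Convolution RealInnerProductSpace


section core1
variable {E : Type*} [NormedAddCommGroup E] [InnerProductSpace ℝ E] [FiniteDimensional ℝ E]
  [MeasurableSpace E] [BorelSpace E] {μ : Measure E} [μ.IsAddHaarMeasure]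

theorem lip_of_compact {F : Type*} [NormedAddCommGroup F] {f : E → F} (hf : LocallyLipschitz f)
    (hc : HasCompactSupport f) : ∃ C, LipschitzWith C f := by
  haveI : ProperSpace E := FiniteDimensional.proper ℝ E
  obtain ⟨R, hR⟩ := hc.isBounded.subset_closedBall (0 : E)
  obtain ⟨C, hC⟩ := hf.locallyLipschitzOn.exists_lipschitzOnWith_of_compact
    (isCompact_closedBall (0 : E) (R + 1))
  obtain ⟨M, hM⟩ := hf.continuous.bounded_above_of_compact_support hc
  have hM0 : 0 ≤ M := (norm_nonneg _).trans (hM 0)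
  have key : ∀ y z : E, ‖y‖ ≤ ‖z‖ → dist (f y) (f z) ≤ (max C M.toNNReal : ℝ≥0) * dist y z := by
    intro y z hyz
    have hmax1 : (C : ℝ) ≤ (max C M.toNNReal : ℝ≥0) := by exact_mod_cast le_max_left _ _
    have hmax2 : M ≤ (max C M.toNNReal : ℝ≥0) := by
      calc M = (M.toNNReal : ℝ) := (Real.coe_toNNReal M hM0).symm
        _ ≤ _ := by exact_mod_cast le_max_right _ _
    have zero_of : ∀ x : E, R < ‖x‖ → f x = 0 := by
      intro x hx
      by_contra h
      have := hR (subset_tsupport f h)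
      simp at this
      linarith
    by_cases h1 : ‖z‖ ≤ R + 1
    · have := hC.dist_le_mul y (by simp; linarith) z (by simpa using h1)
      exact this.trans (by gcongr)
    · push Not at h1
      have hz : f z = 0 := zero_of z (by linarith)
      by_cases h2 : ‖y‖ ≤ R
      · have hd : 1 ≤ dist y z := by
          rw [dist_comm, dist_eq_norm]
          have := norm_sub_norm_le z y
          linarith
        rw [hz, dist_zero_right]
        calc ‖f y‖ ≤ M * 1 := by simpa using hM y
          _ ≤ _ := by gcongr
      · rw [hz, zero_of y (by linarith)]; simp; positivity
  refine ⟨max C M.toNNReal, LipschitzWith.of_dist_le_mul fun y z => ?_⟩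
  rcases le_total ‖y‖ ‖z‖ with h | h
  · exact key y z h
  · rw [dist_comm, dist_comm y z]; exact key z y h

theorem int_fderiv_zero {f : E → ℝ} {C : ℝ≥0} (hf : LipschitzWith C f)
    (hc : HasCompactSupport f) (u : E) : ∫ y, fderiv ℝ f y u ∂μ = 0 := by
  have h := LipschitzWith.integral_lineDeriv_mul_eq (μ := μ)
    (LipschitzWith.const (1:ℝ) : LipschitzWith 0 (fun _ : E => (1:ℝ))) hf hc (-u)
  have h0 : ∀ x : E, lineDeriv ℝ (fun _ : E => (1:ℝ)) x (-u) = 0 := by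
    intro x; simp [lineDeriv]
  simp only [h0, zero_mul, integral_zero, neg_neg, mul_one] at h
  rw [h]
  apply integral_congr_ae
  filter_upwards [hf.ae_differentiableAt (μ := μ)] with x hx
  exact hx.lineDeriv_eq_fderiv.symm

theorem locLip_fderiv_bound {f : E → ℝ} {C : ℝ≥0} (hf : LipschitzWith C f) (y : E) :
    ‖fderiv ℝ f y‖ ≤ C := norm_fderiv_le_of_lipschitz ℝ hf

open ContinuousLinearMap Filter in
theorem weak_lip {F : E → E} (hF : Continuous F) (hFc : HasCompactSupport F) {ρ : ℝ}
    (hw : ∀ ψ : E → ℝ, ContDiff ℝ ∞ ψ → HasCompactSupport ψ → tsupport ψ ⊆ ball 0 ρ →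
      ∫ y, fderiv ℝ ψ y (F y) ∂μ = 0) {ψ : E → ℝ} {C : ℝ≥0} (hψ : LipschitzWith C ψ)
    (hψc : HasCompactSupport ψ) {s : ℝ} (hs : s < ρ) (hψs : tsupport ψ ⊆ closedBall 0 s) :
    ∫ y, fderiv ℝ ψ y (F y) ∂μ = 0 := by
  haveI : ProperSpace E := FiniteDimensional.proper ℝ E
  set d : ℝ := (ρ - s) / 2 with hd
  have hd0 : 0 < d := by simp only [hd]; linarith
  let φ : ℕ → ContDiffBump (0 : E) := fun n =>
    ⟨d / (2 * (n + 1)), d / (n + 1), by positivity, by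
      apply div_lt_div_of_pos_left hd0 (by positivity); linarith [(Nat.cast_nonneg n : (0:ℝ) ≤ n)]⟩
  have hφ0 : Tendsto (fun n => (φ n).rOut) atTop (𝓝 0) := by
    have := (tendsto_one_div_add_atTop_nhds_zero_nat (𝕜 := ℝ)).const_mul d
    simpa [φ, div_eq_mul_inv] using this
  have hmeas : Measurable (fderiv ℝ ψ) := measurable_fderiv ℝ ψ
  have hloc : LocallyIntegrable (fderiv ℝ ψ) μ := by
    have : MemLp (fderiv ℝ ψ) ⊤ μ := memLp_top_of_bound hmeas.aestronglyMeasurable C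
      (Filter.Eventually.of_forall fun y => norm_fderiv_le_of_lipschitz ℝ hψ)
    exact this.locallyIntegrable le_top
  have hψloc : LocallyIntegrable ψ μ := hψ.continuous.locallyIntegrable
  set Ψ : ℕ → E → ℝ := fun n => (φ n).normed μ ⋆[lsmul ℝ ℝ, μ] ψ with hΨ
  have hsm : ∀ n, ContDiff ℝ ∞ (Ψ n) := fun n =>
    (φ n).hasCompactSupport_normed.contDiff_convolution_left _ (φ n).contDiff_normed hψloc
  have hder : ∀ n y, fderiv ℝ (Ψ n) y = ((φ n).normed μ ⋆[lsmul ℝ ℝ, μ] fderiv ℝ ψ) y := by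
    intro n y
    apply HasFDerivAt.fderiv
    have hcts : Continuous ((φ n).normed μ) := (φ n).contDiff_normed (n := 0) |>.continuous
    have hint : Integrable ((φ n).normed μ) μ := (φ n).integrable_normed
    simp only [hΨ, convolution_def, lsmul_apply]
    have hqm : ∀ᵐ t ∂μ, DifferentiableAt ℝ ψ (y - t) :=
      (quasiMeasurePreserving_sub_left μ y).ae hψ.ae_differentiableAt
    refine (hasFDerivAt_integral_of_dominated_loc_of_lip (𝕜 := ℝ)
      (F := fun x t => (φ n).normed μ t • ψ (x - t))
      (F' := fun t => (φ n).normed μ t • fderiv ℝ ψ (y - t)) (s := univ)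
      (bound := fun t => (φ n).normed μ t * C)
      Filter.univ_mem ?_ ?_ ?_ ?_ ?_ ?_).2
    · exact Filter.Eventually.of_forall fun x =>
        (hcts.smul (hψ.continuous.comp (continuous_const.sub continuous_id))).aestronglyMeasurable
    · apply Continuous.integrable_of_hasCompactSupport
      · exact (hcts.smul (hψ.continuous.comp (continuous_const.sub continuous_id)))
      · exact ((φ n).hasCompactSupport_normed).smul_right
    · exact (hcts.aestronglyMeasurable).smul
        (hmeas.comp (measurable_const.sub measurable_id)).aestronglyMeasurable
    · refine Filter.Eventually.of_forall fun t => LipschitzWith.lipschitzOnWith ?_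
      apply LipschitzWith.of_dist_le_mul
      intro x z
      have h0 : 0 ≤ (φ n).normed μ t := (φ n).nonneg_normed t
      have := hψ.dist_le_mul (x - t) (z - t)
      simp only [smul_eq_mul, Real.dist_eq, ← mul_sub, abs_mul] at this ⊢
      rw [Real.coe_nnabs, abs_mul, mul_assoc]
      rw [dist_sub_right] at this
      simp only [NNReal.abs_eq]
      gcongr
    · exact hint.mul_const _
    · filter_upwards [hqm] with t ht
      have : HasFDerivAt (fun x => ψ (x - t)) (fderiv ℝ ψ (y - t)) y := by
        have := ht.hasFDerivAt.comp y ((hasFDerivAt_id y).sub_const t)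
        rw [ContinuousLinearMap.comp_id] at this
        exact this
      exact this.fun_const_smul _
  have hsupp : ∀ n, tsupport (Ψ n) ⊆ closedBall 0 (s + d) := by
    intro n
    apply closure_minimal _ isClosed_closedBall
    refine (support_convolution_subset (lsmul ℝ ℝ) (f := (φ n).normed μ)).trans ?_
    rintro _ ⟨x, hx, z, hz, rfl⟩
    rw [(φ n).support_normed_eq] at hx
    have h2 := hψs (subset_tsupport _ hz)
    simp only [mem_ball, dist_zero_right, mem_closedBall] at hx h2 ⊢
    have h3 : (φ n).rOut ≤ d := by
      simp only [φ]
      exact div_le_self hd0.le (by linarith [(Nat.cast_nonneg n : (0:ℝ) ≤ n)])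
    have := norm_add_le x z
    linarith
  have hzero : ∀ n, ∫ y, fderiv ℝ (Ψ n) y (F y) ∂μ = 0 := by
    intro n
    apply hw _ (hsm n)
    · exact HasCompactSupport.of_support_subset_isCompact (isCompact_closedBall 0 (s + d))
        ((subset_tsupport _).trans (hsupp n))
    · refine (hsupp n).trans (closedBall_subset_ball ?_)
      simp only [hd]; linarith
  have hlim : Tendsto (fun n => ∫ y, fderiv ℝ (Ψ n) y (F y) ∂μ) atTop
      (𝓝 (∫ y, fderiv ℝ ψ y (F y) ∂μ)) := by
    apply tendsto_integral_of_dominated_convergence (fun y => C * ‖F y‖)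
    · intro n
      exact (((hsm n).continuous_fderiv (by simp)).clm_apply hF).aestronglyMeasurable
    · exact ((hF.integrable_of_hasCompactSupport hFc).norm).const_mul _
    · intro n
      refine Filter.Eventually.of_forall fun y => ?_
      refine (le_opNorm _ _).trans ?_
      gcongr
      apply norm_fderiv_le_of_lipschitz
      apply LipschitzWith.of_dist_le_mul
      intro x z
      simp only [hΨ, convolution_def, lsmul_apply]
      have hi : ∀ x, Integrable (fun t => (φ n).normed μ t • ψ (x - t)) μ := by
        intro x
        apply Continuous.integrable_of_hasCompactSupport
        · exact (((φ n).contDiff_normed (n := 0) |>.continuous).smul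
            (hψ.continuous.comp (continuous_const.sub continuous_id)))
        · exact ((φ n).hasCompactSupport_normed).smul_right
      rw [dist_eq_norm, ← integral_sub (hi x) (hi z)]
      have : ∀ t, ‖(φ n).normed μ t • ψ (x - t) - (φ n).normed μ t • ψ (z - t)‖ ≤
          (φ n).normed μ t * (C * dist x z) := by
        intro t
        have h0 : 0 ≤ (φ n).normed μ t := (φ n).nonneg_normed t
        have := hψ.dist_le_mul (x - t) (z - t)
        rw [dist_sub_right] at this
        rw [← smul_sub, norm_smul, Real.norm_of_nonneg h0, ← dist_eq_norm]
        gcongr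
      refine (norm_integral_le_of_norm_le ((φ n).integrable_normed.mul_const _)
        (Filter.Eventually.of_forall this)).trans ?_
      rw [integral_mul_const, (φ n).integral_normed, one_mul]
    · have := ContDiffBump.ae_convolution_tendsto_right_of_locallyIntegrable (μ := μ) (K := 2)
        hφ0 (Filter.Eventually.of_forall fun n => ?_) hloc
      · filter_upwards [this] with y hy
        simp only [hder]
        exact ((ContinuousLinearMap.apply ℝ ℝ (F y)).continuous.tendsto _).comp hy
      · simp only [φ]
        apply le_of_eq; field_simp
  simp only [hzero] at hlim
  exact (tendsto_nhds_unique hlim tendsto_const_nhds)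

end core1
end part1

section part2
open scoped Convolution RealInnerProductSpace


section core2
variable {E : Type*} [NormedAddCommGroup E] [InnerProductSpace ℝ E] [FiniteDimensional ℝ E]
  [MeasurableSpace E] [BorelSpace E] {μ : Measure E} [μ.IsAddHaarMeasure]

structure CoreH (μ : Measure E) (a : E → E →L[ℝ] E) (v : E → ℝ) (p : E → E) (lam : ℝ) (K : ℝ≥0)
    (ρ : ℝ) : Prop where
  lam1 : 1 ≤ lam
  lip : LipschitzWith K a
  symm : ∀ y u w, ⟪a y u, w⟫ = ⟪u, a y w⟫
  ell : ∀ y u, ‖u‖ ^ 2 ≤ lam * ⟪a y u, u⟫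
  nrm : ∀ y, ‖a y‖ ≤ lam
  hv : ContDiff ℝ 1 v
  hvc : HasCompactSupport v
  hp : ∀ y h, fderiv ℝ v y h = ⟪p y, h⟫
  weak : ∀ ψ : E → ℝ, ContDiff ℝ ∞ ψ → HasCompactSupport ψ → tsupport ψ ⊆ ball 0 ρ →
      ∫ y, fderiv ℝ ψ y (a y (p y)) ∂μ = 0

theorem LL_smul {F : Type*} [NormedAddCommGroup F] [NormedSpace ℝ F] {f : E → ℝ} {g : E → F}
    (hf : LocallyLipschitz f) (hg : LocallyLipschitz g) : LocallyLipschitz (fun y => f y • g y) :=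
  (contDiff_smul (𝕜 := ℝ) (n := 1) (F := F)).locallyLipschitz.comp (hf.prodMk hg)

theorem LL_mul {f g : E → ℝ}
    (hf : LocallyLipschitz f) (hg : LocallyLipschitz g) : LocallyLipschitz (fun y => f y * g y) :=
  LL_smul hf hg

theorem LL_add {F : Type*} [NormedAddCommGroup F] [NormedSpace ℝ F] {f g : E → F}
    (hf : LocallyLipschitz f) (hg : LocallyLipschitz g) : LocallyLipschitz (fun y => f y + g y) :=
  (contDiff_add (𝕜 := ℝ) (n := 1) (F := F)).locallyLipschitz.comp (hf.prodMk hg)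

theorem LL_sub {F : Type*} [NormedAddCommGroup F] [NormedSpace ℝ F] {f g : E → F}
    (hf : LocallyLipschitz f) (hg : LocallyLipschitz g) : LocallyLipschitz (fun y => f y - g y) :=
  ((contDiff_fst (𝕜 := ℝ) (n := 1) (E := F) (F := F)).sub contDiff_snd).locallyLipschitz.comp
    (hf.prodMk hg)

theorem LL_clm {f : E → E →L[ℝ] E} {g : E → E}
    (hf : LocallyLipschitz f) (hg : LocallyLipschitz g) : LocallyLipschitz (fun y => f y (g y)) :=
  ((contDiff_fst (𝕜 := ℝ) (n := 1) (E := E →L[ℝ] E) (F := E)).clm_apply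
    contDiff_snd).locallyLipschitz.comp (hf.prodMk hg)

theorem LL_inner {f g : E → E}
    (hf : LocallyLipschitz f) (hg : LocallyLipschitz g) :
    LocallyLipschitz (fun y => ⟪f y, g y⟫) :=
  ((contDiff_fst (𝕜 := ℝ) (n := 1) (E := E) (F := E)).inner ℝ
    contDiff_snd).locallyLipschitz.comp (hf.prodMk hg)

namespace CoreH
variable {a : E → E →L[ℝ] E} {v : E → ℝ} {p : E → E} {lam : ℝ} {K : ℝ≥0} {ρ : ℝ}

theorem p_eq (h : CoreH μ a v p lam K ρ) :
    p = fun y => (InnerProductSpace.toDual ℝ E).symm (fderiv ℝ v y) := by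
  ext1 y
  apply ext_inner_right ℝ
  intro w
  rw [InnerProductSpace.toDual_symm_apply, h.hp]

theorem p_cont (h : CoreH μ a v p lam K ρ) : Continuous p := by
  rw [h.p_eq]
  exact (LinearIsometryEquiv.continuous _).comp (h.hv.continuous_fderiv (by simp))

theorem p_supp (h : CoreH μ a v p lam K ρ) : HasCompactSupport p := by
  rw [h.p_eq]
  exact (h.hvc.fderiv ℝ).comp_left (g := (InnerProductSpace.toDual ℝ E).symm) (map_zero _)

theorem F_cont (h : CoreH μ a v p lam K ρ) : Continuous (fun y => a y (p y)) :=
  h.lip.continuous.clm_apply h.p_cont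

theorem F_supp (h : CoreH μ a v p lam K ρ) : HasCompactSupport (fun y => a y (p y)) := by
  apply h.p_supp.mono
  intro y hy hy'
  apply hy
  simp [hy']

theorem v_lip (h : CoreH μ a v p lam K ρ) : ∃ C, LipschitzWith C v :=
  lip_of_compact h.hv.locallyLipschitz h.hvc

theorem weakL (h : CoreH μ a v p lam K ρ) {ψ : E → ℝ} {C : ℝ≥0} (hψ : LipschitzWith C ψ)
    {s : ℝ} (hs : s < ρ) (hψs : ∀ y, s < ‖y‖ → ψ y = 0) :
    ∫ y, fderiv ℝ ψ y (a y (p y)) ∂μ = 0 := by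
  haveI : ProperSpace E := FiniteDimensional.proper ℝ E
  have hsub : tsupport ψ ⊆ closedBall 0 s := by
    apply closure_minimal _ isClosed_closedBall
    intro y hy
    by_contra hc
    exact hy (hψs y (by simpa using hc))
  exact weak_lip h.F_cont h.F_supp h.weak hψ
    (HasCompactSupport.of_support_subset_isCompact (isCompact_closedBall 0 s)
      ((subset_tsupport _).trans hsub)) hs hsub

theorem comp_of_zero {F : Type*} [NormedAddCommGroup F] {f : E → F} {s : ℝ}
    (h : ∀ y, s < ‖y‖ → f y = 0) : HasCompactSupport f := by
  haveI : ProperSpace E := FiniteDimensional.proper ℝ E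
  apply HasCompactSupport.of_support_subset_isCompact (isCompact_closedBall 0 s)
  intro y hy
  by_contra hc
  exact hy (h y (by simpa using hc))

theorem fderiv_zero_of_zero {F : Type*} [NormedAddCommGroup F] [NormedSpace ℝ F] {f : E → F} {s : ℝ}
    (h : ∀ y, s < ‖y‖ → f y = 0) (y : E) (hy : s < ‖y‖) : fderiv ℝ f y = 0 := by
  have : f =ᶠ[𝓝 y] fun _ => 0 := by
    filter_upwards [(isOpen_lt continuous_const continuous_norm).mem_nhds hy] with z hz
    exact h z hz
  rw [this.fderiv_eq]; simp

set_option maxHeartbeats 1000000 in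
open Filter in
theorem rellich_scalar (h : CoreH μ a v p lam K ρ) {ζ : E → ℝ} {C : ℝ≥0} (hζ : LipschitzWith C ζ)
    {s : ℝ} (hs : s < ρ) (hζs : ∀ y, s < ‖y‖ → ζ y = 0) (u : E) :
    ∫ y, (2 * (fderiv ℝ ζ y (a y (p y)) * ⟪p y, u⟫)
      - ⟪fderiv ℝ (fun y => ζ y • a y) y u (p y), p y⟫) ∂μ = 0 := by
  haveI : ProperSpace E := FiniteDimensional.proper ℝ E
  have pc := h.p_cont
  have Fc := h.F_cont
  have ac := h.lip.continuous
  have vc := h.hv.continuous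
  have ζc := hζ.continuous
  set F : E → E := fun y => a y (p y) with hF
  set m : E → E →L[ℝ] E := fun y => ζ y • a y with hm
  obtain ⟨Cv, hCv⟩ := h.v_lip
  have hms : ∀ y, s < ‖y‖ → m y = 0 := fun y hy => by simp [hm, hζs y hy]
  obtain ⟨Cm, hCm⟩ := lip_of_compact (LL_smul hζ.locallyLipschitz h.lip.locallyLipschitz)
    (comp_of_zero hms)
  have mc : Continuous m := hCm.continuous
  obtain ⟨Mp, hMp⟩ := pc.bounded_above_of_compact_support h.p_supp
  obtain ⟨MF, hMF⟩ := Fc.bounded_above_of_compact_support h.F_supp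
  obtain ⟨Mz, hMz⟩ := ζc.bounded_above_of_compact_support (comp_of_zero hζs)
  have hMp0 : 0 ≤ Mp := (norm_nonneg _).trans (hMp 0)
  have hMF0 : 0 ≤ MF := (norm_nonneg _).trans (hMF 0)
  have hMz0 : 0 ≤ Mz := (norm_nonneg _).trans (hMz 0)
  obtain ⟨R1, hR1⟩ := h.p_supp.isBounded.subset_closedBall (0 : E)
  have hp0 : ∀ y, R1 < ‖y‖ → p y = 0 := by
    intro y hy
    by_contra hc
    have := hR1 (subset_tsupport p hc)
    simp at this; linarith
  -- the test function
  set ψ : ℝ → E → ℝ := fun t y => ζ y * (v (y + t • u) - v y) with hψ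
  have hψs : ∀ t y, s < ‖y‖ → ψ t y = 0 := fun t y hy => by simp [hψ, hζs y hy]
  have shiftLL : ∀ t : ℝ, LocallyLipschitz (fun y : E => y + t • u) := fun t =>
    (contDiff_id.add contDiff_const : ContDiff ℝ 1 (fun y : E => y + t • u)).locallyLipschitz
  have hψL : ∀ t, ∃ D, LipschitzWith D (ψ t) := fun t =>
    lip_of_compact (LL_mul hζ.locallyLipschitz (LL_sub (h.hv.locallyLipschitz.comp (shiftLL t))
      h.hv.locallyLipschitz)) (comp_of_zero (hψs t))
  have hA1 : ∀ t, ∫ y, fderiv ℝ (ψ t) y (F y) ∂μ = 0 := by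
    intro t
    obtain ⟨D, hD⟩ := hψL t
    exact h.weakL hD hs (hψs t)
  have hA2 : ∀ᶠ t in 𝓝[≠] (0:ℝ), ∫ y, fderiv ℝ (ψ t) y (F (y + t • u)) ∂μ = 0 := by
    have hcont : Continuous (fun t : ℝ => s + ‖t • u‖) := by fun_prop
    have : ∀ᶠ t in 𝓝 (0:ℝ), s + ‖t • u‖ < ρ := by
      apply hcont.continuousAt.eventually_lt continuousAt_const
      simpa using hs
    filter_upwards [nhdsWithin_le_nhds this] with t ht
    obtain ⟨D, hD⟩ := hψL t
    have hz : ∀ y, s + ‖t • u‖ < ‖y‖ → ψ t (y - t • u) = 0 := by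
      intro y hy
      apply hψs
      have := norm_sub_norm_le y (t • u)
      linarith
    have hD' : LipschitzWith (D * 1) (fun y => ψ t (y - t • u)) := by
      apply hD.comp
      apply LipschitzWith.of_dist_le_mul; intro y z; simp
    have key := h.weakL hD' ht hz
    have e1 : ∀ y, fderiv ℝ (fun y => ψ t (y - t • u)) y = fderiv ℝ (ψ t) (y - t • u) :=
      fun y => by simp only [fderiv_comp_sub]
    simp only [e1] at key
    rw [← integral_sub_right_eq_self _ (t • u)]
    simpa using key
  set Θ : ℝ → E → ℝ := fun t y => t⁻¹ * (fderiv ℝ (ψ t) y (F y) + fderiv ℝ (ψ t) y (F (y + t • u))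
    - ζ y * ⟪a y (p (y + t • u)), p (y + t • u)⟫ + ⟪m (y + t • (-u)) (p y), p y⟫) with hΘ
  have hsh : ∀ t : ℝ, Continuous (fun y : E => y + t • u) := fun t => by fun_prop
  have hsh' : ∀ t : ℝ, Continuous (fun y : E => y + t • (-u)) := fun t => by fun_prop
  have mD : ∀ t, ∀ G : E → E, Continuous G → Measurable (fun y => fderiv ℝ (ψ t) y (G y)) := by
    intro t G hG
    have h1 := measurable_fderiv ℝ (ψ t)
    exact (ContinuousLinearMap.measurable_apply₂).comp (h1.prodMk hG.measurable) 
  have iD : ∀ t, ∀ G : E → E, Continuous G → Integrable (fun y => fderiv ℝ (ψ t) y (G y)) μ := by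
    intro t G hG
    obtain ⟨D, hD⟩ := hψL t
    obtain ⟨B, hB⟩ := (isCompact_closedBall (0:E) s).exists_bound_of_continuousOn hG.continuousOn
    have : Integrable (indicator (closedBall (0:E) s) (fun _ => (D : ℝ) * B)) μ :=
      (integrable_indicator_iff isClosed_closedBall.measurableSet).2
        (integrableOn_const (isCompact_closedBall _ _).measure_lt_top.ne)
    refine this.mono' (mD t G hG).aestronglyMeasurable (Eventually.of_forall fun y => ?_)
    by_cases hy : y ∈ closedBall (0:E) s
    · rw [indicator_of_mem hy]
      refine (ContinuousLinearMap.le_opNorm _ _).trans ?_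
      have := hB y hy
      have h2 := norm_fderiv_le_of_lipschitz ℝ hD (x₀ := y)
      gcongr
    · rw [indicator_of_notMem hy, fderiv_zero_of_zero (hψs t) y (by simpa using hy)]
      simp
  have i3 : ∀ t : ℝ, Integrable (fun y => ζ y * ⟪a y (p (y + t • u)), p (y + t • u)⟫) μ := by
    intro t
    apply Continuous.integrable_of_hasCompactSupport
    · exact ζc.mul ((ac.clm_apply (pc.comp (hsh t))).inner (pc.comp (hsh t)))
    · exact comp_of_zero (s := s) (fun y hy => by simp [hζs y hy])
  have i4 : ∀ t : ℝ, Integrable (fun y => ⟪m (y + t • (-u)) (p y), p y⟫) μ := by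
    intro t
    apply Continuous.integrable_of_hasCompactSupport
    · exact (((mc.comp (hsh' t)).clm_apply pc).inner pc)
    · exact comp_of_zero (s := R1) (fun y hy => by simp [hp0 y hy])
  have hΘ0 : ∀ᶠ t in 𝓝[≠] (0:ℝ), ∫ y, Θ t y ∂μ = 0 := by
    filter_upwards [hA2] with t ht
    simp only [hΘ]
    rw [integral_const_mul, integral_add, integral_sub, integral_add, hA1, ht]
    · have : ∫ y, ⟪m (y + t • (-u)) (p y), p y⟫ ∂μ =
          ∫ y, ζ y * ⟪a y (p (y + t • u)), p (y + t • u)⟫ ∂μ := by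
        rw [← integral_add_right_eq_self _ (t • u)]
        congr 1; ext y
        simp [hm, inner_smul_left]
      rw [this]; ring
    · exact iD t F Fc
    · exact iD t _ (Fc.comp (hsh t))
    · exact (iD t F Fc).add (iD t _ (Fc.comp (hsh t)))
    · exact i3 t
    · exact ((iD t F Fc).add (iD t _ (Fc.comp (hsh t)))).sub (i3 t)
    · exact i4 t
  have vdiff : Differentiable ℝ v := h.hv.differentiable (by simp)
  have hrew : ∀ᵐ y ∂μ, ∀ t : ℝ, Θ t y = fderiv ℝ ζ y (F y + F (y + t • u)) *
      (t⁻¹ * (v (y + t • u) - v y)) +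
      ζ y * ⟪p (y + t • u) - p y, (t⁻¹ • (a (y + t • u) - a y)) (p (y + t • u))⟫ +
      ⟪(t⁻¹ • (m (y + t • (-u)) - m y)) (p y), p y⟫ := by
    filter_upwards [hζ.ae_differentiableAt (μ := μ)] with y hy t
    have d1 : ∀ G, fderiv ℝ (ψ t) y G = fderiv ℝ ζ y G * (v (y + t • u) - v y) +
        ζ y * ⟪p (y + t • u) - p y, G⟫ := by
      intro G
      have e1 : HasFDerivAt (fun y => v (y + t • u)) (fderiv ℝ v (y + t • u)) y := by
        have := (vdiff (y + t • u)).hasFDerivAt.comp y ((hasFDerivAt_id y).add_const (t • u))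
        rw [ContinuousLinearMap.comp_id] at this
        exact this
      have e2 := hy.hasFDerivAt.mul (e1.sub (vdiff y).hasFDerivAt)
      have e3 : fderiv ℝ (ψ t) y = _ := e2.fderiv
      rw [e3]
      simp [h.hp, inner_sub_left]
      ring
    simp only [hΘ, d1]
    have s1 : ⟪p (y + t • u), a y (p y)⟫ = ⟪p y, a y (p (y + t • u))⟫ := by
      rw [← h.symm, real_inner_comm]
    have s2 : ⟪a y (p (y + t • u)), p (y + t • u)⟫ = ⟪p (y + t • u), a y (p (y + t • u))⟫ :=
      h.symm _ _ _
    have s3 : ⟪a y (p y), p y⟫ = ⟪p y, a y (p y)⟫ := h.symm _ _ _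
    simp only [hF, hm, map_add, ContinuousLinearMap.smul_apply, ContinuousLinearMap.sub_apply,
      inner_smul_left, inner_smul_right, inner_sub_left, inner_sub_right, s1, s2, s3]
    simp
    ring
  have hlim : Tendsto (fun t => ∫ y, Θ t y ∂μ) (𝓝[≠] 0)
      (𝓝 (∫ y, (2 * (fderiv ℝ ζ y (a y (p y)) * ⟪p y, u⟫)
      - ⟪fderiv ℝ (fun y => ζ y • a y) y u (p y), p y⟫) ∂μ)) := by
    set Mt : ℝ := C * (MF + MF) * (Cv * ‖u‖) + Mz * ((Mp + Mp) * ((K * ‖u‖) * Mp)) +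
      Cm * ‖u‖ * Mp * Mp with hMt
    have hMt0 : 0 ≤ Mt := by positivity
    apply tendsto_integral_filter_of_dominated_convergence
      (indicator (closedBall (0:E) (max s R1)) (fun _ => Mt))
    · refine Eventually.of_forall fun t => ?_
      exact (((((iD t F Fc).add (iD t _ (Fc.comp (hsh t)))).sub (i3 t)).add
        (i4 t)).const_mul t⁻¹).aestronglyMeasurable
    · filter_upwards [self_mem_nhdsWithin] with t ht
      have ht0 : 0 < |t| := abs_pos.2 ht
      filter_upwards [hrew] with y hy
      rw [hy t]
      by_cases hyR : y ∈ closedBall (0:E) (max s R1)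
      · rw [indicator_of_mem hyR]
        have b1 : ‖t⁻¹ * (v (y + t • u) - v y)‖ ≤ Cv * ‖u‖ := by
          have := hCv.dist_le_mul (y + t • u) y
          rw [dist_eq_norm, dist_eq_norm, add_sub_cancel_left, norm_smul, Real.norm_eq_abs t] at this
          rw [norm_mul, norm_inv, Real.norm_eq_abs t, inv_mul_le_iff₀ ht0]
          linarith
        have b2 : ‖t⁻¹ • (a (y + t • u) - a y)‖ ≤ K * ‖u‖ := by
          have := h.lip.dist_le_mul (y + t • u) y
          rw [dist_eq_norm, dist_eq_norm, add_sub_cancel_left, norm_smul, Real.norm_eq_abs t] at this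
          rw [norm_smul, norm_inv, Real.norm_eq_abs t, inv_mul_le_iff₀ ht0]
          linarith
        have b3 : ‖t⁻¹ • (m (y + t • (-u)) - m y)‖ ≤ Cm * ‖u‖ := by
          have := hCm.dist_le_mul (y + t • (-u)) y
          rw [dist_eq_norm, dist_eq_norm, add_sub_cancel_left, norm_smul, norm_neg,
            Real.norm_eq_abs t] at this
          rw [norm_smul, norm_inv, Real.norm_eq_abs t, inv_mul_le_iff₀ ht0]
          linarith
        have c1 : ‖fderiv ℝ ζ y (F y + F (y + t • u))‖ ≤ C * (MF + MF) := by
          refine (ContinuousLinearMap.le_opNorm _ _).trans ?_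
          gcongr
          · exact norm_fderiv_le_of_lipschitz ℝ hζ
          · exact (norm_add_le _ _).trans (add_le_add (hMF _) (hMF _))
        have c2 : ‖⟪p (y + t • u) - p y, (t⁻¹ • (a (y + t • u) - a y)) (p (y + t • u))⟫‖ ≤
            (Mp + Mp) * ((K * ‖u‖) * Mp) := by
          refine (norm_inner_le_norm _ _).trans ?_
          gcongr
          · exact (norm_sub_le _ _).trans (add_le_add (hMp _) (hMp _))
          · refine (ContinuousLinearMap.le_opNorm _ _).trans ?_
            gcongr
            exact hMp _
        have c3 : ‖⟪(t⁻¹ • (m (y + t • (-u)) - m y)) (p y), p y⟫‖ ≤ Cm * ‖u‖ * Mp * Mp := by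
          refine (norm_inner_le_norm _ _).trans ?_
          gcongr
          · refine (ContinuousLinearMap.le_opNorm _ _).trans ?_
            gcongr
            exact hMp _
          · exact hMp _
        refine (norm_add_le _ _).trans (add_le_add ((norm_add_le _ _).trans (add_le_add ?_ ?_)) c3)
        · rw [norm_mul]; gcongr
        · rw [norm_mul]; gcongr; exact hMz _
      · rw [indicator_of_notMem hyR]
        simp only [mem_closedBall, dist_zero_right, not_le, max_lt_iff] at hyR
        rw [fderiv_zero_of_zero hζs y hyR.1, hζs y hyR.1, hp0 y hyR.2]
        simp
    · exact (integrable_indicator_iff isClosed_closedBall.measurableSet).2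
        (integrableOn_const (isCompact_closedBall _ _).measure_lt_top.ne)
    · filter_upwards [hrew, hCm.ae_differentiableAt (μ := μ)] with y hy hmd
      simp only [hy]
      have sh : Tendsto (fun t : ℝ => y + t • u) (𝓝[≠] 0) (𝓝 y) := by
        have : Continuous (fun t : ℝ => y + t • u) := by fun_prop
        have h2 := this.tendsto 0
        simp only [zero_smul, add_zero] at h2
        exact h2.mono_left nhdsWithin_le_nhds
      have l1 : Tendsto (fun t : ℝ => t⁻¹ * (v (y + t • u) - v y)) (𝓝[≠] 0) (𝓝 ⟪p y, u⟫) := by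
        have := ((vdiff y).hasFDerivAt.hasLineDerivAt u).tendsto_slope_zero
        rw [h.hp] at this
        exact this
      have l2 : Tendsto (fun t : ℝ => t⁻¹ • (m (y + t • (-u)) - m y)) (𝓝[≠] 0)
          (𝓝 (fderiv ℝ m y (-u))) :=
        (hmd.hasFDerivAt.hasLineDerivAt (-u)).tendsto_slope_zero
      have l3 : Tendsto (fun t : ℝ => fderiv ℝ ζ y (F y + F (y + t • u))) (𝓝[≠] 0)
          (𝓝 (fderiv ℝ ζ y (F y + F y))) :=
        ((fderiv ℝ ζ y).continuous.tendsto _).comp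
          (tendsto_const_nhds.add ((Fc.tendsto y).comp sh))
      have l4 : Tendsto (fun t : ℝ => ⟪(t⁻¹ • (m (y + t • (-u)) - m y)) (p y), p y⟫) (𝓝[≠] 0)
          (𝓝 ⟪fderiv ℝ m y (-u) (p y), p y⟫) := by
        have hc : Continuous (fun T : E →L[ℝ] E => ⟪T (p y), p y⟫) := by fun_prop
        exact (hc.tendsto _).comp l2
      have l5 : Tendsto (fun t : ℝ => ζ y * ⟪p (y + t • u) - p y,
          (t⁻¹ • (a (y + t • u) - a y)) (p (y + t • u))⟫) (𝓝[≠] 0) (𝓝 0) := by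
        have z1 : Tendsto (fun t : ℝ => Mz * (‖p (y + t • u) - p y‖ * ((K * ‖u‖) * Mp)))
            (𝓝[≠] 0) (𝓝 0) := by
          have : Tendsto (fun t : ℝ => ‖p (y + t • u) - p y‖) (𝓝[≠] 0) (𝓝 0) := by
            have h1 := (((pc.tendsto y).comp sh).sub_const (p y)).norm
            simpa using h1
          simpa using (this.mul_const ((K * ‖u‖) * Mp)).const_mul Mz
        apply squeeze_zero_norm' _ z1
        filter_upwards [self_mem_nhdsWithin] with t ht
        have ht0 : 0 < |t| := abs_pos.2 ht
        have b2 : ‖t⁻¹ • (a (y + t • u) - a y)‖ ≤ K * ‖u‖ := by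
          have := h.lip.dist_le_mul (y + t • u) y
          rw [dist_eq_norm, dist_eq_norm, add_sub_cancel_left, norm_smul, Real.norm_eq_abs t] at this
          rw [norm_smul, norm_inv, Real.norm_eq_abs t, inv_mul_le_iff₀ ht0]
          linarith
        rw [norm_mul]
        gcongr
        · exact hMz _
        · refine (norm_inner_le_norm _ _).trans ?_
          gcongr
          refine (ContinuousLinearMap.le_opNorm _ _).trans ?_
          gcongr
          exact hMp _
      have := ((l3.mul l1).add l5).add l4
      convert this using 2
      simp [hF, map_add]
      ring
  have : Tendsto (fun t => ∫ y, Θ t y ∂μ) (𝓝[≠] 0) (𝓝 0) :=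
    tendsto_const_nhds.congr' (hΘ0.mono fun t ht => ht.symm)
  exact tendsto_nhds_unique hlim this

end CoreH
end core2
end part2

section part3
open scoped Convolution RealInnerProductSpace


section core3
variable {E : Type*} [NormedAddCommGroup E] [InnerProductSpace ℝ E] [FiniteDimensional ℝ E]
  [MeasurableSpace E] [BorelSpace E] {μ : Measure E} [μ.IsAddHaarMeasure]

structure GH (G : E →L[ℝ] E) (lam : ℝ) : Prop where
  lam1 : 1 ≤ lam
  symm : ∀ u w, ⟪G u, w⟫ = ⟪u, G w⟫
  ell : ∀ u, ‖u‖ ^ 2 ≤ lam * ⟪G u, u⟫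
  nrm : ‖G‖ ≤ lam

namespace GH
variable {G : E →L[ℝ] E} {lam : ℝ}

theorem q_nonneg (h : GH G lam) (y : E) : 0 ≤ ⟪G y, y⟫ := by
  have := h.ell y
  have h1 := h.lam1
  by_contra hc
  push Not at hc
  nlinarith [sq_nonneg ‖y‖]

theorem q_pos (h : GH G lam) {y : E} (hy : y ≠ 0) : 0 < ⟪G y, y⟫ := by
  have := h.ell y
  have h1 := h.lam1
  have h2 : 0 < ‖y‖ := norm_pos_iff.2 hy
  by_contra hc
  push Not at hc
  nlinarith [sq_nonneg ‖y‖]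

theorem q_cont (h : GH G lam) : Continuous (fun y => ⟪G y, y⟫) := by fun_prop

theorem q_lt (h : GH G lam) {r : ℝ} (hr : 0 ≤ r) {y : E} (hy : ⟪G y, y⟫ < r ^ 2) :
    ‖y‖ < lam * r := by
  have h1 := h.ell y
  have h2 := h.lam1
  apply lt_of_pow_lt_pow_left₀ 2 (by positivity)
  have : ‖y‖ ^ 2 < lam * r ^ 2 := by nlinarith
  nlinarith [sq_nonneg r]

theorem null_level (h : GH G lam) {r : ℝ} (hr : 0 < r) : μ {y | ⟪G y, y⟫ = r ^ 2} = 0 := by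
  have hconv : Convex ℝ {y : E | ⟪G y, y⟫ ≤ r ^ 2} := by
    intro y hy z hz s t hs ht hst
    simp only [mem_setOf_eq] at *
    have h0 := h.q_nonneg (y - z)
    have e : ⟪G y, z⟫ = ⟪G z, y⟫ := by rw [h.symm, real_inner_comm]
    simp only [map_sub, map_add, map_smul, inner_sub_left, inner_sub_right, inner_add_left,
      inner_add_right, inner_smul_left, inner_smul_right, e, conj_trivial] at h0 ⊢
    have ht' : t = 1 - s := by linarith
    subst ht'
    nlinarith [mul_nonneg hs ht]
  have := hconv.addHaar_frontier μ
  refine measure_mono_null ?_ this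
  intro y hy
  simp only [mem_setOf_eq] at hy
  refine ⟨subset_closure (by simp [hy]), ?_⟩
  intro hint
  rw [mem_interior_iff_mem_nhds] at hint
  have hc : Continuous (fun t : ℝ => (1 + t) • y) := by fun_prop
  have h2 : Filter.Tendsto (fun t : ℝ => (1 + t) • y) (𝓝[>] 0) (𝓝 y) := by
    have := hc.tendsto 0
    simp only [add_zero, one_smul] at this
    exact this.mono_left nhdsWithin_le_nhds
  have h3 := h2.eventually hint
  obtain ⟨t, ht, ht0⟩ := (h3.and self_mem_nhdsWithin).exists
  simp only [mem_setOf_eq, map_smul, inner_smul_left, inner_smul_right, hy, conj_trivial,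
    mem_Ioi] at ht ht0
  nlinarith [pow_pos hr 2, mul_pos ht0 (pow_pos hr 2)]

theorem W_deriv (h : GH G lam) {f : E → ℝ} (hf : Integrable f μ) {r : ℝ} (hr : 0 < r) :
    HasDerivAt (fun x : ℝ => ∫ y, max (x ^ 2 - ⟪G y, y⟫) 0 * f y ∂μ)
      (2 * r * ∫ y in {y | ⟪G y, y⟫ < r ^ 2}, f y ∂μ) r := by
  have qc := h.q_cont
  have hm : MeasurableSet {y | ⟪G y, y⟫ < r ^ 2} := (isOpen_lt qc continuous_const).measurableSet
  rw [← integral_indicator hm, ← integral_const_mul]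
  refine (hasDerivAt_integral_of_dominated_loc_of_lip (s := ball r 1)
    (F := fun x y => max (x ^ 2 - ⟪G y, y⟫) 0 * f y)
    (F' := fun y => 2 * r * indicator {y | ⟪G y, y⟫ < r ^ 2} f y)
    (bound := fun y => 2 * (r + 1) * ‖f y‖) (ball_mem_nhds r one_pos) ?_ ?_ ?_ ?_ ?_ ?_).2
  · refine Filter.Eventually.of_forall fun x => ?_
    have : Continuous (fun y => max (x ^ 2 - ⟪G y, y⟫) 0) :=
      (continuous_const.sub qc).max continuous_const
    exact this.aestronglyMeasurable.mul hf.aestronglyMeasurable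
  · have : Continuous (fun y => max (r ^ 2 - ⟪G y, y⟫) 0) :=
      (continuous_const.sub qc).max continuous_const
    refine hf.bdd_mul (c := r ^ 2) this.aestronglyMeasurable (Filter.Eventually.of_forall fun y => ?_)
    rw [Real.norm_of_nonneg (le_max_right _ _)]
    exact max_le (by linarith [h.q_nonneg y]) (by positivity)
  · exact ((hf.indicator hm).const_mul _).aestronglyMeasurable
  · refine Filter.Eventually.of_forall fun y => ?_
    apply LipschitzOnWith.of_dist_le_mul
    intro x hx z hz
    rw [mem_ball, Real.dist_eq, abs_lt] at hx hz
    rw [Real.dist_eq, Real.dist_eq, ← sub_mul, abs_mul, Real.coe_nnabs, abs_mul, Real.norm_eq_abs,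
      abs_abs]
    have h1 : |max (x ^ 2 - ⟪G y, y⟫) 0 - max (z ^ 2 - ⟪G y, y⟫) 0| ≤
        |x ^ 2 - ⟪G y, y⟫ - (z ^ 2 - ⟪G y, y⟫)| := abs_max_sub_max_le_abs _ _ _
    have h2 : x ^ 2 - ⟪G y, y⟫ - (z ^ 2 - ⟪G y, y⟫) = (x + z) * (x - z) := by ring
    rw [h2, abs_mul] at h1
    have h3 : |x + z| ≤ |2 * (r + 1)| := by
      rw [abs_of_pos (by linarith : 0 < 2 * (r + 1)), abs_le]; constructor <;> linarith
    calc _ ≤ |x + z| * |x - z| * |f y| := by gcongr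
      _ ≤ |2 * (r + 1)| * |x - z| * |f y| := by gcongr
      _ = _ := by ring
  · exact hf.norm.const_mul _
  · have hn : ∀ᵐ y ∂μ, ⟪G y, y⟫ ≠ r ^ 2 := by
      rw [ae_iff]; simpa using h.null_level (μ := μ) hr
    filter_upwards [hn] with y hy
    have hd : HasDerivAt (fun x : ℝ => x ^ 2 - ⟪G y, y⟫) (2 * r) r := by
      simpa using (hasDerivAt_pow 2 r).sub_const ⟪G y, y⟫
    rcases lt_or_gt_of_ne hy with hlt | hgt
    · rw [indicator_of_mem (by exact hlt)]
      apply HasDerivAt.mul_const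
      apply hd.congr_of_eventuallyEq
      have : ∀ᶠ x in 𝓝 r, ⟪G y, y⟫ < x ^ 2 := continuousAt_const.eventually_lt (by fun_prop) hlt
      filter_upwards [this] with x hx
      exact max_eq_left (by linarith)
    · rw [indicator_of_notMem (by simpa using hgt.le), mul_zero]
      have : (fun x : ℝ => max (x ^ 2 - ⟪G y, y⟫) 0 * f y) =ᶠ[𝓝 r] fun _ => 0 := by
        have : ∀ᶠ x in 𝓝 r, x ^ 2 < ⟪G y, y⟫ := ContinuousAt.eventually_lt (by fun_prop) continuousAt_const hgt
        filter_upwards [this] with x hx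
        rw [max_eq_right (by linarith), zero_mul]
      exact (hasDerivAt_const r (0:ℝ)).congr_of_eventuallyEq this

end GH

namespace CoreH
variable {a : E → E →L[ℝ] E} {v : E → ℝ} {p : E → E} {lam : ℝ} {K : ℝ≥0} {ρ : ℝ}
  {k : ℕ}

theorem rellich_int (h : CoreH μ a v p lam K ρ) {ζ : E → ℝ} {C : ℝ≥0} (hζ : LipschitzWith C ζ)
    {s : ℝ} (hζs : ∀ y, s < ‖y‖ → ζ y = 0) (u : E) :
    Integrable (fun y => (2 * (fderiv ℝ ζ y (a y (p y)) * ⟪p y, u⟫)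
      - ⟪fderiv ℝ (fun y => ζ y • a y) y u (p y), p y⟫)) μ := by
  have pc := h.p_cont
  have Fc := h.F_cont
  obtain ⟨Cm, hCm⟩ := lip_of_compact (LL_smul hζ.locallyLipschitz h.lip.locallyLipschitz)
    (comp_of_zero (s := s) (fun y hy => by simp [hζs y hy]))
  have mm : Measurable (fun y => ⟪fderiv ℝ (fun y => ζ y • a y) y u (p y), p y⟫) := by
    have h1 : Measurable (fun y => fderiv ℝ (fun y => ζ y • a y) y u) :=
      measurable_fderiv_apply_const ℝ _ u
    have h2 : Measurable (fun y => fderiv ℝ (fun y => ζ y • a y) y u (p y)) :=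
      ContinuousLinearMap.measurable_apply₂.comp (h1.prodMk pc.measurable)
    exact h2.inner pc.measurable
  have m1 : Measurable (fun y => fderiv ℝ ζ y (a y (p y))) :=
    ContinuousLinearMap.measurable_apply₂.comp ((measurable_fderiv ℝ ζ).prodMk Fc.measurable)
  have ip : Integrable (fun y => ‖p y‖ ^ 2) μ := by
    apply Continuous.integrable_of_hasCompactSupport (by fun_prop)
    apply h.p_supp.mono
    intro y hy hy'
    exact hy (by simp [hy'])
  have l0 : 0 ≤ lam := by linarith [h.lam1]
  apply Integrable.sub
  · apply Integrable.const_mul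
    refine (ip.const_mul (C * lam * ‖u‖)).mono' (m1.mul (pc.measurable.inner measurable_const)).aestronglyMeasurable
      (Filter.Eventually.of_forall fun y => ?_)
    rw [norm_mul]
    have h1 : ‖fderiv ℝ ζ y (a y (p y))‖ ≤ C * (lam * ‖p y‖) := by
      refine (ContinuousLinearMap.le_opNorm _ _).trans ?_
      gcongr
      · exact norm_fderiv_le_of_lipschitz ℝ hζ
      · refine (ContinuousLinearMap.le_opNorm _ _).trans ?_
        gcongr
        exact h.nrm y
    have h2 : ‖⟪p y, u⟫‖ ≤ ‖p y‖ * ‖u‖ := norm_inner_le_norm _ _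
    calc _ ≤ (C * (lam * ‖p y‖)) * (‖p y‖ * ‖u‖) := by gcongr
      _ = _ := by ring
  · refine (ip.const_mul (Cm * ‖u‖)).mono' mm.aestronglyMeasurable
      (Filter.Eventually.of_forall fun y => ?_)
    refine (norm_inner_le_norm _ _).trans ?_
    have : ‖fderiv ℝ (fun y => ζ y • a y) y u (p y)‖ ≤ Cm * ‖u‖ * ‖p y‖ := by
      refine (ContinuousLinearMap.le_opNorm _ _).trans ?_
      gcongr
      refine (ContinuousLinearMap.le_opNorm _ _).trans ?_
      gcongr
      exact norm_fderiv_le_of_lipschitz ℝ hCm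
    calc _ ≤ Cm * ‖u‖ * ‖p y‖ * ‖p y‖ := by gcongr
      _ = _ := by ring

theorem rellich_vec (b : OrthonormalBasis (Fin k) ℝ E) (h : CoreH μ a v p lam K ρ) {ζ : E → E}
    {C : ℝ≥0} (hζ : LipschitzWith C ζ)
    {s : ℝ} (hs : s < ρ) (hζs : ∀ y, s < ‖y‖ → ζ y = 0) :
    Integrable (fun y => (2 * ⟪fderiv ℝ ζ y (a y (p y)), p y⟫
      - (∑ i, ⟪fderiv ℝ ζ y (b i), b i⟫) * ⟪a y (p y), p y⟫
      - ⟪fderiv ℝ a y (ζ y) (p y), p y⟫)) μ ∧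
    ∫ y, (2 * ⟪fderiv ℝ ζ y (a y (p y)), p y⟫
      - (∑ i, ⟪fderiv ℝ ζ y (b i), b i⟫) * ⟪a y (p y), p y⟫
      - ⟪fderiv ℝ a y (ζ y) (p y), p y⟫) ∂μ = 0 := by
  have hL : ∀ i, ∃ D, LipschitzWith D (fun y => ⟪ζ y, b i⟫) := fun i =>
    lip_of_compact (LL_inner hζ.locallyLipschitz (LocallyLipschitz.const _))
      (comp_of_zero (s := s) (fun y hy => by simp [hζs y hy]))
  choose D hD using hL
  have hz : ∀ i y, s < ‖y‖ → ⟪ζ y, b i⟫ = 0 := fun i y hy => by simp [hζs y hy]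
  have hsum : ∫ y, ∑ i, (2 * (fderiv ℝ (fun y => ⟪ζ y, b i⟫) y (a y (p y)) * ⟪p y, b i⟫)
      - ⟪fderiv ℝ (fun y => ⟪ζ y, b i⟫ • a y) y (b i) (p y), p y⟫) ∂μ = 0 := by
    rw [integral_finset_sum _ (fun i _ => h.rellich_int (hD i) (hz i) (b i))]
    exact Finset.sum_eq_zero fun i _ => h.rellich_scalar (hD i) hs (hz i) (b i)
  have hint := integrable_finset_sum Finset.univ (fun i _ => h.rellich_int (hD i) (hz i) (b i))
  have hae : (fun y => ∑ i, (2 * (fderiv ℝ (fun y => ⟪ζ y, b i⟫) y (a y (p y)) * ⟪p y, b i⟫)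
      - ⟪fderiv ℝ (fun y => ⟪ζ y, b i⟫ • a y) y (b i) (p y), p y⟫)) =ᵐ[μ]
    (fun y => (2 * ⟪fderiv ℝ ζ y (a y (p y)), p y⟫
      - (∑ i, ⟪fderiv ℝ ζ y (b i), b i⟫) * ⟪a y (p y), p y⟫
      - ⟪fderiv ℝ a y (ζ y) (p y), p y⟫)) := by
    filter_upwards [hζ.ae_differentiableAt (μ := μ), h.lip.ae_differentiableAt (μ := μ)] with y hy ha
    have d1 : ∀ i, HasFDerivAt (fun y => ⟪ζ y, b i⟫) ((innerSL ℝ (b i)).comp (fderiv ℝ ζ y)) y := by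
      intro i
      have := ((innerSL ℝ (b i)).hasFDerivAt (x := ζ y)).comp y hy.hasFDerivAt
      refine this.congr_of_eventuallyEq (Filter.Eventually.of_forall fun z => ?_)
      simp [real_inner_comm]
    have e1 : ∀ i u, fderiv ℝ (fun y => ⟪ζ y, b i⟫) y u = ⟪fderiv ℝ ζ y u, b i⟫ := by
      intro i u
      rw [(d1 i).fderiv]
      simp [real_inner_comm]
    have e2 : ∀ i u, fderiv ℝ (fun y => ⟪ζ y, b i⟫ • a y) y u =
        ⟪ζ y, b i⟫ • fderiv ℝ a y u + ⟪fderiv ℝ ζ y u, b i⟫ • a y := by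
      intro i u
      have := ((d1 i).smul ha.hasFDerivAt).fderiv
      have e3 : fderiv ℝ (fun y => ⟪ζ y, b i⟫ • a y) y = _ := this
      rw [e3]
      simp [real_inner_comm]
    simp only [e1, e2]
    rw [Finset.sum_sub_distrib, ← Finset.mul_sum]
    have s1 : ∑ i, ⟪fderiv ℝ ζ y (a y (p y)), b i⟫ * ⟪p y, b i⟫ = ⟪fderiv ℝ ζ y (a y (p y)), p y⟫ := by
      rw [← b.sum_inner_mul_inner]
      exact Finset.sum_congr rfl fun i _ => by rw [real_inner_comm (b i) (p y)]
    have s2 : fderiv ℝ a y (ζ y) = ∑ i, ⟪ζ y, b i⟫ • fderiv ℝ a y (b i) := by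
      conv_lhs => rw [← b.sum_repr' (ζ y)]
      simp [real_inner_comm]
    rw [s1, s2]
    simp only [ContinuousLinearMap.add_apply, ContinuousLinearMap.smul_apply, inner_add_left,
      inner_smul_left, Finset.sum_add_distrib, ContinuousLinearMap.sum_apply, sum_inner,
      conj_trivial, Finset.sum_mul]
    ring
  exact ⟨hint.congr hae, by rw [← integral_congr_ae hae]; exact hsum⟩

end CoreH
end core3
end part3

section part4
open scoped Convolution RealInnerProductSpace


section core4
variable {E : Type*} [NormedAddCommGroup E] [InnerProductSpace ℝ E] [FiniteDimensional ℝ E]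
  [MeasurableSpace E] [BorelSpace E] {μ : Measure E} [μ.IsAddHaarMeasure]

def Sg (G : E →L[ℝ] E) (r : ℝ) : Set E := {y | ⟪G y, y⟫ < r ^ 2}
def wg (G : E →L[ℝ] E) (r : ℝ) (y : E) : ℝ := max (r ^ 2 - ⟪G y, y⟫) 0
def muf (a : E → E →L[ℝ] E) (G : E →L[ℝ] E) (y : E) : ℝ := ⟪a y (G y), G y⟫ / ⟪G y, y⟫
def Hf (μ : Measure E) (a : E → E →L[ℝ] E) (G : E →L[ℝ] E) (v : E → ℝ) (r : ℝ) : ℝ :=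
  ∫ y in Sg G r, muf a G y * v y ^ 2 ∂μ
def If (μ : Measure E) (a : E → E →L[ℝ] E) (G : E →L[ℝ] E) (p : E → E) (r : ℝ) : ℝ :=
  ∫ y, wg G r y * ⟪a y (p y), p y⟫ ∂μ

namespace GH
variable {G : E →L[ℝ] E} {lam : ℝ}

theorem S_meas (h : GH G lam) (r : ℝ) : MeasurableSet (Sg G r) :=
  (isOpen_lt h.q_cont continuous_const).measurableSet

theorem w_cont (h : GH G lam) (r : ℝ) : Continuous (wg G r) :=
  (continuous_const.sub h.q_cont).max continuous_const

theorem w_nonneg (h : GH G lam) (r : ℝ) (y : E) : 0 ≤ wg G r y := le_max_right _ _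

theorem w_le (h : GH G lam) (r : ℝ) (y : E) : wg G r y ≤ r ^ 2 :=
  max_le (by linarith [h.q_nonneg y]) (by positivity)

theorem q_LL (h : GH G lam) : LocallyLipschitz (fun y => ⟪G y, y⟫) :=
  LL_inner G.lipschitz.locallyLipschitz LipschitzWith.id.locallyLipschitz

theorem w_LL (h : GH G lam) (r : ℝ) : LocallyLipschitz (wg G r) := by
  have h1 : LocallyLipschitz (fun y => r ^ 2 - ⟪G y, y⟫) := LL_sub (LocallyLipschitz.const _) h.q_LL
  exact ((LipschitzWith.id (α := ℝ)).max_const 0).locallyLipschitz.comp h1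

theorem w_zero (h : GH G lam) {r : ℝ} (hr : 0 ≤ r) {y : E} (hy : lam * r < ‖y‖) : wg G r y = 0 := by
  apply max_eq_right
  by_contra hc
  push Not at hc
  have := h.q_lt hr (y := y) (by linarith)
  linarith

theorem w_zero' (h : GH G lam) {r : ℝ} {y : E} (hy : y ∉ Sg G r) : wg G r y = 0 := by
  apply max_eq_right
  simp only [Sg, mem_setOf_eq, not_lt] at hy
  linarith

theorem w_in (h : GH G lam) {r : ℝ} {y : E} (hy : y ∈ Sg G r) : wg G r y = r ^ 2 - ⟪G y, y⟫ := by
  apply max_eq_left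
  simp only [Sg, mem_setOf_eq] at hy
  linarith

theorem q_deriv (h : GH G lam) (y : E) :
    HasFDerivAt (fun y => ⟪G y, y⟫) ((2 : ℝ) • innerSL ℝ (G y)) y := by
  have := (G.hasFDerivAt (x := y)).inner ℝ (hasFDerivAt_id y)
  refine this.congr_fderiv ?_
  ext u
  have := h.symm u y
  simp [real_inner_comm] at *
  rw [this]; ring

theorem w_deriv (h : GH G lam) {r : ℝ} {y : E} (hy : ⟪G y, y⟫ ≠ r ^ 2) :
    HasFDerivAt (wg G r) ((Sg G r).indicator (fun y => (-2 : ℝ) • innerSL ℝ (G y)) y) y := by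
  rcases lt_or_gt_of_ne hy with hlt | hgt
  · rw [indicator_of_mem (by exact hlt)]
    have h1 : HasFDerivAt (fun y => r ^ 2 - ⟪G y, y⟫) (-((2 : ℝ) • innerSL ℝ (G y))) y :=
      (h.q_deriv y).const_sub (r ^ 2)
    have h2 : HasFDerivAt (wg G r) (-((2 : ℝ) • innerSL ℝ (G y))) y := by
      apply h1.congr_of_eventuallyEq
      filter_upwards [(isOpen_lt h.q_cont continuous_const).mem_nhds hlt] with z hz
      exact h.w_in hz
    convert h2 using 1
    ext u; simp
  · rw [indicator_of_notMem (by simpa [Sg] using hgt.le)]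
    apply (hasFDerivAt_const (0 : ℝ) y).congr_of_eventuallyEq
    filter_upwards [(isOpen_lt continuous_const h.q_cont).mem_nhds hgt] with z hz
    exact h.w_zero' (by simp only [Sg, mem_setOf_eq, not_lt]; exact le_of_lt hz)

theorem w_ae (h : GH G lam) {r : ℝ} (hr : 0 < r) : ∀ᵐ y ∂μ,
    HasFDerivAt (wg G r) ((Sg G r).indicator (fun y => (-2 : ℝ) • innerSL ℝ (G y)) y) y := by
  have hn : ∀ᵐ y ∂μ, ⟪G y, y⟫ ≠ r ^ 2 := by
    rw [ae_iff]; simpa using h.null_level (μ := μ) hr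
  filter_upwards [hn] with y hy using h.w_deriv hy

theorem W_int (h : GH G lam) {f : E → ℝ} (hf : Integrable f μ) (r : ℝ) :
    Integrable (fun y => wg G r y * f y) μ := by
  refine hf.bdd_mul (c := r ^ 2) (h.w_cont r).aestronglyMeasurable (Filter.Eventually.of_forall fun y => ?_)
  rw [Real.norm_of_nonneg (h.w_nonneg r y)]
  exact h.w_le r y

theorem W_eq (h : GH G lam) {f : E → ℝ} (hf : Integrable f μ)
    (hqf : Integrable (fun y => ⟪G y, y⟫ * f y) μ) (r : ℝ) :
    ∫ y, wg G r y * f y ∂μ = r ^ 2 * (∫ y in Sg G r, f y ∂μ) - ∫ y in Sg G r, ⟪G y, y⟫ * f y ∂μ := by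
  rw [← integral_const_mul, ← integral_sub (hf.integrableOn.const_mul _) hqf.integrableOn,
    ← integral_indicator (h.S_meas r)]
  congr 1; ext y
  by_cases hy : y ∈ Sg G r
  · rw [indicator_of_mem hy, h.w_in hy]; ring
  · rw [indicator_of_notMem hy, h.w_zero' hy, zero_mul]

theorem W_deriv' (h : GH G lam) {f : E → ℝ} (hf : Integrable f μ) {r : ℝ} (hr : 0 < r) :
    HasDerivAt (fun x : ℝ => ∫ y, wg G x y * f y ∂μ) (2 * r * ∫ y in Sg G r, f y ∂μ) r :=
  h.W_deriv hf hr

theorem ker (h : GH G lam) (y : E) : ‖y‖ ≤ lam * ‖G y‖ := by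
  have h1 := h.ell y
  have h2 := real_inner_le_norm (G y) y
  have h3 := h.lam1
  by_cases hy : ‖y‖ = 0
  · rw [hy]; positivity
  · have : 0 < ‖y‖ := lt_of_le_of_ne (norm_nonneg _) (Ne.symm hy)
    have h4 : ‖y‖ * ‖y‖ ≤ (lam * ‖G y‖) * ‖y‖ := by nlinarith
    exact le_of_mul_le_mul_right h4 this

theorem G_le (h : GH G lam) (y : E) : ‖G y‖ ≤ lam * ‖y‖ :=
  (G.le_opNorm y).trans (by gcongr; exact h.nrm)

theorem q_le (h : GH G lam) (y : E) : ⟪G y, y⟫ ≤ lam * ‖y‖ ^ 2 := by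
  have := real_inner_le_norm (G y) y
  have := mul_le_mul_of_nonneg_right (h.G_le y) (norm_nonneg y)
  nlinarith

end GH

namespace CoreH
variable {a : E → E →L[ℝ] E} {v : E → ℝ} {p : E → E} {lam : ℝ} {K : ℝ≥0} {ρ : ℝ}
  {k : ℕ} {G : E →L[ℝ] E}

theorem a_le (h : CoreH μ a v p lam K ρ) (y u : E) : ‖a y u‖ ≤ lam * ‖u‖ :=
  ((a y).le_opNorm u).trans (by gcongr; exact h.nrm y)

theorem e_nonneg (h : CoreH μ a v p lam K ρ) (y u : E) : 0 ≤ ⟪a y u, u⟫ := by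
  have := h.ell y u
  have h1 := h.lam1
  by_contra hc
  push Not at hc
  nlinarith [sq_nonneg ‖u‖]

theorem e_le (h : CoreH μ a v p lam K ρ) (y u : E) : ⟪a y u, u⟫ ≤ lam * ‖u‖ ^ 2 := by
  have := real_inner_le_norm (a y u) u
  have := mul_le_mul_of_nonneg_right (h.a_le y u) (norm_nonneg u)
  nlinarith

theorem P_nonneg (h : CoreH μ a v p lam K ρ) (y : E) : 0 ≤ ⟪a y (G y), G y⟫ := h.e_nonneg _ _

theorem P_lower (h : CoreH μ a v p lam K ρ) (hG : GH G lam) (y : E) :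
    ‖y‖ ^ 2 ≤ lam ^ 3 * ⟪a y (G y), G y⟫ := by
  have h1 := hG.ker y
  have h2 := h.ell y (G y)
  have h3 := h.lam1
  have h0 : 0 ≤ lam := by linarith
  calc ‖y‖ ^ 2 ≤ (lam * ‖G y‖) ^ 2 := by gcongr
    _ = lam ^ 2 * ‖G y‖ ^ 2 := by ring
    _ ≤ lam ^ 2 * (lam * ⟪a y (G y), G y⟫) := by gcongr
    _ = _ := by ring

theorem P_upper (h : CoreH μ a v p lam K ρ) (hG : GH G lam) (y : E) :
    ⟪a y (G y), G y⟫ ≤ lam ^ 3 * ‖y‖ ^ 2 := by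
  have h1 := hG.G_le y
  have h2 := h.e_le y (G y)
  have h3 := h.lam1
  have h0 : 0 ≤ lam := by linarith
  calc _ ≤ lam * ‖G y‖ ^ 2 := h2
    _ ≤ lam * (lam * ‖y‖) ^ 2 := by gcongr
    _ = _ := by ring

theorem mu_upper (h : CoreH μ a v p lam K ρ) (hG : GH G lam) (y : E) : muf a G y ≤ lam ^ 4 := by
  have h3 := h.lam1
  by_cases hy : y = 0
  · subst hy; simp [muf]; positivity
  have q := hG.q_pos hy
  rw [muf, div_le_iff₀ q]
  calc _ ≤ lam ^ 3 * ‖y‖ ^ 2 := h.P_upper hG y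
    _ ≤ lam ^ 3 * (lam * ⟪G y, y⟫) := by gcongr; exact hG.ell y
    _ = _ := by ring

theorem mu_nonneg (h : CoreH μ a v p lam K ρ) (hG : GH G lam) (y : E) : 0 ≤ muf a G y :=
  div_nonneg (h.P_nonneg y) (hG.q_nonneg y)

theorem mu_lower (h : CoreH μ a v p lam K ρ) (hG : GH G lam) {y : E} (hy : y ≠ 0) :
    1 ≤ lam ^ 4 * muf a G y := by
  have h3 := h.lam1
  have q := hG.q_pos hy
  rw [muf, mul_div_assoc', le_div_iff₀ q, one_mul]
  calc _ ≤ lam * ‖y‖ ^ 2 := hG.q_le y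
    _ ≤ lam * (lam ^ 3 * ⟪a y (G y), G y⟫) := by gcongr; exact h.P_lower hG y
    _ = _ := by ring

theorem mu_q (h : CoreH μ a v p lam K ρ) (hG : GH G lam) (y : E) :
    ⟪G y, y⟫ * muf a G y = ⟪a y (G y), G y⟫ := by
  by_cases hy : y = 0
  · subst hy; simp
  · have q := hG.q_pos hy
    rw [muf]; field_simp

theorem Z_cont (h : CoreH μ a v p lam K ρ) : Continuous (fun y => a y (G y)) :=
  h.lip.continuous.clm_apply G.continuous

theorem P_cont (h : CoreH μ a v p lam K ρ) : Continuous (fun y => ⟪a y (G y), G y⟫) :=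
  (h.Z_cont).inner G.continuous

theorem mu_meas (h : CoreH μ a v p lam K ρ) (hG : GH G lam) : Measurable (muf a G) :=
  h.P_cont.measurable.div hG.q_cont.measurable

/-- anything continuous times `v` or `p`-quadratic is integrable -/
theorem int_of_supp {f : E → ℝ} {g : E → ℝ} (hf : Continuous f) (hg : HasCompactSupport g)
    (hfg : ∀ y, g y = 0 → f y = 0) : Integrable f μ :=
  hf.integrable_of_hasCompactSupport (hg.mono fun y hy hy' => hy (hfg y hy'))

theorem v2_int (h : CoreH μ a v p lam K ρ) {f : E → ℝ} (hf : Continuous f) :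
    Integrable (fun y => f y * v y ^ 2) μ :=
  int_of_supp (hf.mul (h.hv.continuous.pow 2)) h.hvc (fun y hy => by simp [hy])

theorem e_cont (h : CoreH μ a v p lam K ρ) : Continuous (fun y => ⟪a y (p y), p y⟫) :=
  h.F_cont.inner h.p_cont

theorem e_int (h : CoreH μ a v p lam K ρ) {f : E → ℝ} (hf : Continuous f) :
    Integrable (fun y => f y * ⟪a y (p y), p y⟫) μ := by
  apply Continuous.integrable_of_hasCompactSupport (hf.mul h.e_cont)
  exact h.p_supp.mono fun y hy hy' => hy (by simp [hy'])

theorem c_cont (h : CoreH μ a v p lam K ρ) : Continuous (fun y => ⟪a y (p y), G y⟫) :=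
  h.F_cont.inner G.continuous

theorem vc_int (h : CoreH μ a v p lam K ρ) {f : E → ℝ} (hf : Continuous f) :
    Integrable (fun y => f y * (v y * ⟪a y (p y), G y⟫)) μ :=
  int_of_supp (hf.mul (h.hv.continuous.mul h.c_cont)) h.hvc (fun y hy => by simp [hy])

theorem muv_int (h : CoreH μ a v p lam K ρ) (hG : GH G lam) :
    Integrable (fun y => muf a G y * v y ^ 2) μ := by
  have := h.v2_int (μ := μ) (f := fun _ => 1) continuous_const
  simp only [one_mul] at this
  refine this.bdd_mul (c := lam ^ 4) (h.mu_meas hG).aestronglyMeasurable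
    (Filter.Eventually.of_forall fun y => ?_)
  rw [Real.norm_of_nonneg (h.mu_nonneg hG y)]
  exact h.mu_upper hG y

theorem I1 (h : CoreH μ a v p lam K ρ) (hG : GH G lam) {r : ℝ} (hr : 0 < r) (hrρ : lam * r < ρ) :
    If μ a G p r = 2 * ∫ y in Sg G r, v y * ⟪a y (p y), G y⟫ ∂μ := by
  have hz : ∀ y, lam * r < ‖y‖ → wg G r y * v y = 0 := fun y hy => by rw [hG.w_zero hr.le hy, zero_mul]
  obtain ⟨C, hC⟩ := lip_of_compact (LL_mul (hG.w_LL r) h.hv.locallyLipschitz) (comp_of_zero hz)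
  have h0 := h.weakL hC hrρ hz
  have hae : (fun y => fderiv ℝ (fun y => wg G r y * v y) y (a y (p y))) =ᵐ[μ] fun y =>
      wg G r y * ⟪a y (p y), p y⟫ -
        (Sg G r).indicator (fun y => 2 * (v y * ⟪a y (p y), G y⟫)) y := by
    filter_upwards [hG.w_ae (μ := μ) hr] with y hy
    have dv : HasFDerivAt v (fderiv ℝ v y) y :=
      (h.hv.differentiable (by simp) y).hasFDerivAt
    have e0 : fderiv ℝ (fun y => wg G r y * v y) y = _ := (hy.mul dv).fderiv
    rw [e0]
    simp only [ContinuousLinearMap.add_apply, ContinuousLinearMap.smul_apply, h.hp, smul_eq_mul]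
    by_cases hyS : y ∈ Sg G r
    · rw [indicator_of_mem hyS, indicator_of_mem hyS]
      simp [real_inner_comm]
      ring
    · rw [indicator_of_notMem hyS, indicator_of_notMem hyS]
      simp [real_inner_comm]
  rw [integral_congr_ae hae, integral_sub, integral_indicator (hG.S_meas r), integral_const_mul] at h0
  · rw [If]; linarith
  · exact h.e_int (hG.w_cont r)
  · have := h.vc_int (μ := μ) (G := G) (f := fun _ => 2) continuous_const
    exact this.indicator (hG.S_meas r)

def Tf (a : E → E →L[ℝ] E) (G : E →L[ℝ] E) (b : OrthonormalBasis (Fin k) ℝ E) (y : E) : ℝ :=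
  ∑ i, ⟪fderiv ℝ (fun y => a y (G y)) y (b i), b i⟫

theorem Z_deriv (h : CoreH μ a v p lam K ρ) {y : E} (hy : DifferentiableAt ℝ a y) (u : E) :
    fderiv ℝ (fun y => a y (G y)) y u = fderiv ℝ a y u (G y) + a y (G u) := by
  have := (hy.hasFDerivAt.clm_apply (G.hasFDerivAt (x := y))).fderiv
  rw [this]
  simp [add_comm]

theorem Da_le (h : CoreH μ a v p lam K ρ) (y u w : E) : ‖fderiv ℝ a y u w‖ ≤ K * ‖u‖ * ‖w‖ := by
  refine (ContinuousLinearMap.le_opNorm _ _).trans ?_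
  gcongr
  refine (ContinuousLinearMap.le_opNorm _ _).trans ?_
  gcongr
  exact norm_fderiv_le_of_lipschitz ℝ h.lip

theorem T_meas (b : OrthonormalBasis (Fin k) ℝ E) : Measurable (Tf a G b) := by
  apply Finset.measurable_sum
  intro i _
  exact (measurable_fderiv_apply_const ℝ _ _).inner measurable_const

theorem T_bound (h : CoreH μ a v p lam K ρ) (hG : GH G lam) (b : OrthonormalBasis (Fin k) ℝ E)
    {y : E} (hy : DifferentiableAt ℝ a y) {β : ℝ}
    (hβ : ‖(a y).comp G - ContinuousLinearMap.id ℝ E‖ ≤ β) :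
    |Tf a G b y - k| ≤ k * (K * (lam * ‖y‖) + β) := by
  have e : Tf a G b y - k = ∑ i, (⟪fderiv ℝ a y (b i) (G y), b i⟫ +
      ⟪((a y).comp G - ContinuousLinearMap.id ℝ E) (b i), b i⟫) := by
    have : (k : ℝ) = ∑ i : Fin k, (1 : ℝ) := by simp
    rw [Tf, this, ← Finset.sum_sub_distrib]
    refine Finset.sum_congr rfl fun i _ => ?_
    rw [h.Z_deriv hy]
    simp only [ContinuousLinearMap.sub_apply, ContinuousLinearMap.comp_apply,
      ContinuousLinearMap.id_apply, inner_sub_left, inner_add_left, real_inner_self_eq_norm_sq,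
      b.norm_eq_one]
    ring
  rw [e]
  refine (Finset.abs_sum_le_sum_abs _ _).trans ?_
  have : ∀ i ∈ (Finset.univ : Finset (Fin k)), |⟪fderiv ℝ a y (b i) (G y), b i⟫ +
      ⟪((a y).comp G - ContinuousLinearMap.id ℝ E) (b i), b i⟫| ≤ K * (lam * ‖y‖) + β := by
    intro i _
    refine (abs_add_le _ _).trans ?_
    gcongr
    · refine (abs_real_inner_le_norm _ _).trans ?_
      rw [b.norm_eq_one, mul_one]
      refine (h.Da_le _ _ _).trans ?_
      rw [b.norm_eq_one, mul_one]
      gcongr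
      exact hG.G_le y
    · refine (abs_real_inner_le_norm _ _).trans ?_
      rw [b.norm_eq_one, mul_one]
      refine (ContinuousLinearMap.le_opNorm _ _).trans ?_
      rw [b.norm_eq_one, mul_one]
      exact hβ
  refine (Finset.sum_le_sum this).trans ?_
  simp [mul_add]

theorem B_le (h : CoreH μ a v p lam K ρ) (hG : GH G lam) (y : E) :
    ‖(a y).comp G - ContinuousLinearMap.id ℝ E‖ ≤ lam ^ 2 + 1 := by
  refine (norm_sub_le _ _).trans ?_
  gcongr
  · refine (ContinuousLinearMap.opNorm_comp_le _ _).trans ?_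
    rw [sq]
    have := h.nrm y
    have := hG.nrm
    have := h.lam1
    gcongr
  · exact ContinuousLinearMap.norm_id_le

theorem T_int (h : CoreH μ a v p lam K ρ) (hG : GH G lam) (b : OrthonormalBasis (Fin k) ℝ E) :
    Integrable (fun y => Tf a G b y * v y ^ 2) μ := by
  have c1 : Continuous (fun y : E => (k + k * (K * (lam * ‖y‖) + (lam ^ 2 + 1)) : ℝ)) := by fun_prop
  refine (h.v2_int (μ := μ) c1).mono' ((T_meas b).aestronglyMeasurable.mul
    (h.hv.continuous.pow 2).aestronglyMeasurable) ?_
  filter_upwards [h.lip.ae_differentiableAt (μ := μ)] with y hy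
  have := h.T_bound hG b hy (h.B_le hG y)
  rw [norm_mul, Real.norm_eq_abs, Real.norm_of_nonneg (sq_nonneg _)]
  gcongr
  have h2 : |Tf a G b y| ≤ |Tf a G b y - k| + |(k:ℝ)| := by
    have := abs_add_le (Tf a G b y - k) (k:ℝ); simpa using this
  rw [Nat.abs_cast] at h2
  linarith

def gf (a : E → E →L[ℝ] E) (G : E →L[ℝ] E) (b : OrthonormalBasis (Fin k) ℝ E) (v : E → ℝ) (p : E → E)
    (y : E) : ℝ := Tf a G b y * v y ^ 2 + 2 * (v y * ⟪a y (p y), G y⟫)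

theorem g_int (h : CoreH μ a v p lam K ρ) (hG : GH G lam) (b : OrthonormalBasis (Fin k) ℝ E) :
    Integrable (gf a G b v p) μ := (h.T_int hG b).add (h.vc_int continuous_const)

theorem I2 (h : CoreH μ a v p lam K ρ) (hG : GH G lam) (b : OrthonormalBasis (Fin k) ℝ E)
    {r : ℝ} (hr : 0 < r) :
    2 * ∫ y in Sg G r, ⟪a y (G y), G y⟫ * v y ^ 2 ∂μ = ∫ y, wg G r y * gf a G b v p y ∂μ := by
  have Zll : LocallyLipschitz (fun y => a y (G y)) :=
    LL_clm h.lip.locallyLipschitz G.lipschitz.locallyLipschitz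
  set f : Fin k → E → ℝ := fun i y => (wg G r y * (v y * v y)) * ⟪a y (G y), b i⟫ with hf
  have hz : ∀ i y, lam * r < ‖y‖ → f i y = 0 := fun i y hy => by
    simp only [hf]; rw [hG.w_zero hr.le hy, zero_mul, zero_mul]
  have hL : ∀ i, ∃ C, LipschitzWith C (f i) := fun i =>
    lip_of_compact (LL_mul (LL_mul (hG.w_LL r) (LL_mul h.hv.locallyLipschitz h.hv.locallyLipschitz))
      (LL_inner Zll (LocallyLipschitz.const _))) (comp_of_zero (hz i))
  haveI : ProperSpace E := FiniteDimensional.proper ℝ E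
  choose C hC using hL
  have h0 : ∀ i, ∫ y, fderiv ℝ (f i) y (b i) ∂μ = 0 := fun i =>
    int_fderiv_zero (hC i) (comp_of_zero (hz i)) (b i)
  have hin : ∀ i, Integrable (fun y => fderiv ℝ (f i) y (b i)) μ := by
    intro i
    have : HasCompactSupport (fun y => fderiv ℝ (f i) y (b i)) := by
      apply comp_of_zero (s := lam * r)
      intro y hy
      rw [fderiv_zero_of_zero (hz i) y hy]; simp
    apply ((integrable_indicator_iff (ProperSpace.isCompact_closedBall (0:E) (lam*r)).measurableSet).2 (integrableOn_const (C := (C i : ℝ) * 1)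
      (μ := μ) (s := closedBall (0 : E) (lam * r)) (ProperSpace.isCompact_closedBall (0:E) (lam*r)).measure_lt_top.ne)).mono'
    · exact (measurable_fderiv_apply_const ℝ _ _).aestronglyMeasurable
    · refine Filter.Eventually.of_forall fun y => ?_
      by_cases hy : y ∈ closedBall (0 : E) (lam * r)
      · rw [indicator_of_mem hy]
        refine (ContinuousLinearMap.le_opNorm _ _).trans ?_
        rw [b.norm_eq_one]
        gcongr
        exact norm_fderiv_le_of_lipschitz ℝ (hC i)
      · rw [indicator_of_notMem hy, fderiv_zero_of_zero (hz i) y (by simpa using hy)]; simp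
  have hs : ∫ y, ∑ i, fderiv ℝ (f i) y (b i) ∂μ = 0 := by
    rw [integral_finset_sum _ (fun i _ => hin i)]
    exact Finset.sum_eq_zero fun i _ => h0 i
  have hae : (fun y => ∑ i, fderiv ℝ (f i) y (b i)) =ᵐ[μ] fun y =>
      wg G r y * gf a G b v p y - (Sg G r).indicator (fun y => 2 * (⟪a y (G y), G y⟫ * v y ^ 2)) y := by
    filter_upwards [hG.w_ae (μ := μ) hr, h.lip.ae_differentiableAt (μ := μ)] with y hy ha
    have dv : HasFDerivAt v (fderiv ℝ v y) y :=
      (h.hv.differentiable (by simp) y).hasFDerivAt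
    have dZ : DifferentiableAt ℝ (fun y => a y (G y)) y := ha.clm_apply G.differentiableAt
    have d1 : ∀ i, HasFDerivAt (fun y => ⟪a y (G y), b i⟫)
        ((innerSL ℝ (b i)).comp (fderiv ℝ (fun y => a y (G y)) y)) y := by
      intro i
      have := ((innerSL ℝ (b i)).hasFDerivAt (x := a y (G y))).comp y dZ.hasFDerivAt
      refine this.congr_of_eventuallyEq (Filter.Eventually.of_forall fun z => ?_)
      simp [real_inner_comm]
    have e1 : ∀ i, fderiv ℝ (f i) y (b i) = wg G r y * (v y ^ 2 * ⟪fderiv ℝ (fun y => a y (G y)) y (b i), b i⟫)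
        + wg G r y * (2 * (v y * (⟪p y, b i⟫ * ⟪b i, a y (G y)⟫)))
        - (Sg G r).indicator (fun y => 2 * (v y ^ 2 * (⟪a y (G y), b i⟫ * ⟪b i, G y⟫))) y := by
      intro i
      have e0 : fderiv ℝ (f i) y = _ := ((hy.mul (dv.mul dv)).mul (d1 i)).fderiv
      rw [e0]
      by_cases hyS : y ∈ Sg G r
      · rw [indicator_of_mem hyS, indicator_of_mem hyS]
        simp [h.hp, real_inner_comm]
        ring
      · rw [indicator_of_notMem hyS, indicator_of_notMem hyS]
        simp [h.hp, real_inner_comm]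
        ring
    rw [Finset.sum_congr rfl fun i _ => e1 i, Finset.sum_sub_distrib, Finset.sum_add_distrib,
      ← Finset.mul_sum, ← Finset.mul_sum, ← Finset.mul_sum, ← Finset.mul_sum, ← Finset.mul_sum,
      b.sum_inner_mul_inner]
    have e3 : ⟪p y, a y (G y)⟫ = ⟪a y (p y), G y⟫ := by rw [h.symm]
    have e4 : ∑ i, (Sg G r).indicator (fun y => 2 * (v y ^ 2 * (⟪a y (G y), b i⟫ * ⟪b i, G y⟫))) y =
      (Sg G r).indicator (fun y => 2 * (⟪a y (G y), G y⟫ * v y ^ 2)) y := by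
      by_cases hyS : y ∈ Sg G r
      · simp only [indicator_of_mem hyS]
        rw [← Finset.mul_sum, ← Finset.mul_sum, b.sum_inner_mul_inner]; ring
      · simp only [indicator_of_notMem hyS]; simp
    rw [e4, e3, gf, Tf]
    ring
  have iP : Integrable (fun y => 2 * (⟪a y (G y), G y⟫ * v y ^ 2)) μ :=
    (h.v2_int h.P_cont).const_mul 2
  rw [integral_congr_ae hae, integral_sub (hG.W_int (h.g_int hG b) r) (iP.indicator (hG.S_meas r)),
    integral_indicator (hG.S_meas r), integral_const_mul] at hs
  linarith

theorem H_eq (h : CoreH μ a v p lam K ρ) (hG : GH G lam) (b : OrthonormalBasis (Fin k) ℝ E)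
    {r : ℝ} (hr : 0 < r) :
    r ^ 2 * Hf μ a G v r = (∫ y, wg G r y * (muf a G y * v y ^ 2) ∂μ) +
      (∫ y, wg G r y * gf a G b v p y ∂μ) / 2 := by
  have e : ∀ y, ⟪G y, y⟫ * (muf a G y * v y ^ 2) = ⟪a y (G y), G y⟫ * v y ^ 2 := fun y => by
    rw [← mul_assoc, h.mu_q hG]
  have i1 : Integrable (fun y => ⟪G y, y⟫ * (muf a G y * v y ^ 2)) μ := by
    simp only [e]; exact h.v2_int h.P_cont
  rw [hG.W_eq (h.muv_int hG) i1 r, ← h.I2 hG b hr]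
  simp only [e, Hf]
  ring

theorem H_deriv (h : CoreH μ a v p lam K ρ) (hG : GH G lam) (b : OrthonormalBasis (Fin k) ℝ E)
    {r : ℝ} (hr : 0 < r) (hrρ : lam * r < ρ) :
    HasDerivAt (Hf μ a G v) (((∫ y in Sg G r, Tf a G b y * v y ^ 2 ∂μ) + If μ a G p r) / r) r := by
  have h1 := hG.W_deriv' (h.muv_int hG) hr
  have h2 := hG.W_deriv' (h.g_int hG b) hr
  have h3 := (h1.add (h2.div_const 2)).div (hasDerivAt_pow 2 r) (by positivity)
  have h4 := h3.congr_of_eventuallyEq (f₁ := Hf μ a G v) <| by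
    filter_upwards [lt_mem_nhds hr] with x hx
    rw [Pi.div_apply, eq_div_iff (by positivity)]
    have := h.H_eq hG b hx
    simp only [Pi.add_apply]
    linarith
  refine h4.congr_deriv (Eq.symm ?_)
  have e5 : ∫ y in Sg G r, gf a G b v p y ∂μ = (∫ y in Sg G r, Tf a G b y * v y ^ 2 ∂μ) + If μ a G p r := by
    rw [h.I1 hG hr hrρ, ← integral_const_mul]
    exact integral_add (h.T_int hG b).integrableOn ((h.vc_int continuous_const).integrableOn)
  have e6 := h.H_eq hG b hr
  simp only [Pi.add_apply]
  rw [← e6, e5]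
  have e7 : ∫ y in Sg G r, muf a G y * v y ^ 2 ∂μ = Hf μ a G v r := rfl
  rw [e7]
  field_simp
  push_cast
  ring

theorem I_deriv (h : CoreH μ a v p lam K ρ) (hG : GH G lam) {r : ℝ} (hr : 0 < r) :
    HasDerivAt (If μ a G p) (2 * r * ∫ y in Sg G r, ⟪a y (p y), p y⟫ ∂μ) r := by
  have := h.e_int (μ := μ) (f := fun _ => 1) continuous_const
  simp only [one_mul] at this
  exact hG.W_deriv' this hr

theorem I_nonneg (h : CoreH μ a v p lam K ρ) (hG : GH G lam) (r : ℝ) : 0 ≤ If μ a G p r :=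
  integral_nonneg fun y => mul_nonneg (hG.w_nonneg r y) (h.e_nonneg y _)

theorem H_nonneg (h : CoreH μ a v p lam K ρ) (hG : GH G lam) (r : ℝ) : 0 ≤ Hf μ a G v r :=
  integral_nonneg fun y => mul_nonneg (h.mu_nonneg hG y) (sq_nonneg _)

end CoreH
end core4
end part4

section part5
open scoped Convolution RealInnerProductSpace


section core5
variable {E : Type*} [NormedAddCommGroup E] [InnerProductSpace ℝ E] [FiniteDimensional ℝ E]
  [MeasurableSpace E] [BorelSpace E] {μ : Measure E} [μ.IsAddHaarMeasure]

def Rf (a : E → E →L[ℝ] E) (G : E →L[ℝ] E) (y : E) : E := (muf a G y)⁻¹ • a y (G y) - y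

theorem smul_two (s t : ℝ) (x x' : E) {m1 m2 m3 m4 : ℝ} (h1 : |s - t| ≤ m1) (h2 : ‖x‖ ≤ m2)
    (h3 : |t| ≤ m3) (h4 : ‖x - x'‖ ≤ m4) : ‖s • x - t • x'‖ ≤ m1 * m2 + m3 * m4 := by
  have e : s • x - t • x' = (s - t) • x + t • (x - x') := by
    rw [sub_smul, smul_sub]; abel
  rw [e]
  refine (norm_add_le _ _).trans ?_
  rw [norm_smul, norm_smul, Real.norm_eq_abs, Real.norm_eq_abs]
  have : 0 ≤ m1 := (abs_nonneg _).trans h1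
  have : 0 ≤ m3 := (abs_nonneg _).trans h3
  gcongr

theorem inner_two (s t : E) (x x' : E) {m1 m2 m3 m4 : ℝ} (h1 : ‖s - t‖ ≤ m1) (h2 : ‖x‖ ≤ m2)
    (h3 : ‖t‖ ≤ m3) (h4 : ‖x - x'‖ ≤ m4) : |⟪s, x⟫ - ⟪t, x'⟫| ≤ m1 * m2 + m3 * m4 := by
  have e : ⟪s, x⟫ - ⟪t, x'⟫ = ⟪s - t, x⟫ + ⟪t, x - x'⟫ := by
    rw [inner_sub_left, inner_sub_right]; ring
  rw [e]
  refine (abs_add_le _ _).trans ?_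
  have : 0 ≤ m1 := (norm_nonneg _).trans h1
  have : 0 ≤ m3 := (norm_nonneg _).trans h3
  have i1 := abs_real_inner_le_norm (s - t) x
  have i2 := abs_real_inner_le_norm t (x - x')
  refine (add_le_add i1 i2).trans ?_
  gcongr

namespace CoreH
variable {a : E → E →L[ℝ] E} {v : E → ℝ} {p : E → E} {lam : ℝ} {K : ℝ≥0} {ρ : ℝ}
  {k : ℕ} {G : E →L[ℝ] E}

theorem P_pos (h : CoreH μ a v p lam K ρ) (hG : GH G lam) {y : E} (hy : y ≠ 0) :
    0 < ⟪a y (G y), G y⟫ := by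
  have := h.P_lower hG y
  have h1 : 0 < ‖y‖ ^ 2 := by have := norm_pos_iff.2 hy; positivity
  have h2 := h.lam1
  have h3 : 0 ≤ lam ^ 3 := by positivity
  by_contra hc
  push Not at hc
  nlinarith

theorem R_eq (h : CoreH μ a v p lam K ρ) (hG : GH G lam) {y : E} (hy : y ≠ 0) :
    Rf a G y = (⟪a y (G y), G y⟫)⁻¹ •
      (⟪G y, y⟫ • (a y (G y) - y) - ⟪a y (G y) - y, G y⟫ • y) := by
  have q := hG.q_pos hy
  have hP := h.P_pos hG hy
  have e : ⟪a y (G y) - y, G y⟫ = ⟪a y (G y), G y⟫ - ⟪G y, y⟫ := by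
    rw [inner_sub_left, real_inner_comm y (G y)]
  rw [e, Rf, muf, inv_div]
  match_scalars <;> field_simp <;> ring

theorem R_zero (h : CoreH μ a v p lam K ρ) : Rf a G 0 = 0 := by simp [Rf]

/-- two point estimates -/
theorem R_two (h : CoreH μ a v p lam K ρ) (hG : GH G lam) {s β : ℝ} (hβ2 : β ≤ 2 * lam)
    (hB : ∀ y ∈ ball (0 : E) s, ‖(a y).comp G - ContinuousLinearMap.id ℝ E‖ ≤ β)
    (hK : K * lam * s ≤ β) {y z : E} (hy : y ∈ ball (0 : E) s) (hz : z ∈ ball (0 : E) s)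
    (hzy : ‖z‖ ≤ ‖y‖) : ‖Rf a G y - Rf a G z‖ ≤ 24 * lam ^ 9 * β * ‖y - z‖ := by
  have l1 := h.lam1
  have l0 : 0 < lam := by linarith
  have β0 : 0 ≤ β := (norm_nonneg _).trans (hB y hy)
  have hys : ‖y‖ < s := by simpa using hy
  have hd0 := norm_nonneg (y - z)
  by_cases hy0 : y = 0
  · have hz0 : z = 0 := by subst hy0; simpa using hzy
    subst hy0; subst hz0; simp
  have hM : 0 < ‖y‖ := norm_pos_iff.2 hy0
  have b1 : ∀ x ∈ ball (0:E) s, ‖a x (G x) - x‖ ≤ β * ‖x‖ := by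
    intro x hx
    have := ((a x).comp G - ContinuousLinearMap.id ℝ E).le_opNorm x
    simp only [ContinuousLinearMap.sub_apply, ContinuousLinearMap.comp_apply,
      ContinuousLinearMap.id_apply] at this
    exact this.trans (by gcongr; exact hB x hx)
  have b2 : ∀ x ∈ ball (0:E) s, |⟪a x (G x) - x, G x⟫| ≤ β * lam * ‖x‖ ^ 2 := by
    intro x hx
    refine (abs_real_inner_le_norm _ _).trans ?_
    calc _ ≤ (β * ‖x‖) * (lam * ‖x‖) := by gcongr; exacts [b1 x hx, hG.G_le x]
      _ = _ := by ring
  have q2 : ∀ x, |⟪G x, x⟫| ≤ lam * ‖x‖ ^ 2 := by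
    intro x; rw [abs_of_nonneg (hG.q_nonneg x)]; exact hG.q_le x
  have f2 : ∀ x ∈ ball (0:E) s, ‖⟪G x, x⟫ • (a x (G x) - x) - ⟪a x (G x) - x, G x⟫ • x‖ ≤
      2 * lam * β * ‖x‖ ^ 3 := by
    intro x hx
    refine (norm_sub_le _ _).trans ?_
    rw [norm_smul, norm_smul, Real.norm_eq_abs, Real.norm_eq_abs]
    calc _ ≤ (lam * ‖x‖ ^ 2) * (β * ‖x‖) + (β * lam * ‖x‖ ^ 2) * ‖x‖ := by
          gcongr; exacts [q2 x, b1 x hx, b2 x hx]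
      _ = _ := by ring
  have dG : ‖G y - G z‖ ≤ lam * ‖y - z‖ := by rw [← map_sub]; exact hG.G_le _
  have d1 : ‖(a y (G y) - y) - (a z (G z) - z)‖ ≤ 2 * β * ‖y - z‖ := by
    have e : (a y (G y) - y) - (a z (G z) - z) =
        ((a y).comp G - ContinuousLinearMap.id ℝ E) (y - z) + (a y - a z) (G z) := by
      simp; abel
    rw [e]
    refine (norm_add_le _ _).trans ?_
    have i1 : ‖((a y).comp G - ContinuousLinearMap.id ℝ E) (y - z)‖ ≤ β * ‖y - z‖ :=
      (ContinuousLinearMap.le_opNorm _ _).trans (by gcongr; exact hB y hy)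
    have i2 : ‖(a y - a z) (G z)‖ ≤ (K * ‖y - z‖) * (lam * ‖y‖) := by
      refine (ContinuousLinearMap.le_opNorm _ _).trans ?_
      gcongr
      · simpa [dist_eq_norm] using h.lip.dist_le_mul y z
      · exact (hG.G_le z).trans (by gcongr)
    have i3 : (K * ‖y - z‖) * (lam * ‖y‖) ≤ β * ‖y - z‖ := by
      calc _ = (K * lam * ‖y‖) * ‖y - z‖ := by ring
        _ ≤ (K * lam * s) * ‖y - z‖ := by gcongr
        _ ≤ _ := by gcongr
    linarith
  have dq : |⟪G y, y⟫ - ⟪G z, z⟫| ≤ 2 * lam * ‖y‖ * ‖y - z‖ := by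
    have := inner_two (G y) (G z) y z dG le_rfl ((hG.G_le z).trans (by gcongr : _ ≤ lam * ‖y‖)) le_rfl
    refine this.trans (le_of_eq ?_); ring
  have db : |⟪a y (G y) - y, G y⟫ - ⟪a z (G z) - z, G z⟫| ≤ 3 * β * lam * ‖y‖ * ‖y - z‖ := by
    have := inner_two _ _ (G y) (G z) d1 (hG.G_le y) ((b1 z hz).trans (by gcongr : _ ≤ β * ‖y‖)) dG
    refine this.trans (le_of_eq ?_); ring
  have ePq : ∀ x, ⟪a x (G x), G x⟫ = ⟪G x, x⟫ + ⟪a x (G x) - x, G x⟫ := by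
    intro x; rw [inner_sub_left, real_inner_comm x (G x)]; ring
  have dP : |⟪a y (G y), G y⟫ - ⟪a z (G z), G z⟫| ≤ 8 * lam ^ 2 * ‖y‖ * ‖y - z‖ := by
    rw [ePq, ePq]
    have : ⟪G y, y⟫ + ⟪a y (G y) - y, G y⟫ - (⟪G z, z⟫ + ⟪a z (G z) - z, G z⟫) =
      (⟪G y, y⟫ - ⟪G z, z⟫) + (⟪a y (G y) - y, G y⟫ - ⟪a z (G z) - z, G z⟫) := by ring
    rw [this]
    refine (abs_add_le _ _).trans ?_
    have : 3 * β * lam * ‖y‖ * ‖y - z‖ ≤ 3 * (2 * lam) * lam * ‖y‖ * ‖y - z‖ := by gcongr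
    have : 2 * lam * ‖y‖ * ‖y - z‖ ≤ 2 * (lam * lam) * ‖y‖ * ‖y - z‖ := by
      gcongr; nlinarith
    linarith
  have df : ‖(⟪G y, y⟫ • (a y (G y) - y) - ⟪a y (G y) - y, G y⟫ • y) -
      (⟪G z, z⟫ • (a z (G z) - z) - ⟪a z (G z) - z, G z⟫ • z)‖ ≤ 8 * lam * β * ‖y‖ ^ 2 * ‖y - z‖ := by
    rw [sub_sub_sub_comm]
    refine (norm_sub_le _ _).trans ?_
    have i1 := smul_two _ _ _ _ dq (b1 y hy) ((q2 z).trans (by gcongr : _ ≤ lam * ‖y‖ ^ 2)) d1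
    have i2 := smul_two _ _ y z db le_rfl ((b2 z hz).trans (by gcongr : _ ≤ β * lam * ‖y‖ ^ 2)) le_rfl
    refine (add_le_add i1 i2).trans (le_of_eq ?_)
    ring
  have hPy := h.P_pos hG hy0
  have hPl := h.P_lower hG y
  have iPy : (⟪a y (G y), G y⟫)⁻¹ * ‖y‖ ^ 2 ≤ lam ^ 3 := by
    rw [inv_mul_le_iff₀ hPy]; linarith
  by_cases hz0 : z = 0
  · subst hz0
    rw [h.R_zero, sub_zero, sub_zero, h.R_eq hG hy0, norm_smul, norm_inv, Real.norm_of_nonneg hPy.le]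
    calc _ ≤ (⟪a y (G y), G y⟫)⁻¹ * (2 * lam * β * ‖y‖ ^ 3) := by gcongr; exact f2 y hy
      _ = 2 * lam * β * ((⟪a y (G y), G y⟫)⁻¹ * ‖y‖ ^ 2) * ‖y‖ := by ring
      _ ≤ 2 * lam * β * lam ^ 3 * ‖y‖ := by gcongr
      _ = 2 * lam ^ 4 * β * ‖y‖ := by ring
      _ ≤ 24 * lam ^ 9 * β * ‖y‖ := by gcongr <;> first | norm_num | assumption
  have hPz := h.P_pos hG hz0
  have iPz : (⟪a z (G z), G z⟫)⁻¹ * ‖z‖ ^ 2 ≤ lam ^ 3 := by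
    rw [inv_mul_le_iff₀ hPz]; linarith [h.P_lower hG z]
  rw [h.R_eq hG hy0, h.R_eq hG hz0]
  have dinv : |(⟪a z (G z), G z⟫)⁻¹ - (⟪a y (G y), G y⟫)⁻¹| ≤
      8 * lam ^ 2 * ‖y‖ * ‖y - z‖ * ((⟪a y (G y), G y⟫)⁻¹ * (⟪a z (G z), G z⟫)⁻¹) := by
    have : (⟪a z (G z), G z⟫)⁻¹ - (⟪a y (G y), G y⟫)⁻¹ =
        (⟪a y (G y), G y⟫ - ⟪a z (G z), G z⟫) * ((⟪a y (G y), G y⟫)⁻¹ * (⟪a z (G z), G z⟫)⁻¹) := by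
      field_simp
    rw [this, abs_mul, abs_of_nonneg (a := (⟪a y (G y), G y⟫)⁻¹ * (⟪a z (G z), G z⟫)⁻¹) (by positivity)]
    gcongr
  have := smul_two (⟪a z (G z), G z⟫)⁻¹ (⟪a y (G y), G y⟫)⁻¹ _ _ dinv (f2 z hz)
    (le_of_eq (abs_of_nonneg (inv_nonneg.2 hPy.le))) ((norm_sub_rev _ _).trans_le df)
  rw [norm_sub_rev]
  refine this.trans ?_
  have hz1 : ‖z‖ ^ 3 = ‖z‖ ^ 2 * ‖z‖ := by ring
  calc _ = 16 * lam ^ 3 * β * ‖y - z‖ * ((⟪a y (G y), G y⟫)⁻¹ * (‖y‖ * ‖z‖)) *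
          ((⟪a z (G z), G z⟫)⁻¹ * ‖z‖ ^ 2)
        + 8 * lam * β * ‖y - z‖ * ((⟪a y (G y), G y⟫)⁻¹ * ‖y‖ ^ 2) := by ring
    _ ≤ 16 * lam ^ 3 * β * ‖y - z‖ * ((⟪a y (G y), G y⟫)⁻¹ * (‖y‖ * ‖y‖)) * lam ^ 3
        + 8 * lam * β * ‖y - z‖ * lam ^ 3 := by gcongr
    _ = 16 * lam ^ 3 * β * ‖y - z‖ * ((⟪a y (G y), G y⟫)⁻¹ * ‖y‖ ^ 2) * lam ^ 3
        + 8 * lam ^ 4 * β * ‖y - z‖ := by ring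
    _ ≤ 16 * lam ^ 3 * β * ‖y - z‖ * lam ^ 3 * lam ^ 3 + 8 * lam ^ 9 * β * ‖y - z‖ := by
        gcongr <;> first | norm_num | assumption
    _ = _ := by ring

theorem R_ext (h : CoreH μ a v p lam K ρ) (hG : GH G lam) {s β : ℝ} (hβ2 : β ≤ 2 * lam) (hβ0 : 0 ≤ β)
    (hB : ∀ y ∈ ball (0 : E) s, ‖(a y).comp G - ContinuousLinearMap.id ℝ E‖ ≤ β)
    (hK : K * lam * s ≤ β) : ∃ (R : E → E) (C : ℝ≥0), LipschitzWith C R ∧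
      (∀ y ∈ ball (0:E) s, Rf a G y = R y) ∧
      ∀ y ∈ ball (0:E) s, ‖fderiv ℝ R y‖ ≤ 24 * lam ^ 9 * β := by
  have l1 := h.lam1
  have hC : 0 ≤ 24 * lam ^ 9 * β := by positivity
  have hl : LipschitzOnWith ⟨24 * lam ^ 9 * β, hC⟩ (Rf a G) (ball 0 s) := by
    apply LipschitzOnWith.of_dist_le_mul
    intro y hy z hz
    rw [dist_eq_norm, dist_eq_norm]
    rcases le_total ‖z‖ ‖y‖ with hle | hle
    · exact h.R_two hG hβ2 hB hK hy hz hle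
    · rw [norm_sub_rev, norm_sub_rev y z]
      exact h.R_two hG hβ2 hB hK hz hy hle
  obtain ⟨R, hR, he⟩ := hl.extend_finite_dimension
  refine ⟨R, _, hR, he, fun y hy => ?_⟩
  have hl' : LipschitzOnWith ⟨24 * lam ^ 9 * β, hC⟩ R (ball 0 s) := by
    intro x hx z hz
    rw [← he hx, ← he hz]; exact hl hx hz
  exact norm_fderiv_le_of_lipschitzOn ℝ (isOpen_ball.mem_nhds hy) hl'

theorem muinv_le (h : CoreH μ a v p lam K ρ) (hG : GH G lam) (y : E) : (muf a G y)⁻¹ ≤ lam ^ 4 := by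
  have l1 := h.lam1
  by_cases hy : y = 0
  · subst hy; simp [muf]; positivity
  · have := h.mu_lower hG hy
    have h0 : 0 < muf a G y := div_pos (h.P_pos hG hy) (hG.q_pos hy)
    rw [inv_le_iff_one_le_mul₀ h0]; linarith

theorem c2_int (h : CoreH μ a v p lam K ρ) (hG : GH G lam) :
    Integrable (fun y => (muf a G y)⁻¹ * ⟪a y (p y), G y⟫ ^ 2) μ := by
  have i : Integrable (fun y => ⟪a y (p y), G y⟫ ^ 2) μ := by
    apply Continuous.integrable_of_hasCompactSupport (h.c_cont.pow 2)
    exact h.p_supp.mono fun y hy hy' => hy (by simp [hy'])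
  refine i.bdd_mul (c := lam ^ 4) (h.mu_meas hG).inv.aestronglyMeasurable
    (Filter.Eventually.of_forall fun y => ?_)
  rw [Real.norm_of_nonneg (inv_nonneg.2 (h.mu_nonneg hG y))]
  exact h.muinv_le hG y

theorem I_CS (h : CoreH μ a v p lam K ρ) (hG : GH G lam) {r : ℝ} (hr : 0 < r) (hrρ : lam * r < ρ) :
    If μ a G p r ^ 2 ≤ Hf μ a G v r * (4 * ∫ y in Sg G r, (muf a G y)⁻¹ * ⟪a y (p y), G y⟫ ^ 2 ∂μ) := by
  rw [h.I1 hG hr hrρ]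
  set S := Sg G r
  have i1 := (h.muv_int hG).integrableOn (s := S)
  have i2 : IntegrableOn (fun y => v y * ⟪a y (p y), G y⟫) S μ := by
    have := h.vc_int (μ := μ) (G := G) (f := fun _ => 1) continuous_const
    simp only [one_mul] at this
    exact this.integrableOn
  have i3 := (h.c2_int hG).integrableOn (s := S)
  have hq : ∀ t : ℝ, 0 ≤ (∫ y in S, (muf a G y)⁻¹ * ⟪a y (p y), G y⟫ ^ 2 ∂μ) * (t * t) +
      (-2 * ∫ y in S, v y * ⟪a y (p y), G y⟫ ∂μ) * t + ∫ y in S, muf a G y * v y ^ 2 ∂μ := by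
    intro t
    have e : (∫ y in S, (muf a G y)⁻¹ * ⟪a y (p y), G y⟫ ^ 2 ∂μ) * (t * t) +
      (-2 * ∫ y in S, v y * ⟪a y (p y), G y⟫ ∂μ) * t + ∫ y in S, muf a G y * v y ^ 2 ∂μ =
      ∫ y in S, (t * t * ((muf a G y)⁻¹ * ⟪a y (p y), G y⟫ ^ 2) + t * (-2) * (v y * ⟪a y (p y), G y⟫) +
          muf a G y * v y ^ 2) ∂μ := by
      have j : IntegrableOn (fun y => t * t * ((muf a G y)⁻¹ * ⟪a y (p y), G y⟫ ^ 2) +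
        t * (-2) * (v y * ⟪a y (p y), G y⟫)) S μ := (i3.const_mul _).add (i2.const_mul _)
      rw [integral_add j i1, integral_add (i3.const_mul _) (i2.const_mul _), integral_const_mul,
        integral_const_mul]
      ring
    rw [e]
    apply integral_nonneg
    intro y
    simp only [Pi.zero_apply]
    by_cases hy : y = 0
    · subst hy; simp [muf]
    · have h0 : 0 < muf a G y := div_pos (h.P_pos hG hy) (hG.q_pos hy)
      have : t * t * ((muf a G y)⁻¹ * ⟪a y (p y), G y⟫ ^ 2) + t * (-2) * (v y * ⟪a y (p y), G y⟫) +
          muf a G y * v y ^ 2 = muf a G y * (v y - t * (muf a G y)⁻¹ * ⟪a y (p y), G y⟫) ^ 2 := by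
        field_simp; ring
      rw [this]; positivity
  have := discrim_le_zero hq
  rw [discrim] at this
  rw [Hf]
  nlinarith

theorem I3 (b : OrthonormalBasis (Fin k) ℝ E) (h : CoreH μ a v p lam K ρ) (hG : GH G lam) {r s β : ℝ}
    (hr : 0 < r) (hrs : lam * r < s) (hsρ : s ≤ ρ) (hβ2 : β ≤ 2 * lam) (hβ0 : 0 ≤ β)
    (hB : ∀ y ∈ ball (0 : E) s, ‖(a y).comp G - ContinuousLinearMap.id ℝ E‖ ≤ β)
    (hK : K * lam * s ≤ β) :
    (4 * ∫ y in Sg G r, (muf a G y)⁻¹ * ⟪a y (p y), G y⟫ ^ 2 ∂μ) ≤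
      r * (2 * r * ∫ y in Sg G r, ⟪a y (p y), p y⟫ ∂μ) - k * If μ a G p r
        + (49 + 24 * k) * lam ^ 11 * β * If μ a G p r := by
  have l1 := h.lam1
  have l0 : 0 ≤ lam := by linarith
  obtain ⟨R, C, hRL, hRe, hRd⟩ := h.R_ext hG hβ2 hβ0 hB hK
  set X : E → E := fun y => y + R y with hX
  have XL : LocallyLipschitz X := LL_add LipschitzWith.id.locallyLipschitz hRL.locallyLipschitz
  have hz : ∀ y, lam * r < ‖y‖ → wg G r y • X y = 0 := fun y hy => by rw [hG.w_zero hr.le hy, zero_smul]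
  obtain ⟨D, hD⟩ := lip_of_compact (LL_smul (hG.w_LL r) XL) (comp_of_zero hz)
  obtain ⟨hint, h0⟩ := h.rellich_vec b hD (lt_of_lt_of_le hrs hsρ) hz
  have hSb : ∀ y ∈ Sg G r, y ∈ ball (0:E) s := fun y hy => by
    have := hG.q_lt hr.le hy
    simp; linarith
  have hXe : ∀ y ∈ ball (0:E) s, X y = (muf a G y)⁻¹ • a y (G y) := fun y hy => by
    simp only [hX]; rw [← hRe y hy, Rf]; abel
  have i1 := h.e_int (μ := μ) (hG.w_cont r)
  have i2 := (h.c2_int hG (μ := μ)).indicator (hG.S_meas r)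
  have i3 := (h.e_int (μ := μ) hG.q_cont).indicator (hG.S_meas r)
  have key : ∀ᵐ y ∂μ, (2 * ⟪fderiv ℝ (fun y => wg G r y • X y) y (a y (p y)), p y⟫
      - (∑ i, ⟪fderiv ℝ (fun y => wg G r y • X y) y (b i), b i⟫) * ⟪a y (p y), p y⟫
      - ⟪fderiv ℝ a y (wg G r y • X y) (p y), p y⟫) ≤
      (2 - k + (49 + 24 * k) * lam ^ 11 * β) * (wg G r y * ⟪a y (p y), p y⟫)
      - 4 * (Sg G r).indicator (fun y => (muf a G y)⁻¹ * ⟪a y (p y), G y⟫ ^ 2) y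
      + 2 * (Sg G r).indicator (fun y => ⟪G y, y⟫ * ⟪a y (p y), p y⟫) y := by
    filter_upwards [hG.w_ae (μ := μ) hr, hRL.ae_differentiableAt (μ := μ)] with y hy hR
    have dX : HasFDerivAt X (ContinuousLinearMap.id ℝ E + fderiv ℝ R y) y :=
      (hasFDerivAt_id y).add hR.hasFDerivAt
    have e0 : fderiv ℝ (fun y => wg G r y • X y) y = _ := (hy.smul dX).fderiv
    rw [e0]
    by_cases hyS : y ∈ Sg G r
    · have hyb := hSb y hyS
      rw [indicator_of_mem hyS, indicator_of_mem hyS, indicator_of_mem hyS]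
      simp only [ContinuousLinearMap.add_apply, ContinuousLinearMap.smul_apply,
        ContinuousLinearMap.id_apply, ContinuousLinearMap.smulRight_apply, innerSL_apply_apply,
        inner_add_left, inner_smul_left, conj_trivial, smul_eq_mul, map_smul,
        Finset.sum_add_distrib, real_inner_self_eq_norm_sq, b.norm_eq_one, smul_add]
      have w0 := hG.w_nonneg r y
      have en := h.e_nonneg y (p y)
      have pe := h.ell y (p y)
      have hyn : ‖y‖ < s := by simpa using hyb
      have t1 : |⟪fderiv ℝ R y (a y (p y)), p y⟫| ≤ 24 * lam ^ 11 * β * ⟪a y (p y), p y⟫ := by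
        refine (abs_real_inner_le_norm _ _).trans ?_
        calc _ ≤ (24 * lam ^ 9 * β) * (lam * ‖p y‖) * ‖p y‖ := by
              gcongr
              refine (ContinuousLinearMap.le_opNorm _ _).trans ?_
              gcongr
              · exact hRd y hyb
              · exact h.a_le _ _
          _ = 24 * lam ^ 10 * β * ‖p y‖ ^ 2 := by ring
          _ ≤ 24 * lam ^ 10 * β * (lam * ⟪a y (p y), p y⟫) := by gcongr
          _ = _ := by ring
      have t2 : |∑ i, ⟪fderiv ℝ R y (b i), b i⟫| ≤ k * (24 * lam ^ 11 * β) := by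
        refine (Finset.abs_sum_le_sum_abs _ _).trans ?_
        have : ∀ i ∈ (Finset.univ : Finset (Fin k)), |⟪fderiv ℝ R y (b i), b i⟫| ≤ 24 * lam ^ 11 * β := by
          intro i _
          refine (abs_real_inner_le_norm _ _).trans ?_
          have := (fderiv ℝ R y).le_opNorm (b i)
          rw [b.norm_eq_one, mul_one] at *
          refine this.trans ((hRd y hyb).trans ?_)
          gcongr <;> first | norm_num | assumption
        refine (Finset.sum_le_sum this).trans ?_
        simp
      have t3 : |⟪fderiv ℝ a y (X y) (p y), p y⟫| ≤ lam ^ 11 * β * ⟪a y (p y), p y⟫ := by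
        refine (abs_real_inner_le_norm _ _).trans ?_
        have hXn : ‖X y‖ ≤ lam ^ 4 * (lam * (lam * ‖y‖)) := by
          rw [hXe y hyb, norm_smul, Real.norm_of_nonneg (inv_nonneg.2 (h.mu_nonneg hG y))]
          gcongr
          · exact h.muinv_le hG y
          · refine (h.a_le _ _).trans ?_
            gcongr
            exact hG.G_le y
        calc _ ≤ (K * (lam ^ 4 * (lam * (lam * ‖y‖))) * ‖p y‖) * ‖p y‖ := by
              gcongr
              refine (h.Da_le _ _ _).trans ?_
              gcongr
          _ = (K * lam * ‖y‖) * lam ^ 5 * ‖p y‖ ^ 2 := by ring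
          _ ≤ β * lam ^ 5 * (lam * ⟪a y (p y), p y⟫) := by
              gcongr
              refine le_trans ?_ hK
              gcongr
          _ = lam ^ 6 * β * ⟪a y (p y), p y⟫ := by ring
          _ ≤ _ := by gcongr <;> first | norm_num | assumption
      have s1 : ∑ i, ⟪G y, b i⟫ * ⟪X y, b i⟫ = ⟪G y, y⟫ := by
        have : ∑ i, ⟪G y, b i⟫ * ⟪X y, b i⟫ = ⟪G y, X y⟫ := by
          rw [← b.sum_inner_mul_inner]
          exact Finset.sum_congr rfl fun i _ => by rw [real_inner_comm (b i) (X y)]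
        rw [this, hXe y hyb, inner_smul_right, real_inner_comm]
        by_cases hy0 : y = 0
        · subst hy0; simp
        · rw [muf]
          have := h.P_pos hG hy0
          have := hG.q_pos hy0
          field_simp
      have s2 : ⟪X y, p y⟫ = (muf a G y)⁻¹ * ⟪a y (p y), G y⟫ := by
        rw [hXe y hyb, inner_smul_left, h.symm, real_inner_comm]; simp
      have s3 : ⟪G y, a y (p y)⟫ = ⟪a y (p y), G y⟫ := real_inner_comm _ _
      have s4 : ∑ x, -2 * ⟪G y, b x⟫ * ⟪X y, b x⟫ = -2 * ⟪G y, y⟫ := by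
        rw [← s1, Finset.mul_sum]; exact Finset.sum_congr rfl fun i _ => by ring
      have s5 : ∑ x, wg G r y * ⟪fderiv ℝ R y (b x), b x⟫ = wg G r y * ∑ x, ⟪fderiv ℝ R y (b x), b x⟫ :=
        (Finset.mul_sum _ _ _).symm
      rw [s4, s2, s3, s5]
      simp only [Finset.sum_const, Finset.card_univ, Fintype.card_fin, nsmul_eq_mul, one_pow, mul_one]
      rw [abs_le] at t1 t2 t3
      have u1 := mul_le_mul_of_nonneg_left t1.2 w0
      have u3 := mul_le_mul_of_nonneg_left t3.1 w0
      have u2 := mul_le_mul_of_nonneg_left t2.1 (mul_nonneg w0 en)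
      nlinarith [u1, u2, u3]
    · rw [indicator_of_notMem hyS, indicator_of_notMem hyS, indicator_of_notMem hyS, hG.w_zero' hyS]
      simp
  have e1 : Integrable (fun y => (2 - k + (49 + 24 * k) * lam ^ 11 * β) * (wg G r y * ⟪a y (p y), p y⟫)
      - 4 * (Sg G r).indicator (fun y => (muf a G y)⁻¹ * ⟪a y (p y), G y⟫ ^ 2) y) μ :=
    (i1.const_mul _).sub (i2.const_mul _)
  have := integral_mono_ae hint (e1.add (i3.const_mul 2)) key
  rw [h0, integral_add' e1 (i3.const_mul 2), integral_sub (i1.const_mul _) (i2.const_mul _),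
    integral_const_mul, integral_const_mul, integral_const_mul, integral_indicator (hG.S_meas r),
    integral_indicator (hG.S_meas r)] at this
  have ie := h.e_int (μ := μ) (f := fun _ => 1) continuous_const
  simp only [one_mul] at ie
  have hW := hG.W_eq ie (h.e_int hG.q_cont) r
  rw [If]
  nlinarith

theorem core_ineq [Nontrivial E] (b : OrthonormalBasis (Fin k) ℝ E) (h : CoreH μ a v p lam K ρ) (hG : GH G lam)
    {r s β : ℝ}
    (hr : 0 < r) (hrs : lam * r < s) (hsρ : s ≤ ρ) (hβ2 : β ≤ 2 * lam) (hβ0 : 0 ≤ β)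
    (hB : ∀ y ∈ ball (0 : E) s, ‖(a y).comp G - ContinuousLinearMap.id ℝ E‖ ≤ β)
    (hK : K * lam * s ≤ β) :
    ∃ H' I', HasDerivAt (Hf μ a G v) H' r ∧ HasDerivAt (If μ a G p) I' r ∧
      |r * H' - k * Hf μ a G v r - If μ a G p r| ≤ 4 * k * lam ^ 6 * β * Hf μ a G v r ∧
      If μ a G p r ^ 2 ≤ Hf μ a G v r *
        (r * I' - k * If μ a G p r + (49 + 24 * k) * lam ^ 11 * β * If μ a G p r) := by
  have l1 := h.lam1
  have l0 : 0 ≤ lam := by linarith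
  refine ⟨_, _, h.H_deriv hG b hr (by linarith), h.I_deriv hG hr, ?_, ?_⟩
  · have e : r * (((∫ y in Sg G r, Tf a G b y * v y ^ 2 ∂μ) + If μ a G p r) / r) - k * Hf μ a G v r
        - If μ a G p r = ∫ y in Sg G r, (Tf a G b y - k * muf a G y) * v y ^ 2 ∂μ := by
      simp only [sub_mul, mul_assoc]
      rw [integral_sub (h.T_int hG b).integrableOn ((h.muv_int hG).integrableOn.const_mul _),
        integral_const_mul, mul_div_cancel₀ _ hr.ne']
      rw [Hf]; ring
    rw [e, Hf, ← integral_const_mul, ← Real.norm_eq_abs]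
    apply norm_integral_le_of_norm_le ((h.muv_int hG).integrableOn.const_mul _)
    have hS : ∀ᵐ y ∂μ.restrict (Sg G r), y ∈ Sg G r := ae_restrict_mem (hG.S_meas r)
    filter_upwards [hS, ae_restrict_of_ae (h.lip.ae_differentiableAt (μ := μ)),
      ae_restrict_of_ae (Measure.ae_ne μ (0:E))] with y hyS hd hy0
    have hyn := hG.q_lt hr.le hyS
    have hyb : y ∈ ball (0:E) s := by simp; linarith
    rw [norm_mul, Real.norm_of_nonneg (sq_nonneg (v y)), ← mul_assoc, Real.norm_eq_abs]
    gcongr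
    have t1 := h.T_bound hG b hd (hB y hyb)
    have q := hG.q_pos hy0
    have hm := h.mu_lower hG hy0
    have t2 : |1 - muf a G y| ≤ lam ^ 2 * β := by
      have e : 1 - muf a G y = - (⟪((a y).comp G - ContinuousLinearMap.id ℝ E) y, G y⟫ / ⟪G y, y⟫) := by
        rw [muf]
        simp only [ContinuousLinearMap.sub_apply, ContinuousLinearMap.comp_apply,
          ContinuousLinearMap.id_apply, inner_sub_left]
        rw [real_inner_comm (G y) y]
        field_simp
        ring
      rw [e, abs_neg, abs_div, abs_of_pos q, div_le_iff₀ q]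
      refine (abs_real_inner_le_norm _ _).trans ?_
      calc _ ≤ (β * ‖y‖) * (lam * ‖y‖) := by
            gcongr
            · exact (ContinuousLinearMap.le_opNorm _ _).trans (by gcongr; exact hB y hyb)
            · exact hG.G_le y
        _ = lam * β * ‖y‖ ^ 2 := by ring
        _ ≤ lam * β * (lam * ⟪G y, y⟫) := by gcongr; exact hG.ell y
        _ = _ := by ring
    have t3 : K * (lam * ‖y‖) ≤ β := by
      refine le_trans ?_ hK
      rw [← mul_assoc]; gcongr; linarith
    have t4 : |Tf a G b y - k * muf a G y| ≤ |Tf a G b y - k| + k * |1 - muf a G y| := by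
      have e : Tf a G b y - k * muf a G y = (Tf a G b y - k) + k * (1 - muf a G y) := by ring
      rw [e]
      refine (abs_add_le _ _).trans ?_
      rw [abs_mul, Nat.abs_cast]
    calc _ ≤ k * (β + β) + k * (lam ^ 2 * β) := by
          refine t4.trans (add_le_add (t1.trans ?_) ?_) <;> gcongr
      _ = k * (2 + lam ^ 2) * β * 1 := by ring
      _ ≤ k * (4 * lam ^ 2) * β * (lam ^ 4 * muf a G y) := by gcongr; nlinarith
      _ = _ := by ring
  · refine (h.I_CS hG hr (by linarith)).trans ?_
    exact mul_le_mul_of_nonneg_left (I3 b h hG hr hrs hsρ hβ2 hβ0 hB hK) (h.H_nonneg hG r)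

end CoreH
end core5
end part5

section part6
open scoped Convolution RealInnerProductSpace


section core6

def FP (H I : ℝ → ℝ) (k c r : ℝ) : Prop :=
  ∃ H' I', HasDerivAt H H' r ∧ HasDerivAt I I' r ∧ |r * H' - k * H r - I r| ≤ c * H r ∧
    I r ^ 2 ≤ H r * (r * I' - k * I r + c * I r) ∧ 0 ≤ I r

theorem FP.mono {H I : ℝ → ℝ} {k c : ℝ → ℝ} {k0 : ℝ} {θ : ℝ → ℝ} {s t : ℝ} (hs : 0 < s) (hst : s ≤ t)
    (hF : ∀ r ∈ Icc s t, FP H I k0 (c r) r) (hH : ∀ r ∈ Icc s t, 0 < H r)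
    (hθ : ∀ r ∈ Icc s t, HasDerivAt θ (2 * c r / r * θ r) r) (hθ0 : ∀ r ∈ Icc s t, 0 < θ r) :
    θ s * (I s / H s) ≤ θ t * (I t / H t) := by
  have hm : MonotoneOn (fun r => θ r * (I r / H r)) (Icc s t) := by
    have hd : ∀ r ∈ Icc s t, ∃ D, HasDerivAt (fun r => θ r * (I r / H r)) D r ∧ 0 ≤ D := by
      intro r hr
      obtain ⟨H', I', h1, h2, h3, h4, h5⟩ := hF r hr
      have hHr := hH r hr
      have hr0 : 0 < r := lt_of_lt_of_le hs hr.1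
      refine ⟨_, (hθ r hr).mul (h2.div h1 hHr.ne'), ?_⟩
      have e : 2 * c r / r * θ r * (I r / H r) + θ r * ((I' * H r - I r * H') / H r ^ 2) =
        θ r / (r * H r ^ 2) * (2 * c r * I r * H r + r * I' * H r - I r * (r * H')) := by
        field_simp
        ring
      have h6 : 0 ≤ 2 * c r * I r * H r + r * I' * H r - I r * (r * H') := by
        have h7 : r * H' ≤ k0 * H r + I r + c r * H r := by linarith [(abs_le.1 h3).2]
        have h8 := mul_le_mul_of_nonneg_left h7 h5
        nlinarith
      have := hθ0 r hr
      show 0 ≤ 2 * c r / r * θ r * (I r / H r) + θ r * ((I' * H r - I r * H') / H r ^ 2)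
      rw [e]; positivity
    apply monotoneOn_of_deriv_nonneg (convex_Icc s t)
    · intro r hr
      obtain ⟨D, hD, _⟩ := hd r hr
      exact hD.continuousAt.continuousWithinAt
    · intro r hr
      obtain ⟨D, hD, _⟩ := hd r (interior_subset hr)
      exact hD.differentiableAt.differentiableWithinAt
    · intro r hr
      obtain ⟨D, hD, h0⟩ := hd r (interior_subset hr)
      rw [hD.deriv]; exact h0
  exact hm (left_mem_Icc.2 hst) (right_mem_Icc.2 hst) hst

theorem FP.mono_pow {H I : ℝ → ℝ} {k0 c : ℝ} {s t : ℝ} (hs : 0 < s) (hst : s ≤ t)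
    (hF : ∀ r ∈ Icc s t, FP H I k0 c r) (hH : ∀ r ∈ Icc s t, 0 < H r) :
    I s / H s ≤ (t / s) ^ (2 * c) * (I t / H t) := by
  have ht : 0 < t := lt_of_lt_of_le hs hst
  have := FP.mono (k := fun _ => 0) (c := fun _ => c) (θ := fun r => r ^ (2 * c)) hs hst hF hH ?_ ?_
  · rw [Real.div_rpow ht.le hs.le, div_mul_eq_mul_div, le_div_iff₀ (by positivity)]
    linarith
  · intro r hr
    have hr0 : 0 < r := lt_of_lt_of_le hs hr.1
    have := Real.hasDerivAt_rpow_const (x := r) (p := 2 * c) (Or.inl hr0.ne')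
    refine this.congr_deriv ?_
    rw [Real.rpow_sub_one hr0.ne']
    field_simp
  · intro r hr
    have hr0 : 0 < r := lt_of_lt_of_le hs hr.1
    positivity

theorem FP.mono_exp {H I : ℝ → ℝ} {k0 c : ℝ} {s t : ℝ} (hs : 0 < s) (hst : s ≤ t) (ht1 : t ≤ 1)
    (hc : 0 ≤ c) (hF : ∀ r ∈ Icc s t, FP H I k0 (c * r) r) (hH : ∀ r ∈ Icc s t, 0 < H r) :
    I s / H s ≤ Real.exp (2 * c) * (I t / H t) := by
  have ht : 0 < t := lt_of_lt_of_le hs hst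
  have := FP.mono (k := fun _ => 0) (c := fun r => c * r) (θ := fun r => Real.exp (2 * c * r)) hs hst hF hH ?_ ?_
  · have hIs : 0 ≤ I s / H s := div_nonneg (hF s (left_mem_Icc.2 hst)).choose_spec.choose_spec.2.2.2.2
      (hH s (left_mem_Icc.2 hst)).le
    have hIt : 0 ≤ I t / H t := div_nonneg (hF t (right_mem_Icc.2 hst)).choose_spec.choose_spec.2.2.2.2
      (hH t (right_mem_Icc.2 hst)).le
    have e1 : 1 ≤ Real.exp (2 * c * s) := Real.one_le_exp (by positivity)
    have e2 : Real.exp (2 * c * t) ≤ Real.exp (2 * c) := Real.exp_le_exp.2 (by nlinarith)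
    calc I s / H s ≤ Real.exp (2 * c * s) * (I s / H s) := le_mul_of_one_le_left hIs e1
      _ ≤ _ := this
      _ ≤ _ := by gcongr
  · intro r hr
    have hr0 : 0 < r := lt_of_lt_of_le hs hr.1
    have := ((hasDerivAt_id r).const_mul (2 * c)).exp
    refine this.congr_deriv ?_
    simp only [id]
    field_simp
  · intro r hr; positivity

theorem FP.doub_upper {H I : ℝ → ℝ} {k0 : ℝ} {c : ℝ → ℝ} {c0 M : ℝ} {s t : ℝ} (hs : 0 < s) (hst : s ≤ t)
    (hF : ∀ r ∈ Icc s t, FP H I k0 (c r) r) (hH : ∀ r ∈ Icc s t, 0 < H r)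
    (hc : ∀ r ∈ Icc s t, c r ≤ c0) (hM : ∀ r ∈ Icc s t, I r / H r ≤ M) :
    Real.log (H t) - Real.log (H s) ≤ (k0 + c0 + M) * (Real.log t - Real.log s) := by
  have hm : MonotoneOn (fun r => (k0 + c0 + M) * Real.log r - Real.log (H r)) (Icc s t) := by
    have hd : ∀ r ∈ Icc s t, ∃ D, HasDerivAt (fun r => (k0 + c0 + M) * Real.log r - Real.log (H r)) D r ∧ 0 ≤ D := by
      intro r hr
      obtain ⟨H', I', h1, h2, h3, h4, h5⟩ := hF r hr
      have hHr := hH r hr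
      have hr0 : 0 < r := lt_of_lt_of_le hs hr.1
      refine ⟨_, ((Real.hasDerivAt_log hr0.ne').const_mul _).sub (h1.log hHr.ne'), ?_⟩
      have h7 := (abs_le.1 h3).2
      have h8 := hM r hr
      rw [div_le_iff₀ hHr] at h8
      have h9 := mul_le_mul_of_nonneg_right (hc r hr) hHr.le
      have e : (k0 + c0 + M) * r⁻¹ - H' / H r = ((k0 + c0 + M) * H r - r * H') / (r * H r) := by
        field_simp
      rw [e]
      apply div_nonneg _ (by positivity)
      linarith
    apply monotoneOn_of_deriv_nonneg (convex_Icc s t)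
    · intro r hr
      obtain ⟨D, hD, _⟩ := hd r hr
      exact hD.continuousAt.continuousWithinAt
    · intro r hr
      obtain ⟨D, hD, _⟩ := hd r (interior_subset hr)
      exact hD.differentiableAt.differentiableWithinAt
    · intro r hr
      obtain ⟨D, hD, h0⟩ := hd r (interior_subset hr)
      rw [hD.deriv]; exact h0
  have := hm (left_mem_Icc.2 hst) (right_mem_Icc.2 hst) hst
  simp only at this
  linarith

theorem FP.doub_lower {H I : ℝ → ℝ} {k0 : ℝ} {c : ℝ → ℝ} {c0 M : ℝ} {s t : ℝ} (hs : 0 < s) (hst : s ≤ t)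
    (hF : ∀ r ∈ Icc s t, FP H I k0 (c r) r) (hH : ∀ r ∈ Icc s t, 0 < H r)
    (hc : ∀ r ∈ Icc s t, c r ≤ c0) (hM : ∀ r ∈ Icc s t, M ≤ I r / H r) :
    (k0 - c0 + M) * (Real.log t - Real.log s) ≤ Real.log (H t) - Real.log (H s) := by
  have hm : MonotoneOn (fun r => Real.log (H r) - (k0 - c0 + M) * Real.log r) (Icc s t) := by
    have hd : ∀ r ∈ Icc s t, ∃ D, HasDerivAt (fun r => Real.log (H r) - (k0 - c0 + M) * Real.log r) D r ∧ 0 ≤ D := by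
      intro r hr
      obtain ⟨H', I', h1, h2, h3, h4, h5⟩ := hF r hr
      have hHr := hH r hr
      have hr0 : 0 < r := lt_of_lt_of_le hs hr.1
      refine ⟨_, (h1.log hHr.ne').sub ((Real.hasDerivAt_log hr0.ne').const_mul _), ?_⟩
      have h7 := (abs_le.1 h3).1
      have h8 := hM r hr
      rw [le_div_iff₀ hHr] at h8
      have h9 := mul_le_mul_of_nonneg_right (hc r hr) hHr.le
      have e : H' / H r - (k0 - c0 + M) * r⁻¹ = (r * H' - (k0 - c0 + M) * H r) / (r * H r) := by
        field_simp
      rw [e]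
      apply div_nonneg _ (by positivity)
      linarith
    apply monotoneOn_of_deriv_nonneg (convex_Icc s t)
    · intro r hr
      obtain ⟨D, hD, _⟩ := hd r hr
      exact hD.continuousAt.continuousWithinAt
    · intro r hr
      obtain ⟨D, hD, _⟩ := hd r (interior_subset hr)
      exact hD.differentiableAt.differentiableWithinAt
    · intro r hr
      obtain ⟨D, hD, h0⟩ := hd r (interior_subset hr)
      rw [hD.deriv]; exact h0
  have := hm (left_mem_Icc.2 hst) (right_mem_Icc.2 hst) hst
  simp only at this
  linarith

set_option maxHeartbeats 4000000 in
theorem chain (k0 c D lam : ℝ) (hk : 0 ≤ k0) (hc : 0 ≤ c) (hD : 1 ≤ D) (hlam : 1 ≤ lam) :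
    ∃ C1 > 0, ∃ C2 > 0, ∀ (He Ie Ha Ia : ℝ → ℝ) (T : ℝ), T ≤ 1 →
      (∀ r ∈ Ioo 0 T, FP He Ie k0 c r) → (∀ r ∈ Ioo 0 T, FP Ha Ia k0 (c * r) r) →
      (∀ r s, 0 < r → r ≤ s → He r ≤ He s) → (∀ r s, 0 < r → r ≤ s → Ha r ≤ Ha s) →
      (∀ r, 0 < r → He r ≤ D * Ha (lam * r)) → (∀ r, 0 < r → Ha r ≤ D * He (lam * r)) →
      ∀ r1 r2, 0 < r1 → r1 ≤ r2 → r2 < T → 0 < He r1 →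
        Ie r1 / He r1 ≤ C1 + C2 * (Ie r2 / He r2) := by
  have l0 : 0 < lam := by linarith
  have hl2 : 0 < Real.log 2 := Real.log_pos (by norm_num)
  have lam2 : 1 ≤ lam ^ 2 := one_le_pow₀ hlam
  have hLQ : 0 < Real.log (2 * lam ^ 2) := Real.log_pos (by linarith)
  have hDl : 0 ≤ Real.log D := Real.log_nonneg hD
  set l2 := Real.log 2 with hl2d
  set LQ := Real.log (2 * lam ^ 2) with hLQd
  set P1 := (4 * lam ^ 4) ^ (2 * c) with hP1
  set P2 := (2 * lam ^ 2) ^ (2 * c) with hP2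
  set eC := Real.exp (2 * c) with heC
  have P1p : 0 < P1 := by positivity
  have P2p : 0 < P2 := by positivity
  have eCp : 0 < eC := by positivity
  set A1 := P1 * (((k0 + c) * LQ + 2 * Real.log D) / l2 + c) with hA1
  set B1 := P1 * (eC * LQ / l2) with hB1
  set A2 := eC * (((k0 + c) * LQ + 2 * Real.log D) / l2 + c) with hA2
  set B2 := eC * (P2 * LQ / l2) with hB2
  have A1p : 0 ≤ A1 := by positivity
  have A2p : 0 ≤ A2 := by positivity
  have B1p : 0 ≤ B1 := by positivity
  have B2p : 0 ≤ B2 := by positivity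
  refine ⟨A1 + B1 * A2 + 1, by positivity, B1 * B2 + P1, by positivity, ?_⟩
  intro He Ie Ha Ia T hT hFe hFa mHe mHa cea cae r1 r2 hr1 hr12 hr2 hpos
  have hr2p : 0 < r2 := lt_of_lt_of_le hr1 hr12
  have Hep : ∀ r, r1 ≤ r → 0 < He r := fun r hr => lt_of_lt_of_le hpos (mHe r1 r hr1 hr)
  have hN2 : 0 ≤ Ie r2 / He r2 := div_nonneg
    (hFe r2 ⟨hr2p, hr2⟩).choose_spec.choose_spec.2.2.2.2 (Hep r2 hr12).le
  have subT : ∀ {s t}, 0 < s → t < T → ∀ r ∈ Icc s t, r ∈ Ioo 0 T := fun hs ht r hr =>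
    ⟨lt_of_lt_of_le hs hr.1, lt_of_le_of_lt hr.2 ht⟩
  -- monotonicity on bounded ratios
  have monoE : ∀ s t Q : ℝ, r1 ≤ s → s ≤ t → t < T → t ≤ Q * s →
      Ie s / He s ≤ Q ^ (2 * c) * (Ie t / He t) := by
    intro s t Q h1 h2 h3 h4
    have hs : 0 < s := by linarith
    have := FP.mono_pow hs h2 (fun r hr => hFe r (subT hs h3 r hr)) (fun r hr => Hep r (h1.trans hr.1))
    refine this.trans ?_
    have h0 : 0 ≤ Ie t / He t := div_nonneg
      (hFe t ⟨by linarith, h3⟩).choose_spec.choose_spec.2.2.2.2 (Hep t (h1.trans h2)).le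
    have : 0 < t := by linarith
    gcongr
    rwa [div_le_iff₀ hs]
  by_cases hcase : r2 ≤ 4 * lam ^ 4 * r1
  · have := monoE r1 r2 _ le_rfl hr12 hr2 hcase
    nlinarith [mul_nonneg (mul_nonneg B1p B2p) hN2, mul_nonneg B1p A2p]
  push Not at hcase
  have lam3 : lam ≤ lam ^ 3 := le_self_pow₀ hlam (by norm_num)
  have lam4 : lam ^ 2 ≤ lam ^ 4 := pow_le_pow_right₀ hlam (by norm_num)
  have lam34 : lam ^ 3 ≤ lam ^ 4 := pow_le_pow_right₀ hlam (by norm_num)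
  set t1 := lam * r1 with ht1
  set t2 := 2 * lam ^ 3 * r1 with ht2
  have t1p : 0 < t1 := by positivity
  have t12 : t1 ≤ t2 := by rw [ht1, ht2]; gcongr; linarith
  have hd1 : lam ^ 2 * r1 ≤ 2 * lam ^ 2 * r1 := by nlinarith [mul_pos (pow_pos l0 2) hr1]
  have t2T : t2 < T := by
    have : t2 ≤ 4 * lam ^ 4 * r1 := by rw [ht2]; gcongr; linarith
    linarith
  -- positivity of Ha
  have Hap : ∀ r, t1 ≤ r → 0 < Ha r := by
    intro r hr
    have h1 := cea r1 hr1
    have h2 := mHa _ _ t1p hr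
    have : 0 < Ha (lam * r1) := by
      by_contra hcc
      push Not at hcc
      have := mul_nonpos_of_nonneg_of_nonpos (le_trans zero_le_one hD) hcc
      linarith
    linarith
  have NaP : ∀ r, t1 ≤ r → r < T → 0 ≤ Ia r / Ha r := fun r h1 h2 => div_nonneg
    (hFa r ⟨by linarith, h2⟩).choose_spec.choose_spec.2.2.2.2 (Hap r h1).le
  have monoA : ∀ s t : ℝ, t1 ≤ s → s ≤ t → t < T → Ia s / Ha s ≤ eC * (Ia t / Ha t) := by
    intro s t h1 h2 h3
    have hs : 0 < s := by linarith
    exact FP.mono_exp hs h2 (by linarith) hc (fun r hr => hFa r (subT hs h3 r hr))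
      (fun r hr => Hap r (h1.trans hr.1))
  have hcr : ∀ {s t : ℝ}, t < T → ∀ r ∈ Icc s t, c * r ≤ c := fun ht r hr =>
    mul_le_of_le_one_right hc (hr.2.trans (ht.le.trans hT))
  -- step 1
  have u1 : lam ^ 2 * r1 ≥ r1 := le_mul_of_one_le_left hr1.le lam2
  have u2 : 2 * lam ^ 2 * r1 ≤ 4 * lam ^ 4 * r1 := by gcongr; linarith
  have s1 : (k0 - c + (Ie r1 / He r1) / P1) * l2 ≤
      Real.log (He (2 * lam ^ 2 * r1)) - Real.log (He (lam ^ 2 * r1)) := by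
    have := FP.doub_lower (H := He) (I := Ie) (k0 := k0) (c := fun _ => c) (c0 := c)
      (M := (Ie r1 / He r1) / P1) (s := lam ^ 2 * r1) (t := 2 * lam ^ 2 * r1) (by positivity) hd1
      (fun r hr => hFe r (subT (by positivity) (by linarith) r hr))
      (fun r hr => Hep r (by linarith [hr.1])) (fun r hr => le_rfl) ?_
    · have e : Real.log (2 * lam ^ 2 * r1) - Real.log (lam ^ 2 * r1) = l2 := by
        rw [mul_assoc, Real.log_mul (by norm_num) (by positivity)]; ring
      rwa [e] at this
    · intro r hr
      rw [div_le_iff₀ P1p, mul_comm]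
      exact monoE r1 r _ le_rfl (by linarith [hr.1]) (by linarith [hr.2]) (by linarith [hr.2])
  -- step 2
  have s2 : Real.log (He (2 * lam ^ 2 * r1)) - Real.log (He (lam ^ 2 * r1)) ≤
      Real.log (Ha t2) - Real.log (Ha t1) + 2 * Real.log D := by
    have h1 := cea (2 * lam ^ 2 * r1) (by positivity)
    have h2 := cae t1 t1p
    have e1 : lam * (2 * lam ^ 2 * r1) = t2 := by rw [ht2]; ring
    have e2 : lam * t1 = lam ^ 2 * r1 := by rw [ht1]; ring
    rw [e1] at h1; rw [e2] at h2
    have h3 := Real.log_le_log (Hep _ (by linarith)) h1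
    have h4 := Real.log_le_log (Hap _ le_rfl) h2
    rw [Real.log_mul (by linarith) (Hap _ t12).ne'] at h3
    rw [Real.log_mul (by linarith) (Hep _ (by linarith)).ne'] at h4
    linarith
  have s3 : Real.log (Ha t2) - Real.log (Ha t1) ≤ (k0 + c + eC * (Ia t2 / Ha t2)) * LQ := by
    have := FP.doub_upper (H := Ha) (I := Ia) (k0 := k0) (c := fun r => c * r) (c0 := c)
      (M := eC * (Ia t2 / Ha t2)) (s := t1) (t := t2) t1p t12
      (fun r hr => hFa r (subT t1p t2T r hr))
      (fun r hr => Hap r hr.1) (hcr t2T) (fun r hr => monoA r t2 hr.1 hr.2 t2T)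
    have e : Real.log t2 - Real.log t1 = LQ := by
      have : t2 = (2 * lam ^ 2) * t1 := by rw [ht2, ht1]; ring
      rw [this, Real.log_mul (by positivity) (by positivity)]; ring
    rwa [e] at this
  have m1 : Ie r1 / He r1 ≤ A1 + B1 * (Ia t2 / Ha t2) := by
    have h1 : (k0 - c + (Ie r1 / He r1) / P1) * l2 ≤ (k0 + c + eC * (Ia t2 / Ha t2)) * LQ + 2 * Real.log D := by
      linarith
    rw [← le_div_iff₀ hl2] at h1
    have h2 : (Ie r1 / He r1) / P1 ≤ ((k0 + c + eC * (Ia t2 / Ha t2)) * LQ + 2 * Real.log D) / l2 + c := by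
      linarith
    rw [div_le_iff₀ P1p] at h2
    refine h2.trans (le_of_eq ?_)
    rw [hA1, hB1]; field_simp; ring
  -- step 4
  set x1 := r2 / (2 * lam) with hx1
  set x2 := r2 / lam with hx2
  have x1p : 0 < x1 := by positivity
  have x12 : x2 = 2 * x1 := by rw [hx1, hx2]; field_simp
  have tx : t2 ≤ x1 := by
    rw [hx1, le_div_iff₀ (by positivity), ht2]
    nlinarith
  have x2T : x2 < T := by
    have : x2 ≤ r2 := div_le_self hr2p.le hlam
    linarith
  have s4 : (k0 - c + (Ia t2 / Ha t2) / eC) * l2 ≤ Real.log (Ha x2) - Real.log (Ha x1) := by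
    have := FP.doub_lower (H := Ha) (I := Ia) (k0 := k0) (c := fun r => c * r) (c0 := c)
      (M := (Ia t2 / Ha t2) / eC) (s := x1) (t := x2) x1p (by linarith)
      (fun r hr => hFa r (subT x1p x2T r hr))
      (fun r hr => Hap r (by linarith [hr.1])) (hcr x2T) ?_
    · have e : Real.log x2 - Real.log x1 = l2 := by
        rw [x12, Real.log_mul (by norm_num) (by positivity)]; ring
      rwa [e] at this
    · intro r hr
      rw [div_le_iff₀ eCp, mul_comm]
      exact monoA t2 r t12 (by linarith [hr.1]) (by linarith [hr.2])
  set z := r2 / (2 * lam ^ 2) with hz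
  have zp : 0 < z := by positivity
  have zr : r1 ≤ z := by
    rw [hz, le_div_iff₀ (by positivity)]; nlinarith
  have zr2 : z ≤ r2 := div_le_self hr2p.le (by linarith)
  have s5 : Real.log (Ha x2) - Real.log (Ha x1) ≤ Real.log (He r2) - Real.log (He z) + 2 * Real.log D := by
    have h1 := cae x2 (by positivity)
    have h2 := cea z zp
    have e1 : lam * x2 = r2 := by rw [hx2]; field_simp
    have e2 : lam * z = x1 := by rw [hz, hx1]; field_simp
    rw [e1] at h1; rw [e2] at h2
    have h3 := Real.log_le_log (Hap _ (by linarith)) h1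
    have h4 := Real.log_le_log (Hep _ zr) h2
    rw [Real.log_mul (by linarith) (Hep _ hr12).ne'] at h3
    rw [Real.log_mul (by linarith) (Hap _ (by linarith)).ne'] at h4
    linarith
  have s6 : Real.log (He r2) - Real.log (He z) ≤ (k0 + c + P2 * (Ie r2 / He r2)) * LQ := by
    have := FP.doub_upper (H := He) (I := Ie) (k0 := k0) (c := fun r => c) (c0 := c)
      (M := P2 * (Ie r2 / He r2)) (s := z) (t := r2) zp zr2
      (fun r hr => hFe r (subT zp hr2 r hr))
      (fun r hr => Hep r (zr.trans hr.1)) (fun r hr => le_rfl) (fun r hr => by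
        apply monoE r r2 _ (zr.trans hr.1) hr.2 hr2
        have : z * (2 * lam ^ 2) = r2 := by rw [hz]; field_simp
        nlinarith [hr.1])
    have e : Real.log r2 - Real.log z = LQ := by
      rw [hz, Real.log_div hr2p.ne' (by positivity)]; ring
    rwa [e] at this
  have m2 : Ia t2 / Ha t2 ≤ A2 + B2 * (Ie r2 / He r2) := by
    have h1 : (k0 - c + (Ia t2 / Ha t2) / eC) * l2 ≤ (k0 + c + P2 * (Ie r2 / He r2)) * LQ + 2 * Real.log D := by
      linarith
    rw [← le_div_iff₀ hl2] at h1
    have h2 : (Ia t2 / Ha t2) / eC ≤ ((k0 + c + P2 * (Ie r2 / He r2)) * LQ + 2 * Real.log D) / l2 + c := by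
      linarith
    rw [div_le_iff₀ eCp] at h2
    refine h2.trans (le_of_eq ?_)
    rw [hA2, hB2]; field_simp; ring
  have := mul_le_mul_of_nonneg_left m2 B1p
  nlinarith [mul_nonneg P1p.le hN2]

end core6
end part6

section part7
open scoped Convolution RealInnerProductSpace


section core7
variable {E : Type*} [NormedAddCommGroup E] [InnerProductSpace ℝ E] [FiniteDimensional ℝ E]
  [MeasurableSpace E] [BorelSpace E] {μ : Measure E} [μ.IsAddHaarMeasure]

theorem polar_ball [Nontrivial E] {f : E → ℝ} (hf : Continuous f) (hfc : HasCompactSupport f) {r : ℝ} (hr : 0 < r) :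
    ∫ y in ball 0 r, f y ∂μ = ∫ t in (0:ℝ)..r, t ^ (Module.finrank ℝ E - 1) *
      ∫ w : sphere (0:E) 1, f (t • (w : E)) ∂μ.toSphere := by
  set n := Module.finrank ℝ E - 1
  set g : E → ℝ := (ball 0 r).indicator f with hg
  have gi : Integrable g μ := (hf.integrable_of_hasCompactSupport hfc).indicator measurableSet_ball
  set F : sphere (0:E) 1 × Ioi (0:ℝ) → ℝ := fun z => g ((z.2 : ℝ) • (z.1 : E)) with hF
  have hcomp : ∀ x : ({(0:E)}ᶜ : Set E), F (homeomorphUnitSphereProd E x) = g x := by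
    intro x
    simp only [hF]
    congr 1
    have := homeomorphUnitSphereProd_symm_apply_coe (E := E) (homeomorphUnitSphereProd E x)
    rw [Homeomorph.symm_apply_apply] at this
    exact this.symm
  have Fi : Integrable F (μ.toSphere.prod (.volumeIoiPow n)) := by
    rw [← μ.measurePreserving_homeomorphUnitSphereProd.integrable_comp_emb (Homeomorph.measurableEmbedding _)]
    have : F ∘ (homeomorphUnitSphereProd E) = fun x : ({(0:E)}ᶜ : Set E) => g x := funext hcomp
    rw [this]
    have h2 := integrableOn_iff_comap_subtypeVal (μ := μ) (f := g) (s := ({(0:E)}ᶜ : Set E)) (by measurability)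
    exact h2.1 gi.integrableOn
  have e1 : ∫ y in ball 0 r, f y ∂μ = ∫ z, F z ∂(μ.toSphere.prod (.volumeIoiPow n)) := by
    rw [← integral_indicator measurableSet_ball, ← hg]
    calc ∫ x, g x ∂μ = ∫ x : ({(0)}ᶜ : Set E), g x.1 ∂(μ.comap (↑)) := by
          rw [integral_subtype_comap (measurableSet_singleton _).compl fun x ↦ g x,
            restrict_compl_singleton]
      _ = ∫ x : ({(0)}ᶜ : Set E), F (homeomorphUnitSphereProd E x) ∂(μ.comap (↑)) := by
          simp only [hcomp]
      _ = _ := μ.measurePreserving_homeomorphUnitSphereProd.integral_comp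
        (Homeomorph.measurableEmbedding _) F
  rw [e1, integral_prod_symm _ Fi]
  have e2 : ∀ t : Ioi (0:ℝ), ∫ w, F (w, t) ∂μ.toSphere =
      (Iio r).indicator (fun t : ℝ => ∫ w : sphere (0:E) 1, f (t • (w : E)) ∂μ.toSphere) t := by
    intro t
    have ht : (0:ℝ) < t := t.2
    have hw : ∀ w : sphere (0:E) 1, ‖(t:ℝ) • (w:E)‖ = t := fun w => by
      rw [norm_smul, Real.norm_of_nonneg ht.le]; simp
    by_cases h : (t:ℝ) < r
    · rw [indicator_of_mem (by exact h)]
      apply integral_congr_ae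
      refine Filter.Eventually.of_forall fun w => ?_
      simp only [hF, hg]
      rw [indicator_of_mem]
      simp [hw w, h]
    · rw [indicator_of_notMem (by exact h)]
      apply integral_eq_zero_of_ae
      refine Filter.Eventually.of_forall fun w => ?_
      simp only [hF, hg]
      rw [indicator_of_notMem]
      · rfl
      · simpa [hw w] using h
  simp only [e2]
  set Φ : ℝ → ℝ := fun t : ℝ => ∫ w : sphere (0:E) 1, f (t • (w : E)) ∂μ.toSphere
  simp only [Measure.volumeIoiPow, ENNReal.ofReal]
  rw [integral_withDensity_eq_integral_smul ((measurable_subtype_coe.pow_const _).real_toNNReal),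
        integral_subtype_comap measurableSet_Ioi fun a ↦ Real.toNNReal (a ^ n) • (Iio r).indicator Φ a,
        setIntegral_congr_fun (g := fun t => (Iio r).indicator (fun t => t ^ n * Φ t) t) measurableSet_Ioi fun x hx ↦ ?_]
  · rw [setIntegral_indicator measurableSet_Iio, intervalIntegral.integral_of_le hr.le,
      ← Ioi_inter_Iic, ← Measure.restrict_congr_set (μ := volume) (s := Ioi 0 ∩ Iio r) (t := Ioi 0 ∩ Iic r)]
    exact (ae_eq_refl _).inter Iio_ae_eq_Iic
  · simp only [NNReal.smul_def]
    rw [Real.coe_toNNReal _ (pow_nonneg hx.out.le _)]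
    by_cases h : x < r
    · rw [indicator_of_mem (by exact h), indicator_of_mem (by exact h)]; rfl
    · rw [indicator_of_notMem (by exact h), indicator_of_notMem (by exact h)]; simp

theorem polar_diff [Nontrivial E] {f : E → ℝ} (hf : Continuous f) (hfc : HasCompactSupport f) {r : ℝ} (hr : 0 < r) :
    DifferentiableAt ℝ (fun r => ∫ y in ball 0 r, f y ∂μ) r := by
  have hc : Continuous (fun t : ℝ => ∫ w : sphere (0:E) 1, f (t • (w : E)) ∂μ.toSphere) := by
    have := continuous_parametric_integral_of_continuous (μ := μ.toSphere)
      (f := fun (t : ℝ) (w : sphere (0:E) 1) => f (t • (w : E))) (by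
        unfold Function.uncurry; fun_prop) (s := univ) isCompact_univ
    simpa using this
  have h1 := intervalIntegral.integral_hasDerivAt_right (a := 0) (b := r)
    (f := fun t => t ^ (Module.finrank ℝ E - 1) * ∫ w : sphere (0:E) 1, f (t • (w : E)) ∂μ.toSphere)
    (Continuous.intervalIntegrable (by fun_prop) _ _)
    (Continuous.stronglyMeasurableAtFilter (by fun_prop) _ _) (Continuous.continuousAt (by fun_prop))
  refine (h1.congr_of_eventuallyEq ?_).differentiableAt
  filter_upwards [lt_mem_nhds hr] with x hx
  exact polar_ball hf hfc hx

/-- comparison of derivatives of ball integrals -/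
theorem deriv_le_ball {f g : E → ℝ} {m : ℝ} (hf : Integrable f μ) (hg : Integrable g μ)
    (hfg : ∀ᵐ y ∂μ, f y ≤ m * g y) {r f' g' : ℝ}
    (hf' : HasDerivAt (fun r => ∫ y in ball 0 r, f y ∂μ) f' r)
    (hg' : HasDerivAt (fun r => ∫ y in ball 0 r, g y ∂μ) g' r) : f' ≤ m * g' := by
  have h := (hg'.const_mul m).sub hf'
  have := h.nonneg_of_monotone (by
    intro s t hst
    have e : ∀ s, ((fun y => m * ∫ (y : E) in ball 0 y, g y ∂μ) - fun r => ∫ (y : E) in ball 0 r, f y ∂μ) s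
        = ∫ y in ball 0 s, (m * g y - f y) ∂μ := by
      intro s
      rw [integral_sub (hg.const_mul m).integrableOn hf.integrableOn, integral_const_mul]
      rfl
    rw [e, e]
    apply setIntegral_mono_set ((hg.const_mul m).sub hf).integrableOn
    · exact ae_restrict_of_ae (hfg.mono fun y hy => by simpa using hy)
    · exact (ball_subset_ball hst).eventuallyLE)
  linarith

theorem deriv_nonneg_ball {f : E → ℝ} (hf : Integrable f μ)
    (hfg : ∀ y, 0 ≤ f y) {r : ℝ}  : 0 ≤ deriv (fun r => ∫ y in ball 0 r, f y ∂μ) r := by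
  by_cases h : DifferentiableAt ℝ (fun r => ∫ y in ball 0 r, f y ∂μ) r
  · have := deriv_le_ball (μ := μ) (f := fun _ => 0) (m := 1) (f' := 0) (integrable_zero _ _ _) hf (by simpa using Filter.Eventually.of_forall hfg)
      (by simpa using hasDerivAt_const r (0:ℝ)) h.hasDerivAt
    linarith
  · rw [deriv_zero_of_not_differentiableAt h]

end core7
end part7

section part8
open scoped Convolution RealInnerProductSpace


section core8
variable {E : Type*} [NormedAddCommGroup E] [InnerProductSpace ℝ E] [FiniteDimensional ℝ E]
  [MeasurableSpace E] [BorelSpace E] {μ : Measure E} [μ.IsAddHaarMeasure]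
variable {a : E → E →L[ℝ] E} {v : E → ℝ} {p : E → E} {lam : ℝ} {K : ℝ≥0} {ρ : ℝ} {G G' : E →L[ℝ] E}
  {k : ℕ}

theorem GH.one (hl : 1 ≤ lam) : GH (ContinuousLinearMap.id ℝ E) lam where
  lam1 := hl
  symm := fun u w => rfl
  ell := fun u => by
    simp only [ContinuousLinearMap.id_apply, real_inner_self_eq_norm_sq]
    nlinarith [sq_nonneg ‖u‖]
  nrm := ContinuousLinearMap.norm_id_le.trans hl

theorem CoreH.H_mono (h : CoreH μ a v p lam K ρ) (hG : GH G lam) {r s : ℝ} (hr : 0 < r) (hrs : r ≤ s) :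
    Hf μ a G v r ≤ Hf μ a G v s := by
  apply setIntegral_mono_set (h.muv_int hG).integrableOn
  · exact Filter.Eventually.of_forall fun y => mul_nonneg (h.mu_nonneg hG y) (sq_nonneg _)
  · apply HasSubset.Subset.eventuallyLE
    intro y hy
    simp only [Sg, mem_setOf_eq] at *
    nlinarith

theorem CoreH.H_comp [Nontrivial E] (h : CoreH μ a v p lam K ρ) (hG : GH G lam) (hG' : GH G' lam) {r : ℝ} (hr : 0 < r) :
    Hf μ a G v r ≤ lam ^ 8 * Hf μ a G' v (lam ^ 2 * r) := by
  have l1 := h.lam1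
  have l0 : 0 < lam := by linarith
  have hsub : Sg G r ⊆ Sg G' (lam ^ 2 * r) := by
    intro y hy
    have h1 := hG.q_lt hr.le hy
    have h2 := hG'.q_le y
    simp only [Sg, mem_setOf_eq]
    have h3 : ‖y‖ ^ 2 < (lam * r) ^ 2 := by gcongr
    calc ⟪G' y, y⟫ ≤ lam * ‖y‖ ^ 2 := h2
      _ < lam * (lam * r) ^ 2 := by gcongr
      _ = lam ^ 3 * r ^ 2 := by ring
      _ ≤ lam ^ 4 * r ^ 2 := by gcongr <;> norm_num
      _ = (lam ^ 2 * r) ^ 2 := by ring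
  rw [Hf, Hf, ← integral_const_mul]
  calc ∫ y in Sg G r, muf a G y * v y ^ 2 ∂μ ≤ ∫ y in Sg G r, lam ^ 8 * (muf a G' y * v y ^ 2) ∂μ := by
        apply setIntegral_mono_ae (h.muv_int hG).integrableOn ((h.muv_int hG').const_mul _).integrableOn
        have : ∀ᵐ y ∂μ, y ≠ 0 := by
          rw [ae_iff]; simp
        filter_upwards [this] with y hy
        have h1 := h.mu_upper hG y
        have h2 := h.mu_lower hG' hy
        rw [← mul_assoc]
        gcongr
        calc muf a G y ≤ lam ^ 4 * 1 := by linarith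
          _ ≤ lam ^ 4 * (lam ^ 4 * muf a G' y) := by gcongr
          _ = _ := by ring
    _ ≤ _ := by
        apply setIntegral_mono_set ((h.muv_int hG').const_mul _).integrableOn
        · exact Filter.Eventually.of_forall fun y => mul_nonneg (by positivity) (mul_nonneg (h.mu_nonneg hG' y) (sq_nonneg _))
        · exact hsub.eventuallyLE

theorem FP_of {H I : ℝ → ℝ} {k r H' I' c c1 c2 : ℝ} (h1 : HasDerivAt H H' r) (h2 : HasDerivAt I I' r)
   (h3 : |r*H' - k*H r - I r| ≤ c1*H r) (h4 : I r^2 ≤ H r*(r*I' - k*I r + c2*I r)) (hH : 0 ≤ H r)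
   (hI : 0 ≤ I r) (hc1 : c1 ≤ c) (hc2 : c2 ≤ c) : FP H I k c r := by
  refine ⟨H', I', h1, h2, h3.trans (by gcongr), h4.trans ?_, hI⟩
  gcongr

theorem core_final [Nontrivial E] (b : OrthonormalBasis (Fin k) ℝ E) {lam : ℝ} (hlam : 1 ≤ lam) (K : ℝ≥0)
    {ρ : ℝ} (hρ : 0 < ρ) :
    ∃ T > 0, T ≤ ρ ∧ ∃ c ≥ 0, ∃ C1 > 0, ∃ C2 > 0, ∀ (a : E → E →L[ℝ] E) (v : E → ℝ) (p : E → E) (G : E →L[ℝ] E),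
      CoreH μ a v p lam K ρ → GH G lam → (a 0).comp G = ContinuousLinearMap.id ℝ E →
      (∀ r ∈ Ioo 0 T, FP (Hf μ a (ContinuousLinearMap.id ℝ E) v) (If μ a (ContinuousLinearMap.id ℝ E) p) k c r) ∧
      ∀ r1 r2, 0 < r1 → r1 ≤ r2 → r2 < T → 0 < Hf μ a (ContinuousLinearMap.id ℝ E) v r1 →
        If μ a (ContinuousLinearMap.id ℝ E) p r1 / Hf μ a (ContinuousLinearMap.id ℝ E) v r1 ≤ C1 +
          C2 * (If μ a (ContinuousLinearMap.id ℝ E) p r2 / Hf μ a (ContinuousLinearMap.id ℝ E) v r2) := by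
  have l0 : 0 < lam := by linarith
  have K0 : (0:ℝ) ≤ K := K.2
  set M : ℝ := (49 + 24 * k) * lam ^ 11 with hM
  have hM0 : 0 ≤ M := by positivity
  have hM2 : 4 * k * lam ^ 6 ≤ M := by
    have : lam ^ 6 ≤ lam ^ 11 := pow_le_pow_right₀ hlam (by norm_num)
    calc 4 * k * lam ^ 6 ≤ (49 + 24 * k) * lam ^ 11 := by
          gcongr; have : (0:ℝ) ≤ k := by positivity
          linarith
      _ = M := rfl
  set c : ℝ := M * (2 * lam + 2 * K * lam ^ 2) with hc
  have hc0 : 0 ≤ c := by positivity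
  obtain ⟨C1, hC1, C2, hC2, hch⟩ := chain k c (lam ^ 8) (lam ^ 2) (by positivity) hc0 (one_le_pow₀ hlam) (one_le_pow₀ hlam)
  set T : ℝ := min (min 1 (ρ / (2 * lam))) (1 / (K * lam + 1)) with hT
  have T1 : T ≤ 1 := (min_le_left _ _).trans (min_le_left _ _)
  have T2 : T ≤ ρ / (2 * lam) := (min_le_left _ _).trans (min_le_right _ _)
  have T3 : T ≤ 1 / (K * lam + 1) := min_le_right _ _
  refine ⟨T, by positivity, T2.trans (div_le_self hρ.le (by linarith)), c, hc0, C1, hC1, C2, hC2, ?_⟩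
  intro a v p G h hG haG
  have h1 := GH.one (E := E) hlam
  have fe : ∀ r ∈ Ioo 0 T, FP (Hf μ a (ContinuousLinearMap.id ℝ E) v) (If μ a (ContinuousLinearMap.id ℝ E) p) k c r ∧
      FP (Hf μ a G v) (If μ a G p) k (c * r) r := by
    rintro r ⟨hr, hrT⟩
    have a1 : lam * r < 2 * lam * r := by nlinarith
    have a2 : 2 * lam * r ≤ ρ := by
      have := hrT.le.trans T2
      rw [le_div_iff₀ (by positivity)] at this; linarith
    have a3 : K * lam * (2 * lam * r) ≤ 2 * lam := by
      have := hrT.le.trans T3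
      rw [le_div_iff₀ (by positivity)] at this
      nlinarith
    constructor
    · obtain ⟨H', I', d1, d2, d3, d4⟩ := h.core_ineq b h1 (β := 2 * lam) hr a1 a2 le_rfl (by positivity)
        (by
          intro y hy
          rw [ContinuousLinearMap.comp_id]
          refine (norm_sub_le _ _).trans ?_
          have := h.nrm y
          have := ContinuousLinearMap.norm_id_le (𝕜 := ℝ) (E := E)
          linarith) a3
      refine FP_of d1 d2 d3 d4 (h.H_nonneg h1 r) (h.I_nonneg h1 r) ?_ ?_
      · rw [hc]; gcongr; linarith [show 0 ≤ 2 * (K:ℝ) * lam ^ 2 by positivity]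
      · rw [hc]; gcongr; linarith [show 0 ≤ 2 * (K:ℝ) * lam ^ 2 by positivity]
    · obtain ⟨H', I', d1, d2, d3, d4⟩ := h.core_ineq b hG (β := K * lam * (2 * lam * r)) hr a1 a2 a3 (by positivity)
        (by
          intro y hy
          rw [← haG, ← ContinuousLinearMap.sub_comp]
          refine (ContinuousLinearMap.opNorm_comp_le _ _).trans ?_
          have e1 := h.lip.norm_sub_le y 0
          rw [sub_zero] at e1
          rw [mem_ball_zero_iff] at hy
          calc ‖a y - a 0‖ * ‖G‖ ≤ (K * ‖y‖) * lam := by gcongr; exact hG.nrm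
            _ ≤ (K * (2 * lam * r)) * lam := by gcongr
            _ = _ := by ring) le_rfl
      have e : M * (K * lam * (2 * lam * r)) ≤ c * r := by
        rw [hc]; nlinarith [mul_nonneg (mul_nonneg hM0 l0.le) hr.le]
      refine FP_of d1 d2 d3 d4 (h.H_nonneg hG r) (h.I_nonneg hG r) ?_ e
      refine le_trans ?_ e
      gcongr
  refine ⟨fun r hr => (fe r hr).1, ?_⟩
  exact hch _ _ _ _ T T1 (fun r hr => (fe r hr).1) (fun r hr => (fe r hr).2)
    (fun r s => h.H_mono h1) (fun r s => h.H_mono hG) (fun r hr => h.H_comp h1 hG hr) (fun r hr => h.H_comp hG h1 hr)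

/-- final frequency comparison -/
theorem core_freq [Nontrivial E] (b : OrthonormalBasis (Fin k) ℝ E) {lam : ℝ} (hlam : 1 ≤ lam) (K : ℝ≥0)
    {ρ : ℝ} (hρ : 0 < ρ) :
    ∃ T > 0, T ≤ ρ ∧ ∃ C1 > 0, ∃ C2 > 0, ∀ (a : E → E →L[ℝ] E) (v : E → ℝ) (p : E → E) (G : E →L[ℝ] E)
      (g : E → ℝ),
      CoreH μ a v p lam K ρ → GH G lam → (a 0).comp G = ContinuousLinearMap.id ℝ E →
      Continuous g → (∀ y, g y ≤ lam) → (∀ y, 1 ≤ lam * g y) →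
      ∀ r1 r2, 0 < r1 → r1 ≤ r2 → r2 < T →
        r1 * deriv (fun r => ∫ y in ball 0 r, g y * v y ^ 2 ∂μ) r1 / (∫ y in ball 0 r1, g y * v y ^ 2 ∂μ) ≤
        C1 + C2 * (r2 * deriv (fun r => ∫ y in ball 0 r, g y * v y ^ 2 ∂μ) r2 / (∫ y in ball 0 r2, g y * v y ^ 2 ∂μ)) := by
  have l0 : 0 < lam := by linarith
  obtain ⟨T, hT, hTρ, c, hc, C1, hC1, C2, hC2, hmain⟩ := core_final (μ := μ) b hlam K hρ
  set m := lam ^ 5 with hm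
  have m0 : 0 < m := by positivity
  refine ⟨T, hT, hTρ, m ^ 2 * (k + c + C1 + C2 * c), by positivity, m ^ 4 * C2, by positivity, ?_⟩
  intro a v p G g h hG haG hg hgu hgl r1 r2 hr1 hr12 hr2
  obtain ⟨hF, hN⟩ := hmain a v p G h hG haG
  have h1 := GH.one (E := E) hlam
  have hr2p : 0 < r2 := by linarith
  set J : E →L[ℝ] E := ContinuousLinearMap.id ℝ E
  set f1 : E → ℝ := fun y => g y * v y ^ 2 with hf1
  set f2 : E → ℝ := fun y => muf a J y * v y ^ 2 with hf2
  have i1 : Integrable f1 μ := h.v2_int hg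
  have i2 : Integrable f2 μ := h.muv_int h1
  have g0 : ∀ y, 0 ≤ g y := fun y => by
    by_contra hcc
    push Not at hcc
    nlinarith [hgl y, mul_neg_of_pos_of_neg l0 hcc]
  have f10 : ∀ y, 0 ≤ f1 y := fun y => mul_nonneg (g0 y) (sq_nonneg _)
  have f20 : ∀ y, 0 ≤ f2 y := fun y => mul_nonneg (h.mu_nonneg h1 y) (sq_nonneg _)
  have ne : ∀ᵐ y ∂μ, y ≠ 0 := by rw [ae_iff]; simp
  have c12 : ∀ᵐ y ∂μ, f1 y ≤ m * f2 y := by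
    filter_upwards [ne] with y hy
    simp only [hf1, hf2]
    rw [← mul_assoc]
    gcongr
    calc g y ≤ lam * 1 := by linarith [hgu y]
      _ ≤ lam * (lam ^ 4 * muf a J y) := by gcongr; exact h.mu_lower h1 hy
      _ = _ := by rw [hm]; ring
  have c21 : ∀ᵐ y ∂μ, f2 y ≤ m * f1 y := by
    filter_upwards [ne] with y hy
    simp only [hf1, hf2]
    rw [← mul_assoc]
    gcongr
    calc muf a J y ≤ lam ^ 4 * 1 := by linarith [h.mu_upper h1 y]
      _ ≤ lam ^ 4 * (lam * g y) := by gcongr; exact hgl y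
      _ = _ := by rw [hm]; ring
  have hball : ∀ r, 0 < r → Hf μ a J v r = ∫ y in ball 0 r, f2 y ∂μ := by
    intro r hr
    have : Sg J r = ball 0 r := by
      ext y
      simp only [Sg, mem_setOf_eq, mem_ball_zero_iff, J, ContinuousLinearMap.id_apply, real_inner_self_eq_norm_sq]
      exact pow_lt_pow_iff_left₀ (norm_nonneg _) hr.le (by norm_num)
    rw [Hf, this]
  set Φ1 : ℝ → ℝ := fun r => ∫ y in ball 0 r, f1 y ∂μ with hΦ1
  have e12 : ∀ r, 0 < r → Φ1 r ≤ m * Hf μ a J v r := fun r hr => by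
    rw [hball r hr, ← integral_const_mul]
    exact integral_mono_ae i1.integrableOn (i2.const_mul m).integrableOn (ae_restrict_of_ae c12)
  have e21 : ∀ r, 0 < r → Hf μ a J v r ≤ m * Φ1 r := fun r hr => by
    rw [hball r hr, hΦ1]
    simp only
    rw [← integral_const_mul]
    exact integral_mono_ae i2.integrableOn (i1.const_mul m).integrableOn (ae_restrict_of_ae c21)
  have d1 : ∀ r, 0 ≤ deriv Φ1 r := fun r => deriv_nonneg_ball i1 f10
  have p1 : ∀ r, 0 ≤ Φ1 r := fun r => integral_nonneg f10
  have D2 : ∀ r ∈ Ioo 0 T, ∀ H', HasDerivAt (Hf μ a J v) H' r → HasDerivAt (fun r => ∫ y in ball 0 r, f2 y ∂μ) H' r := by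
    intro r hr H' hH'
    refine hH'.congr_of_eventuallyEq ?_
    filter_upwards [lt_mem_nhds hr.1] with x hx
    exact (hball x hx).symm
  have cf1 : Continuous f1 := hg.mul (h.hv.continuous.pow 2)
  have sf1 : HasCompactSupport f1 := by
    apply h.hvc.mono
    intro y hy hc
    exact hy (by simp [hf1, hc])
  have D1 : ∀ r ∈ Ioo 0 T, HasDerivAt Φ1 (deriv Φ1 r) r := fun r hr => (polar_diff cf1 sf1 hr.1).hasDerivAt
  show r1 * deriv Φ1 r1 / Φ1 r1 ≤ _ + _ * (r2 * deriv Φ1 r2 / Φ1 r2)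
  have rhs : 0 ≤ r2 * deriv Φ1 r2 / Φ1 r2 := div_nonneg (mul_nonneg hr2p.le (d1 _)) (p1 _)
  rcases (p1 r1).eq_or_lt with h0 | h0
  · rw [← h0, div_zero]; positivity
  have q1 : 0 < Hf μ a J v r1 := by
    have := e12 r1 hr1
    by_contra hcc
    push Not at hcc
    nlinarith [mul_nonpos_of_nonneg_of_nonpos m0.le hcc]
  have q2 : 0 < Hf μ a J v r2 := lt_of_lt_of_le q1 (h.H_mono h1 hr1 hr12)
  have z2 : 0 < Φ1 r2 := by
    have := e21 r2 hr2p
    by_contra hcc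
    push Not at hcc
    nlinarith [mul_nonpos_of_nonneg_of_nonpos m0.le hcc]
  have mN := hN r1 r2 hr1 hr12 hr2 q1
  have m1 : r1 ∈ Ioo 0 T := ⟨hr1, by linarith⟩
  have m2 : r2 ∈ Ioo 0 T := ⟨hr2p, hr2⟩
  obtain ⟨H1, -, a1, -, a3, -, a5⟩ := hF r1 m1
  obtain ⟨H2, -, b1, -, b3, -, b5⟩ := hF r2 m2
  have x1 : deriv Φ1 r1 ≤ m * H1 := deriv_le_ball i1 i2 c12 (D1 r1 m1) (D2 r1 m1 _ a1)
  have x2 : H2 ≤ m * deriv Φ1 r2 := deriv_le_ball i2 i1 c21 (D2 r2 m2 _ b1) (D1 r2 m2)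
  set N1 := If μ a J p r1 / Hf μ a J v r1 with hN1
  set N2 := If μ a J p r2 / Hf μ a J v r2 with hN2
  have y1 : r1 * H1 / Hf μ a J v r1 ≤ k + c + N1 := by
    rw [div_le_iff₀ q1, add_mul, hN1, div_mul_cancel₀ _ q1.ne']
    linarith [(abs_le.1 a3).2]
  have y2 : N2 ≤ r2 * H2 / Hf μ a J v r2 + c := by
    rw [hN2, ← sub_le_iff_le_add, le_div_iff₀ q2, sub_mul, div_mul_cancel₀ _ q2.ne']
    have : 0 ≤ k * Hf μ a J v r2 := by positivity
    linarith [(abs_le.1 b3).1]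
  have w1 : r1 * deriv Φ1 r1 / Φ1 r1 ≤ m ^ 2 * (r1 * H1 / Hf μ a J v r1) := by
    rw [div_le_iff₀ h0]
    have hH1 : 0 ≤ H1 := nonneg_of_mul_nonneg_right (le_trans (d1 r1) x1) m0
    have t1 := e21 r1 hr1
    calc r1 * deriv Φ1 r1 ≤ r1 * (m * H1) := by gcongr
      _ = m * (r1 * H1 / Hf μ a J v r1) * Hf μ a J v r1 := by field_simp
      _ ≤ m * (r1 * H1 / Hf μ a J v r1) * (m * Φ1 r1) := by gcongr
      _ = _ := by ring
  have w2 : r2 * H2 / Hf μ a J v r2 ≤ m ^ 2 * (r2 * deriv Φ1 r2 / Φ1 r2) := by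
    rw [div_le_iff₀ q2]
    have t1 := e12 r2 hr2p
    calc r2 * H2 ≤ r2 * (m * deriv Φ1 r2) := by gcongr
      _ = m * (r2 * deriv Φ1 r2 / Φ1 r2) * Φ1 r2 := by field_simp
      _ ≤ m * (r2 * deriv Φ1 r2 / Φ1 r2) * (m * Hf μ a J v r2) := by
        gcongr
      _ = _ := by ring
  calc r1 * deriv Φ1 r1 / Φ1 r1 ≤ m ^ 2 * (r1 * H1 / Hf μ a J v r1) := w1
    _ ≤ m ^ 2 * (k + c + (C1 + C2 * (m ^ 2 * (r2 * deriv Φ1 r2 / Φ1 r2) + c))) := by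
      gcongr
      refine y1.trans ?_
      gcongr
      refine mN.trans ?_
      gcongr
      linarith
    _ = _ := by ring

end core8
end part8

section core9
set_option linter.all false
open scoped Convolution RealInnerProductSpace

theorem inv_GH {E : Type*} [NormedAddCommGroup E] [InnerProductSpace ℝ E] [FiniteDimensional ℝ E]
    (T : E →L[ℝ] E) {Λ n : ℝ} (hΛ : 1 ≤ Λ) (hn : 1 ≤ n)
    (symm : ∀ u w, ⟪T u, w⟫ = ⟪u, T w⟫) (ell : ∀ u, ‖u‖ ^ 2 ≤ Λ * ⟪T u, u⟫) (nrm : ‖T‖ ≤ n) :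
    ∃ G : E →L[ℝ] E, GH G (n ^ 2 * Λ) ∧ T.comp G = ContinuousLinearMap.id ℝ E := by
  have hinj : Function.Injective (T : E →ₗ[ℝ] E) := by
    rw [← LinearMap.ker_eq_bot, LinearMap.ker_eq_bot']
    intro u hu
    have h1 := ell u
    have h2 : T u = 0 := hu
    rw [h2, inner_zero_left, mul_zero] at h1
    have : ‖u‖ = 0 := by nlinarith [norm_nonneg u]
    exact norm_eq_zero.1 this
  set e := LinearEquiv.ofInjectiveEndo (T : E →ₗ[ℝ] E) hinj with he
  set G : E →L[ℝ] E := LinearMap.toContinuousLinearMap (e.symm : E →ₗ[ℝ] E) with hG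
  have TG : ∀ u, T (G u) = u := by
    intro u
    have := e.apply_symm_apply u
    exact this
  have gn : ∀ u, ‖G u‖ ≤ Λ * ‖u‖ := by
    intro u
    have h1 := ell (G u)
    rw [TG] at h1
    have h2 := real_inner_le_norm u (G u)
    by_contra hc
    push Not at hc
    have h4 : 0 ≤ Λ * ‖u‖ := by positivity
    have h3 : 0 < ‖G u‖ := by linarith
    have : Λ * ⟪u, G u⟫ ≤ Λ * (‖u‖ * ‖G u‖) := by gcongr
    nlinarith
  refine ⟨G, ⟨?_, ?_, ?_, ?_⟩, ?_⟩
  · exact one_le_mul_of_one_le_of_one_le (one_le_pow₀ hn) hΛ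
  · intro u w
    have := symm (G u) (G w)
    rw [TG, TG] at this
    exact this.symm
  · intro u
    have h1 := ell (G u)
    rw [TG] at h1
    have h2 : ‖u‖ ≤ n * ‖G u‖ := by
      calc ‖u‖ = ‖T (G u)‖ := by rw [TG]
        _ ≤ ‖T‖ * ‖G u‖ := T.le_opNorm _
        _ ≤ _ := by gcongr
    calc ‖u‖ ^ 2 ≤ (n * ‖G u‖) ^ 2 := by gcongr
      _ = n ^ 2 * ‖G u‖ ^ 2 := by ring
      _ ≤ n ^ 2 * (Λ * ⟪u, G u⟫) := by gcongr
      _ = _ := by rw [real_inner_comm]; ring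
  · refine G.opNorm_le_bound (by positivity) fun u => (gn u).trans ?_
    gcongr
    exact le_mul_of_one_le_left (by linarith) (one_le_pow₀ hn)
  · ext1 u
    exact TG u

variable {k : ℕ}

def mC (M : Matrix (Fin k) (Fin k) ℝ) : Euc k →L[ℝ] Euc k := Matrix.toEuclideanCLM (𝕜 := ℝ) M

theorem mC_apply (M : Matrix (Fin k) (Fin k) ℝ) (u : Euc k) (i : Fin k) :
    mC M u i = ∑ j, M i j * u j := by
  simp only [mC]
  rw [Matrix.ofLp_toEuclideanCLM]
  rfl

theorem mC_inner (M : Matrix (Fin k) (Fin k) ℝ) (u w : Euc k) :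
    ⟪mC M u, w⟫ = aForm M (fun i => u i) (fun i => w i) := by
  rw [PiLp.inner_apply]
  simp only [aForm, mC_apply, RCLike.inner_apply, conj_trivial]
  refine Finset.sum_congr rfl fun i _ => ?_
  rw [mul_comm, Finset.sum_mul]

theorem mC_sub (M N : Matrix (Fin k) (Fin k) ℝ) : mC (M - N) = mC M - mC N := map_sub _ _ _

theorem coord_le (u : Euc k) (i : Fin k) : |u i| ≤ ‖u‖ := by
  simpa using PiLp.norm_apply_le u i

theorem norm_le_coord (u : Euc k) {c : ℝ} (hc : 0 ≤ c) (h : ∀ i, |u i| ≤ c) : ‖u‖ ≤ k * c := by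
  rw [EuclideanSpace.norm_eq]
  apply Real.sqrt_le_iff.2
  refine ⟨by positivity, ?_⟩
  rcases Nat.eq_zero_or_pos k with h0 | h0
  · subst h0; simp
  calc ∑ i, ‖u i‖ ^ 2 ≤ ∑ i : Fin k, c ^ 2 := by
        refine Finset.sum_le_sum fun i _ => ?_
        have := h i
        rw [Real.norm_eq_abs]; gcongr
    _ = k * c ^ 2 := by simp
    _ ≤ (k * c) ^ 2 := by
        rw [mul_pow]; gcongr
        exact_mod_cast Nat.le_self_pow (by norm_num) k

theorem mC_norm (M : Matrix (Fin k) (Fin k) ℝ) {c : ℝ} (hc : 0 ≤ c) (h : ∀ i j, |M i j| ≤ c) :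
    ‖mC M‖ ≤ k ^ 2 * c := by
  refine ContinuousLinearMap.opNorm_le_bound _ (by positivity) fun u => ?_
  have : ∀ i, |mC M u i| ≤ k * (c * ‖u‖) := by
    intro i
    rw [mC_apply]
    refine (Finset.abs_sum_le_sum_abs _ _).trans ?_
    calc ∑ j, |M i j * u j| ≤ ∑ j : Fin k, c * ‖u‖ := by
          refine Finset.sum_le_sum fun j _ => ?_
          rw [abs_mul]
          exact mul_le_mul (h i j) (coord_le u j) (abs_nonneg _) hc
      _ = _ := by simp
  refine (norm_le_coord _ (by positivity) this).trans (le_of_eq ?_)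
  ring

/-- cube retraction -/
def ret (δ : ℝ) (y : Euc k) : Euc k := WithLp.toLp 2 fun i => max (-δ) (min δ (y i))

theorem ret_apply (δ : ℝ) (y : Euc k) (i : Fin k) : ret δ y i = max (-δ) (min δ (y i)) := rfl

theorem ret_lip (δ : ℝ) (y z : Euc k) : ‖ret δ y - ret δ z‖ ≤ ‖y - z‖ := by
  rw [EuclideanSpace.norm_eq, EuclideanSpace.norm_eq]
  apply Real.sqrt_le_sqrt
  refine Finset.sum_le_sum fun i _ => ?_
  gcongr
  simp only [PiLp.sub_apply, ret_apply, Real.norm_eq_abs]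
  have h1 := abs_max_sub_max_le_abs (min δ (y i)) (min δ (z i)) (-δ)
  have h2 := abs_min_sub_min_le_max δ (y i) δ (z i)
  rw [max_comm (-δ), max_comm (-δ)]
  refine h1.trans (h2.trans ?_)
  simp

theorem ret_cont (δ : ℝ) : Continuous (ret (k := k) δ) := by
  have : LipschitzWith 1 (ret (k := k) δ) := LipschitzWith.of_dist_le_mul fun y z => by
    rw [dist_eq_norm, dist_eq_norm]; simpa using ret_lip δ y z
  exact this.continuous

theorem ret_norm {δ : ℝ} (hδ : 0 ≤ δ) (y : Euc k) : ‖ret δ y‖ ≤ k * δ := by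
  apply norm_le_coord _ hδ
  intro i
  rw [ret_apply, abs_le]
  exact ⟨le_max_left _ _, max_le (by linarith) (min_le_left _ _)⟩

theorem ret_id {δ : ℝ} {y : Euc k} (hy : ‖y‖ ≤ δ) : ret δ y = y := by
  ext i
  have := abs_le.1 ((coord_le y i).trans hy)
  rw [ret_apply, min_eq_right this.2, max_eq_right this.1]

theorem fderiv_coord (f : Euc k →L[ℝ] ℝ) (u : Euc k) :
    f u = ∑ i, u i * f (EuclideanSpace.single i 1) := by
  conv_lhs => rw [← (EuclideanSpace.basisFun (Fin k) ℝ).sum_repr u]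
  rw [map_sum]
  simp

variable {A : Euc k → Matrix (Fin k) (Fin k) ℝ} {L : ℝ≥0} {Λ : ℝ} {v : Euc k → ℝ} {x : Euc k}

theorem entry_lip (hL : LipEntries A L (ball 0 1)) {y z : Euc k} (hy : y ∈ ball (0 : Euc k) 1) (hz : z ∈ ball (0 : Euc k) 1)
    (i j) : |(A y - A z) i j| ≤ L * ‖y - z‖ := by
  have := (hL i j).dist_le_mul y hy z hz
  rwa [Real.dist_eq, dist_eq_norm] at this

theorem mC_lip (hL : LipEntries A L (ball 0 1)) {y z : Euc k} (hy : y ∈ ball (0 : Euc k) 1) (hz : z ∈ ball (0 : Euc k) 1) :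
    ‖mC (A y) - mC (A z)‖ ≤ k ^ 2 * L * ‖y - z‖ := by
  rw [← mC_sub]
  refine (mC_norm _ (by positivity) (entry_lip hL hy hz)).trans (le_of_eq (by ring))

theorem mC_bound (hL : LipEntries A L (ball 0 1)) (h1 : A 0 = 1) {y : Euc k} (hy : y ∈ ball (0 : Euc k) 1) :
    ‖mC (A y)‖ ≤ k ^ 2 * (1 + L) := by
  refine mC_norm _ (by positivity) fun i j => ?_
  have h2 := entry_lip hL hy (mem_ball_self one_pos) i j
  rw [h1, sub_zero] at h2
  have h3 : |(1 : Matrix (Fin k) (Fin k) ℝ) i j| ≤ 1 := by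
    rw [Matrix.one_apply]; split_ifs <;> simp
  have h4 : ‖y‖ ≤ 1 := (mem_ball_zero_iff.1 hy).le
  have h5 : A y i j = (A y - 1) i j + (1 : Matrix (Fin k) (Fin k) ℝ) i j := by simp
  rw [h5]
  refine (abs_add_le _ _).trans ?_
  have : (L:ℝ) * ‖y‖ ≤ L * 1 := by gcongr
  linarith

theorem sq_sum (u : Euc k) : ∑ i, u i ^ 2 = ‖u‖ ^ 2 := by
  rw [EuclideanSpace.norm_sq_eq]; simp

theorem mC_one (u : Euc k) : mC (1 : Matrix (Fin k) (Fin k) ℝ) u = u := by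
  simp [mC]

theorem alpha_eq {z : Euc k} (hz : z ≠ 0) : alphaFn A z = ⟪mC (A z) z, z⟫ / ‖z‖ ^ 2 := by
  rw [alphaFn, if_neg hz, mC_inner]

theorem alpha_cont (hL : LipEntries A L (ball 0 1)) (h1 : A 0 = 1) : ContinuousOn (alphaFn A) (ball 0 1) := by
  have hc : ContinuousOn (fun z => mC (A z)) (ball 0 1) := by
    have : LipschitzOnWith (k ^ 2 * L) (fun z => mC (A z)) (ball 0 1) :=
      LipschitzOnWith.of_dist_le_mul fun y hy z hz => by
        rw [dist_eq_norm, dist_eq_norm]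
        simpa using mC_lip hL hy hz
    exact this.continuousOn
  intro z hz
  by_cases h0 : z = 0
  · subst h0
    have key : ∀ y ∈ ball (0 : Euc k) 1, ‖alphaFn A y - alphaFn A 0‖ ≤ k ^ 2 * L * ‖y‖ := by
      intro y hy
      by_cases hy0 : y = 0
      · subst hy0; simp
      have hp : 0 < ‖y‖ ^ 2 := by have := norm_pos_iff.2 hy0; positivity
      rw [alpha_eq hy0, alphaFn, if_pos rfl]
      have e : ⟪mC (A y) y, y⟫ / ‖y‖ ^ 2 - 1 = ⟪(mC (A y) - mC (A 0)) y, y⟫ / ‖y‖ ^ 2 := by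
        rw [h1]
        simp only [ContinuousLinearMap.sub_apply, inner_sub_left, mC_one, real_inner_self_eq_norm_sq]
        field_simp
      rw [e, norm_div, Real.norm_of_nonneg hp.le, div_le_iff₀ hp]
      have h2 := mC_lip hL hy (mem_ball_self one_pos)
      rw [sub_zero] at h2
      calc ‖⟪(mC (A y) - mC (A 0)) y, y⟫‖ ≤ ‖(mC (A y) - mC (A 0)) y‖ * ‖y‖ := norm_inner_le_norm _ _
        _ ≤ (‖mC (A y) - mC (A 0)‖ * ‖y‖) * ‖y‖ := by gcongr; exact ContinuousLinearMap.le_opNorm _ _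
        _ ≤ (k ^ 2 * L * ‖y‖ * ‖y‖) * ‖y‖ := by gcongr
        _ = _ := by ring
    rw [ContinuousWithinAt, tendsto_iff_norm_sub_tendsto_zero]
    refine squeeze_zero' (Filter.Eventually.of_forall fun y => norm_nonneg _)
      (g := fun y => k ^ 2 * L * ‖y‖) ?_ ?_
    · filter_upwards [self_mem_nhdsWithin] with y hy using key y hy
    · have : Continuous (fun y : Euc k => k ^ 2 * L * ‖y‖) := by fun_prop
      have := this.tendsto 0
      simp only [norm_zero, mul_zero] at this
      exact this.mono_left nhdsWithin_le_nhds
  · have h2 : ContinuousWithinAt (fun z => ⟪mC (A z) z, z⟫ / ‖z‖ ^ 2) (ball 0 1) z := by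
      refine ContinuousWithinAt.div ?_ (by fun_prop) (by simpa using h0)
      exact ((hc z hz).clm_apply continuousWithinAt_id).inner continuousWithinAt_id
    refine h2.congr_of_eventuallyEq ?_ (alpha_eq h0)
    filter_upwards [mem_nhdsWithin_of_mem_nhds (isOpen_ne.mem_nhds h0)] with y hy using alpha_eq hy

theorem ell_mC (hE : UnifElliptic A Λ (ball 0 1)) (hΛ : 1 ≤ Λ) {z : Euc k} (hz : z ∈ ball (0 : Euc k) 1) (u : Euc k) :
    ‖u‖ ^ 2 ≤ Λ * ⟪mC (A z) u, u⟫ ∧ ⟪mC (A z) u, u⟫ ≤ Λ * ‖u‖ ^ 2 := by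
  have := hE z hz (fun i => u i)
  rw [sq_sum, ← mC_inner] at this
  refine ⟨?_, this.2⟩
  rw [← inv_mul_le_iff₀ (by linarith)]
  exact this.1

theorem alpha_bd (hE : UnifElliptic A Λ (ball 0 1)) (hΛ : 1 ≤ Λ) {z : Euc k} (hz : z ∈ ball (0 : Euc k) 1) :
    alphaFn A z ≤ Λ ∧ 1 ≤ Λ * alphaFn A z := by
  by_cases h0 : z = 0
  · subst h0; simp [alphaFn, hΛ]
  have hp : 0 < ‖z‖ ^ 2 := by have := norm_pos_iff.2 h0; positivity
  have := ell_mC hE hΛ hz z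
  rw [alpha_eq h0, div_le_iff₀ hp, mul_div_assoc', le_div_iff₀ hp, one_mul]
  exact ⟨this.2, this.1⟩

theorem symm_mC {M : Matrix (Fin k) (Fin k) ℝ} (h : M.IsSymm) (u w : Euc k) : ⟪mC M u, w⟫ = ⟪u, mC M w⟫ := by
  rw [real_inner_comm (mC M w) u, mC_inner, mC_inner, aForm, aForm, Finset.sum_comm]
  refine Finset.sum_congr rfl fun i _ => Finset.sum_congr rfl fun j _ => ?_
  rw [h.apply]; ring

end core9

section core10
set_option linter.all false
open scoped Convolution RealInnerProductSpace
variable {k : ℕ}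
variable {A : Euc k → Matrix (Fin k) (Fin k) ℝ} {L : ℝ≥0} {Λ : ℝ} {v : Euc k → ℝ} {x : Euc k}

theorem ball_in {x y : Euc k} (hx : x ∈ ball (0 : Euc k) (1 / 2)) (hy : ‖y‖ < 1 / 2) : x + y ∈ ball (0 : Euc k) 1 := by
  rw [mem_ball_zero_iff] at *
  linarith [norm_add_le x y]

theorem cut_contDiff (hv : ContDiffOn ℝ 1 v (ball 0 1)) (hx : x ∈ ball (0 : Euc k) (1 / 2))
    (χ : ContDiffBump (0 : Euc k)) (hχ : χ.rOut < 1 / 2) :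
    ContDiff ℝ 1 (fun y => χ y * v (x + y)) := by
  rw [contDiff_iff_contDiffAt]
  intro y
  by_cases hy : ‖y‖ < 1 / 2
  · refine χ.contDiff.contDiffAt.mul ?_
    have h1 : ContDiffAt ℝ 1 v (x + y) := hv.contDiffAt (isOpen_ball.mem_nhds (ball_in hx hy))
    exact h1.comp y (contDiffAt_const.add contDiffAt_id)
  · have : (fun y => χ y * v (x + y)) =ᶠ[𝓝 y] fun _ => 0 := by
      have ho : {z : Euc k | χ.rOut < ‖z‖} ∈ 𝓝 y :=
        (isOpen_lt continuous_const continuous_norm).mem_nhds (by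
          simp only [mem_setOf_eq]; push Not at hy; linarith)
      filter_upwards [ho] with z hz
      rw [χ.zero_of_le_dist (by simpa using le_of_lt hz), zero_mul]
    exact contDiffAt_const.congr_of_eventuallyEq this

theorem setup_core (hk : 2 ≤ k) (hΛ : 1 ≤ Λ) (hs : ∀ x ∈ ball (0 : Euc k) 1, (A x).IsSymm)
    (hL : LipEntries A L (ball 0 1)) (hE : UnifElliptic A Λ (ball 0 1)) (h1 : A 0 = 1)
    (hv : ContDiffOn ℝ 1 v (ball 0 1)) (hw : IsWeakSol A v (ball 0 1))
    (hx : x ∈ ball (0 : Euc k) (1 / 2)) {δ : ℝ} (hδ : 0 < δ) (hδk : k * δ < 1 / 2)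
    (χ : ContDiffBump (0 : Euc k)) (hχ : χ.rOut < 1 / 2) (hχi : χ.rIn = δ) {lam : ℝ} (hl1 : 1 ≤ lam)
    (hl2 : Λ ≤ lam) (hl3 : k ^ 2 * (1 + L) ≤ lam) :
    CoreH (volume : Measure (Euc k)) (fun y => mC (A (x + ret δ y))) (fun y => χ y * v (x + y))
      (gradient (fun y => χ y * v (x + y))) lam (k ^ 2 * L) δ := by
  have hin : ∀ y : Euc k, x + ret δ y ∈ ball (0 : Euc k) 1 := fun y =>
    ball_in hx (lt_of_le_of_lt (ret_norm hδ.le y) hδk)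
  have hcd := cut_contDiff hv hx χ hχ
  have hp : ∀ y h, fderiv ℝ (fun y => χ y * v (x + y)) y h = ⟪gradient (fun y => χ y * v (x + y)) y, h⟫ := by
    intro y h
    rw [gradient, InnerProductSpace.toDual_symm_apply]
  refine ⟨hl1, ?_, ?_, ?_, ?_, hcd, ?_, hp, ?_⟩
  · refine LipschitzWith.of_dist_le_mul fun y z => ?_
    rw [dist_eq_norm, dist_eq_norm]
    refine (mC_lip hL (hin y) (hin z)).trans ?_
    push_cast
    gcongr
    rw [add_sub_add_left_eq_sub]
    exact ret_lip δ y z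
  · exact fun y u w => symm_mC (hs _ (hin y)) u w
  · intro y u
    have := ell_mC hE hΛ (hin y) u
    have h2 : 0 ≤ ⟪mC (A (x + ret δ y)) u, u⟫ := by
      by_contra hc
      push Not at hc
      nlinarith [sq_nonneg ‖u‖, mul_neg_of_pos_of_neg (show 0 < Λ by linarith) hc, this.1]
    refine this.1.trans ?_
    gcongr
  · exact fun y => (mC_bound hL h1 (hin y)).trans hl3
  · exact χ.hasCompactSupport.mul_right
  · intro ψ hψ hψc hψs
    set ψ' : Euc k → ℝ := fun z => ψ (z - x) with hψ'
    have fψ : ∀ z, fderiv ℝ ψ' z = fderiv ℝ ψ (z - x) := fun z => by rw [hψ', fderiv_comp_sub]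
    have hts : tsupport ψ' ⊆ ball 0 1 := by
      have : tsupport ψ' ⊆ (fun z => z - x) ⁻¹' (tsupport ψ) := by
        apply closure_minimal
        · intro z hz
          exact subset_tsupport _ hz
        · exact (isClosed_tsupport ψ).preimage (by fun_prop)
      intro z hz
      have h3 := mem_ball_zero_iff.1 (hψs (this hz))
      have h4 : (1:ℝ) ≤ k := by exact_mod_cast (by omega : 1 ≤ k)
      have h5 : ‖z - x‖ < 1 / 2 := by nlinarith
      simpa using ball_in hx h5
    have hwe := hw ψ' (hψ.comp (contDiff_id.sub contDiff_const))
      (by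
        have := hψc.comp_homeomorph (Homeomorph.subRight x)
        exact this) hts
    rw [setIntegral_eq_integral_of_forall_compl_eq_zero] at hwe
    · rw [← integral_add_left_eq_self (μ := volume) _ x] at hwe
      rw [← hwe]
      refine integral_congr_ae (Filter.Eventually.of_forall fun y => ?_)
      simp only
      by_cases hy : y ∈ tsupport ψ
      · have hyb := hψs hy
        have hyn : ‖y‖ < δ := mem_ball_zero_iff.1 hyb
        rw [ret_id hyn.le]
        have hev : (fun y => χ y * v (x + y)) =ᶠ[𝓝 y] fun y => v (x + y) := by
          filter_upwards [isOpen_ball.mem_nhds hyb] with z hz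
          rw [χ.one_of_mem_closedBall (by rw [hχi]; exact ball_subset_closedBall hz), one_mul]
        have gv : ∀ j, gradient (fun y => χ y * v (x + y)) y j = gradVec v (x + y) j := by
          intro j
          have e1 := hp y (EuclideanSpace.single j 1)
          rw [EuclideanSpace.inner_single_right] at e1
          simp only [conj_trivial, one_mul] at e1
          rw [← e1, hev.fderiv_eq, gradVec, fderiv_comp_add_left]
        rw [fderiv_coord, aForm]
        refine Finset.sum_congr rfl fun i _ => ?_
        rw [mC_apply, Finset.sum_mul]
        refine Finset.sum_congr rfl fun j _ => ?_
        rw [gv, gradVec, gradVec, fψ, add_sub_cancel_left]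
      · have h0 : fderiv ℝ ψ y = 0 := by
          by_contra hc
          exact hy (support_fderiv_subset ℝ hc)
        rw [h0]
        simp [aForm, gradVec, fψ, h0]
    · intro z hz
      have h0 : fderiv ℝ ψ' z = 0 := by
        by_contra hc
        exact hz (hts (support_fderiv_subset ℝ hc))
      simp [aForm, gradVec, h0]

theorem Hfun_eq {δ : ℝ} (χ : ContDiffBump (0 : Euc k)) (hχi : χ.rIn = δ) {r : ℝ} (hr : r < δ) :
    Hfun A v x r = ∫ y in ball (0 : Euc k) r, alphaFn A (x + ret δ y) * (χ y * v (x + y)) ^ 2 := by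
  rw [Hfun, ← integral_indicator measurableSet_ball, ← integral_indicator measurableSet_ball,
    ← integral_add_left_eq_self (μ := volume) _ x]
  refine integral_congr_ae (Filter.Eventually.of_forall fun y => ?_)
  simp only
  by_cases hy : ‖y‖ < r
  · rw [indicator_of_mem (by simpa using hy), indicator_of_mem (by simpa using hy), ret_id (by linarith),
      χ.one_of_mem_closedBall (by rw [hχi, mem_closedBall_zero_iff]; linarith), one_mul]
  · rw [indicator_of_notMem (by simpa using hy), indicator_of_notMem (by simpa using hy)]

end core10

/-- Let `v ∈ W^{1,2}_loc(B(0,1))` be a (not identically zero) weak solution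
of `div(A∇v) = 0` in `B = B(0,1) ⊆ ℝᵏ`, where `A` is symmetric, uniformly elliptic with
constant `Λ`, has `L`-Lipschitz entries, and `A(0) = Id`. Then there are constants
`ρ₀, C₁, C₂ > 0`, depending only on `k`, `L` and `Λ`, such that for every `x ∈ B(0,1/2)`
and all radii `0 < 2r₁ < r₂ < ρ₀`, the frequency function satisfies
`N_v(x,r₁) ≤ C₁ + C₂ N_v(x,r₂)`. -/
theorem statement_2 (k : ℕ) (hk : 2 ≤ k) (L : ℝ≥0) (Λ : ℝ) (hΛ : 1 ≤ Λ) :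
    ∃ ρ₀ > (0 : ℝ), ∃ C₁ > (0 : ℝ), ∃ C₂ > (0 : ℝ),
      ∀ A : Euc k → Matrix (Fin k) (Fin k) ℝ,
        (∀ x ∈ ball (0 : Euc k) 1, (A x).IsSymm) →
        LipEntries A L (ball 0 1) →
        UnifElliptic A Λ (ball 0 1) →
        A 0 = 1 →
        ∀ v : Euc k → ℝ,
          ContDiffOn ℝ 1 v (ball 0 1) →
          IsWeakSol A v (ball 0 1) →
          (∃ x ∈ ball (0 : Euc k) 1, v x ≠ 0) →
          ∀ x ∈ ball (0 : Euc k) (1 / 2), ∀ r₁ r₂ : ℝ,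
            0 < r₁ → 2 * r₁ < r₂ → r₂ < ρ₀ →
            freqN A v x r₁ ≤ C₁ + C₂ * freqN A v x r₂ := by
  have hk2 : (2:ℝ) ≤ k := by exact_mod_cast hk
  have hΛ0 : 0 < Λ := by linarith
  set n : ℝ := k ^ 2 * (1 + L) with hn
  have L0 : (0:ℝ) ≤ L := L.2
  have hn1 : 1 ≤ n := by
    rw [hn]; nlinarith [mul_nonneg (sq_nonneg (k:ℝ)) L0]
  set lam : ℝ := n ^ 2 * Λ with hlam
  have n2 : 1 ≤ n ^ 2 := one_le_pow₀ hn1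
  have hl2 : Λ ≤ lam := le_mul_of_one_le_left hΛ0.le n2
  have hl1 : 1 ≤ lam := hΛ.trans hl2
  have hl3 : n ≤ lam := by
    calc n ≤ n ^ 2 := le_self_pow₀ hn1 (by norm_num)
      _ ≤ lam := le_mul_of_one_le_right (by positivity) hΛ
  set δ : ℝ := 1 / (4 * k) with hδd
  have hδ : 0 < δ := by positivity
  have hδk : k * δ < 1 / 2 := by
    rw [hδd]; field_simp; norm_num
  have hδ2 : 2 * δ < 1 / 2 := by nlinarith
  have : Nontrivial (Euc k) := by
    have : Nonempty (Fin k) := ⟨⟨0, by omega⟩⟩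
    infer_instance
  obtain ⟨T, hT, hTδ, C1, hC1, C2, hC2, hmain⟩ := core_freq (μ := (volume : Measure (Euc k)))
    (EuclideanSpace.basisFun (Fin k) ℝ) hl1 (k ^ 2 * L) hδ
  refine ⟨T, hT, C1, hC1, C2, hC2, ?_⟩
  intro A hs hL hE h1 v hv hw _ x hx r₁ r₂ hr1 hr12 hr2
  let χ : ContDiffBump (0 : Euc k) := ⟨δ, 2 * δ, hδ, by linarith⟩
  have hχi : χ.rIn = δ := rfl
  have hC := setup_core hk hΛ hs hL hE h1 hv hw hx hδ hδk χ hδ2 hχi hl1 hl2 hl3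
  have hin : ∀ y : Euc k, x + ret δ y ∈ ball (0 : Euc k) 1 := fun y =>
    ball_in hx (lt_of_le_of_lt (ret_norm hδ.le y) hδk)
  obtain ⟨G, hG, haG⟩ := inv_GH (mC (A (x + ret δ 0))) hΛ hn1 (fun u w => symm_mC (hs _ (hin 0)) u w)
    (fun u => (ell_mC hE hΛ (hin 0) u).1) (mC_bound hL h1 (hin 0))
  have hgc : Continuous (fun y => alphaFn A (x + ret δ y)) :=
    (alpha_cont hL h1).comp_continuous (continuous_const.add (ret_cont δ)) hin
  have hfin := hmain _ _ _ G (fun y => alphaFn A (x + ret δ y)) hC hG haG hgc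
    (fun y => (alpha_bd hE hΛ (hin y)).1.trans hl2)
    (fun y => (alpha_bd hE hΛ (hin y)).2.trans (by
      have := alpha_bd hE hΛ (hin y)
      have : 0 ≤ alphaFn A (x + ret δ y) := by
        by_contra hc
        push Not at hc
        nlinarith [mul_neg_of_pos_of_neg hΛ0 hc]
      gcongr)) r₁ r₂ hr1 (by linarith) hr2
  have key : ∀ r, r < δ → Hfun A v x =ᶠ[𝓝 r]
      fun r => ∫ y in ball (0 : Euc k) r, alphaFn A (x + ret δ y) * (χ y * v (x + y)) ^ 2 := by
    intro r hr
    filter_upwards [gt_mem_nhds hr] with s hs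
    exact Hfun_eq χ hχi hs
  have a1 : r₁ < δ := by linarith
  have a2 : r₂ < δ := by linarith
  rw [freqN, freqN, (key r₁ a1).deriv_eq, (key r₂ a2).deriv_eq, (key r₁ a1).eq_of_nhds, (key r₂ a2).eq_of_nhds]
  exact hfin
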